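/- Existence of moments: Let γ ∈ (0, √(2d)) and let f : D → ℝ be measurable with 0 < c ≤ f(x) ≤ C for all x ∈ D and some constants c, C. Let M be the Gaussian multiplicative chaos measure on D (the in-probability limit of the M_ε). Then for every open Euclidean ball O with compact closure contained in D and every q ∈ ℝ, E[ M(O)^q ] < ∞ if and only if q < 2d/γ² (for q < 0 this in particular asserts that M(O) > 0 almost surely). -/

import Mathlib

open MeasureTheory ProbabilityTheory Filter Topology
open scoped ENNReal NNReal

noncomputable section

variable {d : ℕ}

/-- The rescaled mollifier `θ_ε(x) = ε^{-d} θ(x/ε)`. -/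
def mollifierScaled (θ : EuclideanSpace ℝ (Fin d) → ℝ) (ε : ℝ)
    (x : EuclideanSpace ℝ (Fin d)) : ℝ :=
  (ε ^ d)⁻¹ * θ (ε⁻¹ • x)

/-- A nonnegative smooth mollifier: `C^∞`, compactly supported, nonnegative, total integral 1. -/
def IsMollifier (θ : EuclideanSpace ℝ (Fin d) → ℝ) : Prop :=
  ContDiff ℝ (⊤ : ℕ∞) θ ∧ HasCompactSupport θ ∧ (∀ x, 0 ≤ θ x) ∧ (∫ x, θ x) = 1

/-- The kernel of log-type associated to `g`: `K(x,y) = ln₊(1/|x-y|) + g(x,y)` where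
`ln₊ u = max (ln u) 0`. -/
def logKernel (g : EuclideanSpace ℝ (Fin d) → EuclideanSpace ℝ (Fin d) → ℝ)
    (x y : EuclideanSpace ℝ (Fin d)) : ℝ :=
  max (Real.log (dist x y)⁻¹) 0 + g x y

/-- `g` is bounded and (jointly) measurable. -/
def IsBoundedMeasurable (g : EuclideanSpace ℝ (Fin d) → EuclideanSpace ℝ (Fin d) → ℝ) : Prop :=
  Measurable (Function.uncurry g) ∧ ∃ C, ∀ x y, |g x y| ≤ C

/-- The mollified covariance `K_{ε,ε'}(x,y) = ∫∫ θ₁_ε(u) θ₂_{ε'}(v) K(x-u, y-v) du dv`. -/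
def mollifiedCov (K : EuclideanSpace ℝ (Fin d) → EuclideanSpace ℝ (Fin d) → ℝ)
    (θ₁ θ₂ : EuclideanSpace ℝ (Fin d) → ℝ) (ε ε' : ℝ)
    (x y : EuclideanSpace ℝ (Fin d)) : ℝ :=
  ∫ u, ∫ v, mollifierScaled θ₁ ε u * mollifierScaled θ₂ ε' v * K (x - u) (y - v)

/-- `X = (X(ε,x))` is a jointly measurable family whose finite-dimensional distributions are
centered Gaussian with covariance `E[X(ε,x) X(ε',y)] = Km ε ε' x y` (expressed by requiring
every finite real linear combination to have the appropriate centered Gaussian law). -/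
def IsGaussianFamily {Ω : Type*} [MeasurableSpace Ω] (P : Measure Ω)
    (X : ℝ → EuclideanSpace ℝ (Fin d) → Ω → ℝ)
    (Km : ℝ → ℝ → EuclideanSpace ℝ (Fin d) → EuclideanSpace ℝ (Fin d) → ℝ) : Prop :=
  (Measurable fun p : ℝ × EuclideanSpace ℝ (Fin d) × Ω => X p.1 p.2.1 p.2.2) ∧
  ∀ (n : ℕ) (ε : Fin n → ℝ) (x : Fin n → EuclideanSpace ℝ (Fin d)),
    (∀ i, ε i ∈ Set.Ioc (0 : ℝ) 1) → ∀ l : Fin n → ℝ, ∃ v : ℝ≥0,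
      (v : ℝ) = ∑ i, ∑ j, l i * l j * Km (ε i) (ε j) (x i) (x j) ∧
      Measure.map (fun ω => ∑ i, l i * X (ε i) (x i) ω) P = gaussianReal 0 v

/-- The approximate Gaussian multiplicative chaos measure
`M_ε(A) = ∫_A exp(γ X(ε,x) - (γ²/2) Km ε ε x x) f(x) dx`. -/
def approxGMC {Ω : Type*} (γ : ℝ) (X : ℝ → EuclideanSpace ℝ (Fin d) → Ω → ℝ)
    (Km : ℝ → ℝ → EuclideanSpace ℝ (Fin d) → EuclideanSpace ℝ (Fin d) → ℝ)
    (f : EuclideanSpace ℝ (Fin d) → ℝ) (ε : ℝ) (ω : Ω)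
    (A : Set (EuclideanSpace ℝ (Fin d))) : ℝ :=
  ∫ x in A, Real.exp (γ * X ε x ω - γ ^ 2 / 2 * Km ε ε x x) * f x

/-- `M` is the Gaussian multiplicative chaos measure on `D`: a random Radon measure on `D`
such that `M_ε(A) → M(A)` in probability as `ε → 0` for every Borel `A` with compact closure
contained in `D`. -/
def IsGMCMeasure {Ω : Type*} [MeasurableSpace Ω] (P : Measure Ω) (γ : ℝ)
    (X : ℝ → EuclideanSpace ℝ (Fin d) → Ω → ℝ)
    (Km : ℝ → ℝ → EuclideanSpace ℝ (Fin d) → EuclideanSpace ℝ (Fin d) → ℝ)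
    (f : EuclideanSpace ℝ (Fin d) → ℝ) (D : Set (EuclideanSpace ℝ (Fin d)))
    (M : Ω → Measure (EuclideanSpace ℝ (Fin d))) : Prop :=
  (∀ A : Set (EuclideanSpace ℝ (Fin d)), MeasurableSet A → Measurable fun ω => M ω A) ∧
  (∀ ω, ∀ A : Set (EuclideanSpace ℝ (Fin d)), IsCompact (closure A) → closure A ⊆ D →
    M ω A ≠ ⊤) ∧
  (∀ A : Set (EuclideanSpace ℝ (Fin d)), MeasurableSet A → IsCompact (closure A) →
    closure A ⊆ D →
    TendstoInMeasure P (fun ε ω => approxGMC γ X Km f ε ω A) (𝓝[Set.Ioc (0 : ℝ) 1] 0)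
      fun ω => (M ω A).toReal)

section GaussianSpace

variable {Ω : Type*} [MeasurableSpace Ω]

/-- A linear space of measurable functions, each of which has a centered Gaussian law. -/
structure IsGaussianSpace (P : Measure Ω) (H : Submodule ℝ (Ω → ℝ)) : Prop where
  measurable : ∀ L ∈ H, Measurable L
  law : ∀ L ∈ H, ∃ v : ℝ≥0, P.map L = gaussianReal 0 v

/-- The second mixed moment of two random variables. -/
def mixedMoment (P : Measure Ω) (L N : Ω → ℝ) : ℝ := ∫ ω, L ω * N ω ∂P

/-- The Wick exponential `exp(L - E[L²]/2)`. -/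
def wickExp (P : Measure Ω) (L : Ω → ℝ) (ω : Ω) : ℝ≥0∞ :=
  ENNReal.ofReal (Real.exp (L ω - mixedMoment P L L / 2))

variable {P : Measure Ω} {H : Submodule ℝ (Ω → ℝ)}

lemma mixedMoment_comm (L L' : Ω → ℝ) : mixedMoment P L L' = mixedMoment P L' L := by
  simp only [mixedMoment, mul_comm]

lemma mixedMoment_smul_left (c : ℝ) (L L' : Ω → ℝ) :
    mixedMoment P (c • L) L' = c * mixedMoment P L L' := by
  simp [mixedMoment, mul_assoc, integral_const_mul]

lemma mixedMoment_smul_right (c : ℝ) (L L' : Ω → ℝ) :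
    mixedMoment P L (c • L') = c * mixedMoment P L L' := by
  rw [mixedMoment_comm, mixedMoment_smul_left, mixedMoment_comm]

lemma mixedMoment_self_nonneg (L : Ω → ℝ) : 0 ≤ mixedMoment P L L :=
  integral_nonneg fun ω => mul_self_nonneg (L ω)

namespace IsGaussianSpace

lemma memLp_two (h : IsGaussianSpace P H) {L : Ω → ℝ} (hL : L ∈ H) : MemLp L 2 P := by
  obtain ⟨v, hv⟩ := h.law L hL
  have h2 : MemLp id 2 (P.map L) := by
    rw [hv]; exact memLp_id_gaussianReal 2
  exact (memLp_map_measure_iff (by fun_prop) (h.measurable L hL).aemeasurable).1 h2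

lemma integrable_mul (h : IsGaussianSpace P H) {L L' : Ω → ℝ} (hL : L ∈ H) (hL' : L' ∈ H) :
    Integrable (fun ω => L ω * L' ω) P :=
  (h.memLp_two hL).integrable_mul (h.memLp_two hL')

lemma mixedMoment_add_left (h : IsGaussianSpace P H) {L L' N : Ω → ℝ} (hL : L ∈ H)
    (hL' : L' ∈ H) (hN : N ∈ H) :
    mixedMoment P (L + L') N = mixedMoment P L N + mixedMoment P L' N := by
  simp only [mixedMoment, Pi.add_apply, add_mul]
  exact integral_add (h.integrable_mul hL hN) (h.integrable_mul hL' hN)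

lemma mixedMoment_add_right (h : IsGaussianSpace P H) {L L' N : Ω → ℝ} (hL : L ∈ H)
    (hL' : L' ∈ H) (hN : N ∈ H) :
    mixedMoment P N (L + L') = mixedMoment P N L + mixedMoment P N L' := by
  rw [mixedMoment_comm, h.mixedMoment_add_left hL hL' hN, mixedMoment_comm L, mixedMoment_comm L']

lemma mixedMoment_add_self (h : IsGaussianSpace P H) {L L' : Ω → ℝ} (hL : L ∈ H) (hL' : L' ∈ H) :
    mixedMoment P (L + L') (L + L') =
      mixedMoment P L L + 2 * mixedMoment P L L' + mixedMoment P L' L' := by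
  rw [h.mixedMoment_add_left hL hL' (H.add_mem hL hL'), h.mixedMoment_add_right hL hL' hL,
    h.mixedMoment_add_right hL hL' hL', mixedMoment_comm L' L]
  ring

lemma mixedMoment_self_of_law (h : IsGaussianSpace P H) {L : Ω → ℝ} (hL : L ∈ H) {v : ℝ≥0}
    (hv : P.map L = gaussianReal 0 v) : mixedMoment P L L = v := by
  have hm := h.measurable L hL
  have h1 : mixedMoment P L L = ∫ x, x ^ 2 ∂(P.map L) := by
    rw [integral_map hm.aemeasurable (by fun_prop)]
    simp [mixedMoment, sq]
  have h2 : Var[fun x => x; gaussianReal 0 v] = v := variance_fun_id_gaussianReal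
  rw [variance_eq_integral (by fun_prop)] at h2
  rw [h1, hv, ← h2]
  simp

lemma law_eq (h : IsGaussianSpace P H) {L : Ω → ℝ} (hL : L ∈ H) :
    P.map L = gaussianReal 0 (mixedMoment P L L).toNNReal := by
  obtain ⟨v, hv⟩ := h.law L hL
  rw [h.mixedMoment_self_of_law hL hv, hv, Real.toNNReal_coe]

lemma lintegral_exp (h : IsGaussianSpace P H) {L : Ω → ℝ} (hL : L ∈ H) :
    ∫⁻ ω, ENNReal.ofReal (Real.exp (L ω)) ∂P =
      ENNReal.ofReal (Real.exp (mixedMoment P L L / 2)) := by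
  have hv := h.law_eq hL
  have hmgf := mgf_gaussianReal hv 1
  have hint : Integrable (fun ω => Real.exp (L ω)) P := by
    have := integrable_exp_mul_gaussianReal (μ := 0) (v := (mixedMoment P L L).toNNReal) 1
    rw [← hv, integrable_map_measure (by fun_prop) (h.measurable L hL).aemeasurable] at this
    simpa [Function.comp_def] using this
  rw [← ofReal_integral_eq_lintegral_ofReal hint (ae_of_all _ fun ω => (Real.exp_pos _).le)]
  simp only [mgf, one_mul, zero_add, one_pow, mul_one] at hmgf
  rw [hmgf, Real.coe_toNNReal _ (mixedMoment_self_nonneg L)]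

lemma lintegral_wickExp (h : IsGaussianSpace P H) {L : Ω → ℝ} (hL : L ∈ H) :
    ∫⁻ ω, wickExp P L ω ∂P = 1 := by
  have h1 : ∀ ω, wickExp P L ω = ENNReal.ofReal (Real.exp (-(mixedMoment P L L / 2))) *
      ENNReal.ofReal (Real.exp (L ω)) := fun ω => by
    rw [wickExp, ← ENNReal.ofReal_mul (Real.exp_pos _).le, ← Real.exp_add]
    ring_nf
  simp_rw [h1]
  rw [lintegral_const_mul' _ _ ENNReal.ofReal_ne_top, h.lintegral_exp hL,
    ← ENNReal.ofReal_mul (Real.exp_pos _).le, ← Real.exp_add]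
  simp

lemma measurable_wickExp (h : IsGaussianSpace P H) {L : Ω → ℝ} (hL : L ∈ H) :
    Measurable (wickExp P L) := by
  have := h.measurable L hL
  unfold wickExp
  fun_prop

lemma wickExp_mul_wickExp (h : IsGaussianSpace P H) {L L' : Ω → ℝ} (hL : L ∈ H) (hL' : L' ∈ H)
    (ω : Ω) : wickExp P L ω * wickExp P L' ω =
      ENNReal.ofReal (Real.exp (mixedMoment P L L')) * wickExp P (L + L') ω := by
  simp only [wickExp]
  rw [← ENNReal.ofReal_mul (Real.exp_pos _).le, ← ENNReal.ofReal_mul (Real.exp_pos _).le,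
    ← Real.exp_add, ← Real.exp_add, h.mixedMoment_add_self hL hL', Pi.add_apply]
  ring_nf

lemma lintegral_wickExp_mul_wickExp (h : IsGaussianSpace P H) {L L' : Ω → ℝ} (hL : L ∈ H)
    (hL' : L' ∈ H) : ∫⁻ ω, wickExp P L ω * wickExp P L' ω ∂P =
      ENNReal.ofReal (Real.exp (mixedMoment P L L')) := by
  simp_rw [h.wickExp_mul_wickExp hL hL']
  rw [lintegral_const_mul' _ _ ENNReal.ofReal_ne_top, h.lintegral_wickExp (H.add_mem hL hL'),
    mul_one]

end IsGaussianSpace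

/-- The power of a Wick exponential is a multiple of a Wick exponential. -/
lemma wickExp_rpow (L : Ω → ℝ) (t : ℝ) (ω : Ω) : wickExp P L ω ^ t =
    ENNReal.ofReal (Real.exp ((t ^ 2 - t) * mixedMoment P L L / 2)) * wickExp P (t • L) ω := by
  simp only [wickExp]
  rw [ENNReal.ofReal_rpow_of_pos (Real.exp_pos _), ← ENNReal.ofReal_mul (Real.exp_pos _).le,
    ← Real.exp_mul, ← Real.exp_add, mixedMoment_smul_left, mixedMoment_smul_right, Pi.smul_apply,
    smul_eq_mul]
  ring_nf

lemma IsGaussianSpace.lintegral_wickExp_rpow (h : IsGaussianSpace P H) {L : Ω → ℝ} (hL : L ∈ H)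
    (t : ℝ) : ∫⁻ ω, wickExp P L ω ^ t ∂P =
      ENNReal.ofReal (Real.exp ((t ^ 2 - t) * mixedMoment P L L / 2)) := by
  simp_rw [wickExp_rpow]
  rw [lintegral_const_mul' _ _ ENNReal.ofReal_ne_top, h.lintegral_wickExp (H.smul_mem t hL),
    mul_one]

end GaussianSpace

section ChaosMass

variable {Ω : Type*} [MeasurableSpace Ω] {E : Type*} [PseudoMetricSpace E] [MeasurableSpace E]

/-- The mass that the chaos of the field `Y` with base measure `σ` gives to `A`. -/
def chaosMass (P : Measure Ω) (σ : Measure E) (Y : E → Ω → ℝ) (A : Set E) (ω : Ω) : ℝ≥0∞ :=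
  ∫⁻ x in A, wickExp P (Y x) ω ∂σ

/-- A Gaussian field whose covariance is `-γ² log` at scales above `ε`, up to bounded errors, with
coarse observables `N` that see the field at the intermediate scales `r`. -/
structure IsLogField (P : Measure Ω) (H : Submodule ℝ (Ω → ℝ)) (γ C₀ ε : ℝ) (Y : E → Ω → ℝ) :
    Prop where
  mem : ∀ x, Y x ∈ H
  measurable : Measurable (Function.uncurry Y)
  le : ∀ x y, mixedMoment P (Y x) (Y y) ≤
    γ ^ 2 * (max (-Real.log (max (dist x y) ε)) 0 + C₀)
  ge : ∀ x y, -(γ ^ 2 * C₀) ≤ mixedMoment P (Y x) (Y y)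
  coarse : ∀ z r, ε ≤ r → r ≤ 1 → ∃ N ∈ H, mixedMoment P N N ≤ -Real.log r + C₀ ∧
    ∀ y, γ * (-Real.log (max (dist y z) r) - C₀) ≤ mixedMoment P N (Y y)

/-- The measure `σ` has dimension at least `δ` at scales above `ε`. -/
def IsBallRegular (σ : Measure E) (δ Cσ ε : ℝ) : Prop :=
  ∀ z r, ε ≤ r → σ (Metric.closedBall z r) ≤ ENNReal.ofReal (Cσ * r ^ δ)

/-- Scaling bound of exponent `ζ` for the moments of order `p` of the chaos, uniform over
exponential changes of measure. -/
def HasMomentBound (P : Measure Ω) (H : Submodule ℝ (Ω → ℝ)) (σ : Measure E) (Y : E → Ω → ℝ)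
    (ε R p ζ C : ℝ) : Prop :=
  ∀ L ∈ H, ∀ (z : E) (r : ℝ) (A : Set E) (κ : ℝ), ε ≤ r → r ≤ R → MeasurableSet A →
    A ⊆ Metric.closedBall z r → (∀ y ∈ A, mixedMoment P L (Y y) ≤ κ) →
    ∫⁻ ω, wickExp P L ω * chaosMass P σ Y A ω ^ p ∂P ≤
      ENNReal.ofReal (C * (r ^ ζ * Real.exp (p * κ)))

variable {P : Measure Ω} {H : Submodule ℝ (Ω → ℝ)} {σ : Measure E} {Y : E → Ω → ℝ}
  {γ C₀ ε : ℝ}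

namespace IsLogField

lemma le_of_dist_le (hY : IsLogField P H γ C₀ ε Y) (hε : 0 < ε) (hε1 : ε ≤ 1) {R : ℝ}
    (hR : 1 ≤ R) {x y : E} (hxy : dist x y ≤ R) :
    mixedMoment P (Y x) (Y y) ≤ γ ^ 2 * (-Real.log (max (dist x y) ε) + (C₀ + Real.log R)) := by
  refine (hY.le x y).trans (mul_le_mul_of_nonneg_left ?_ (sq_nonneg γ))
  have h0 := Real.log_nonneg hR
  have hm : 0 < max (dist x y) ε := lt_max_of_lt_right hε
  have h1 : Real.log (max (dist x y) ε) ≤ Real.log R :=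
    Real.log_le_log hm (max_le hxy (hε1.trans hR))
  rcases max_cases (-Real.log (max (dist x y) ε)) 0 with h | h <;> linarith

lemma exists_coarse (hY : IsLogField P H γ C₀ ε Y) (hγ : 0 ≤ γ) (hε1 : ε ≤ 1) {R : ℝ}
    (hR : 1 ≤ R) (z : E) {r : ℝ} (hr0 : 0 < r) (hεr : ε ≤ r) (hrR : r ≤ R) :
    ∃ N ∈ H, mixedMoment P N N ≤ -Real.log r + (C₀ + Real.log R) ∧
      ∀ y ∈ Metric.closedBall z r,
        γ * (-Real.log r - (C₀ + Real.log R)) ≤ mixedMoment P N (Y y) := by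
  have h0 := Real.log_nonneg hR
  rcases le_total r 1 with h1 | h1
  · obtain ⟨N, hN, hNN, hNY⟩ := hY.coarse z r hεr h1
    refine ⟨N, hN, by linarith, fun y hy => ?_⟩
    have := hNY y
    rw [max_eq_right (Metric.mem_closedBall.1 hy)] at this
    exact le_trans (mul_le_mul_of_nonneg_left (by linarith) hγ) this
  · obtain ⟨N, hN, hNN, hNY⟩ := hY.coarse z 1 hε1 le_rfl
    have hlr : Real.log r ≤ Real.log R := Real.log_le_log hr0 hrR
    refine ⟨N, hN, ?_, fun y hy => ?_⟩
    · rw [Real.log_one] at hNN; linarith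
    · refine le_trans (mul_le_mul_of_nonneg_left ?_ hγ) (hNY y)
      have : Real.log (max (dist y z) 1) ≤ Real.log r :=
        Real.log_le_log (by positivity) (max_le (Metric.mem_closedBall.1 hy) h1)
      linarith

lemma measurable_uncurry_wickExp [SFinite P] (hY : IsLogField P H γ C₀ ε Y) :
    Measurable (Function.uncurry fun x ω => wickExp P (Y x) ω) := by
  have h1 : Measurable fun x => mixedMoment P (Y x) (Y x) := by
    have h2 : StronglyMeasurable (Function.uncurry fun x ω => Y x ω * Y x ω) :=
      (hY.measurable.mul hY.measurable).stronglyMeasurable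
    exact h2.integral_prod_right.measurable
  have h3 := hY.measurable
  unfold wickExp
  exact ENNReal.measurable_ofReal.comp (Real.measurable_exp.comp
    (h3.sub ((h1.comp measurable_fst).div_const 2)))

lemma measurable_chaosMass [SFinite P] [SFinite σ] (hY : IsLogField P H γ C₀ ε Y) (A : Set E) :
    Measurable (chaosMass P σ Y A) :=
  hY.measurable_uncurry_wickExp.lintegral_prod_left'

/-- Tonelli's theorem for the chaos. -/
lemma lintegral_mul_chaosMass [SFinite P] [SFinite σ] (hY : IsLogField P H γ C₀ ε Y) (A : Set E)
    {F : Ω → ℝ≥0∞} (hF : Measurable F) :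
    ∫⁻ ω, F ω * chaosMass P σ Y A ω ∂P =
      ∫⁻ x in A, ∫⁻ ω, F ω * wickExp P (Y x) ω ∂P ∂σ := by
  have hm := hY.measurable_uncurry_wickExp
  rw [lintegral_lintegral_swap]
  · refine lintegral_congr fun ω => ?_
    rw [chaosMass, lintegral_const_mul]
    exact hm.of_uncurry_right
  · exact ((hF.comp measurable_snd).mul hm).aemeasurable

lemma lintegral_wickExp_mul_chaosMass [SFinite P] [SFinite σ] (hP : IsGaussianSpace P H)
    (hY : IsLogField P H γ C₀ ε Y) (A : Set E) {L : Ω → ℝ} (hL : L ∈ H) :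
    ∫⁻ ω, wickExp P L ω * chaosMass P σ Y A ω ∂P =
      ∫⁻ x in A, ENNReal.ofReal (Real.exp (mixedMoment P L (Y x))) ∂σ := by
  rw [hY.lintegral_mul_chaosMass A (hP.measurable_wickExp hL)]
  exact lintegral_congr fun x => hP.lintegral_wickExp_mul_wickExp hL (hY.mem x)

end IsLogField

lemma chaosMass_mono {E : Type*} [MeasurableSpace E] {σ : Measure E} {Y : E → Ω → ℝ}
    {A B : Set E} (h : A ⊆ B) (ω : Ω) :
    chaosMass P σ Y A ω ≤ chaosMass P σ Y B ω :=
  lintegral_mono_set h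

/-- The multifractal spectrum of the chaos in dimension `δ`. -/
def multifractalExponent (δ γ p : ℝ) : ℝ := δ * p + γ ^ 2 * p * (1 - p) / 2

/-- Moments of order at most one. -/
lemma IsLogField.hasMomentBound_of_le_one [SFinite P] [SFinite σ] (hP : IsGaussianSpace P H)
    (hY : IsLogField P H γ C₀ ε Y) (hγ : 0 ≤ γ) (hε : 0 < ε) (hε1 : ε ≤ 1) [OpensMeasurableSpace E]
    {δ Cσ R p : ℝ} (hR : 1 ≤ R) (hCσ : 0 ≤ Cσ) (hσ : IsBallRegular σ δ Cσ ε) (hp0 : 0 ≤ p)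
    (hp1 : p ≤ 1) :
    HasMomentBound P H σ Y ε R p (multifractalExponent δ γ p)
      (Cσ ^ p * Real.exp (γ ^ 2 * p * (1 - p) * (3 / 2 * (C₀ + Real.log R)))) := by
  intro L hL z r A κ hεr hrR hA hAr hκ
  have hr : 0 < r := hε.trans_le hεr
  obtain ⟨N, hN, hNN, hNY⟩ := hY.exists_coarse hγ hε1 hR z hr hεr hrR
  set c := C₀ + Real.log R with hc
  set v := mixedMoment P N N with hv
  set a := -(γ * (1 - p)) with ha
  set b := γ * p with hb
  set m := mixedMoment P L N with hm
  have haN : a • N ∈ H := H.smul_mem a hN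
  have hbN : b • N ∈ H := H.smul_mem b hN
  set f : Ω → ℝ≥0∞ := fun ω => wickExp P L ω * wickExp P (a • N) ω * chaosMass P σ Y A ω
  set g : Ω → ℝ≥0∞ := fun ω => wickExp P L ω * wickExp P (b • N) ω
  have hmL := hP.measurable_wickExp hL
  have hmN := hP.measurable_wickExp haN
  have hmN' := hP.measurable_wickExp hbN
  have hmC := hY.measurable_chaosMass (σ := σ) A
  have hpt : ∀ ω, wickExp P L ω * chaosMass P σ Y A ω ^ p =
      ENNReal.ofReal (Real.exp (v * γ ^ 2 * p * (1 - p) / 2)) * (f ω ^ p * g ω ^ (1 - p)) := by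
    intro ω
    have h1p : 0 ≤ 1 - p := by linarith
    have e1 : wickExp P L ω ^ p * wickExp P L ω ^ (1 - p) = wickExp P L ω := by
      rw [← ENNReal.rpow_add_of_nonneg _ _ hp0 h1p]; simp
    have e2 : ENNReal.ofReal (Real.exp (v * γ ^ 2 * p * (1 - p) / 2)) *
        (wickExp P (a • N) ω ^ p * wickExp P (b • N) ω ^ (1 - p)) = 1 := by
      simp only [wickExp, mixedMoment_smul_left, mixedMoment_smul_right, Pi.smul_apply, smul_eq_mul]
      rw [ENNReal.ofReal_rpow_of_pos (Real.exp_pos _), ENNReal.ofReal_rpow_of_pos (Real.exp_pos _),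
        ← ENNReal.ofReal_mul (by positivity), ← ENNReal.ofReal_mul (by positivity),
        ← Real.exp_mul, ← Real.exp_mul, ← Real.exp_add, ← Real.exp_add, ENNReal.ofReal_eq_one,
        Real.exp_eq_one_iff, ha, hb, hv]
      ring
    simp only [f, g]
    rw [ENNReal.mul_rpow_of_nonneg _ _ hp0, ENNReal.mul_rpow_of_nonneg _ _ hp0,
      ENNReal.mul_rpow_of_nonneg _ _ h1p]
    calc _ = (wickExp P L ω ^ p * wickExp P L ω ^ (1 - p)) * chaosMass P σ Y A ω ^ p * 1 := by
          rw [e1, mul_one]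
      _ = _ := by rw [← e2]; ring
  have hfint : ∫⁻ ω, f ω ∂P ≤ ENNReal.ofReal (Real.exp (a * m) *
      (Cσ * r ^ δ * Real.exp (κ + a * (γ * (-Real.log r - c))))) := by
    simp only [f]
    simp_rw [hP.wickExp_mul_wickExp hL haN, mul_assoc]
    rw [lintegral_const_mul' _ _ ENNReal.ofReal_ne_top,
      hY.lintegral_wickExp_mul_chaosMass hP A (H.add_mem hL haN), mixedMoment_smul_right, ← hm,
      ENNReal.ofReal_mul (Real.exp_pos _).le]
    gcongr
    calc _ ≤ ∫⁻ _ in A, ENNReal.ofReal (Real.exp (κ + a * (γ * (-Real.log r - c)))) ∂σ := by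
          refine setLIntegral_mono' hA fun y hy => ENNReal.ofReal_le_ofReal (Real.exp_le_exp.2 ?_)
          rw [hP.mixedMoment_add_left hL haN (hY.mem y), mixedMoment_smul_left]
          refine add_le_add (hκ y hy) ?_
          rw [ha]
          have := mul_le_mul_of_nonneg_left (hNY y (hAr hy))
            (mul_nonneg hγ (by linarith : (0 : ℝ) ≤ 1 - p))
          linarith
      _ ≤ ENNReal.ofReal (Real.exp (κ + a * (γ * (-Real.log r - c)))) *
          ENNReal.ofReal (Cσ * r ^ δ) := by
          rw [setLIntegral_const]
          gcongr
          exact (measure_mono hAr).trans (hσ z r hεr)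
      _ = _ := by
          rw [← ENNReal.ofReal_mul (Real.exp_pos _).le]
          ring_nf
  have hgint : ∫⁻ ω, g ω ∂P = ENNReal.ofReal (Real.exp (b * m)) := by
    rw [hP.lintegral_wickExp_mul_wickExp hL hbN, mixedMoment_smul_right]
  have h1p : 0 ≤ 1 - p := by linarith
  calc _ = ENNReal.ofReal (Real.exp (v * γ ^ 2 * p * (1 - p) / 2)) *
        ∫⁻ ω, f ω ^ p * g ω ^ (1 - p) ∂P := by
        simp_rw [hpt]
        rw [lintegral_const_mul' _ _ ENNReal.ofReal_ne_top]
    _ ≤ ENNReal.ofReal (Real.exp (v * γ ^ 2 * p * (1 - p) / 2)) *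
        ((∫⁻ ω, f ω ∂P) ^ p * (∫⁻ ω, g ω ∂P) ^ (1 - p)) := by
        gcongr
        exact ENNReal.lintegral_mul_norm_pow_le ((hmL.mul hmN).mul hmC).aemeasurable
          (hmL.mul hmN').aemeasurable hp0 h1p (by ring)
    _ ≤ ENNReal.ofReal (Real.exp (v * γ ^ 2 * p * (1 - p) / 2)) *
        (ENNReal.ofReal (Real.exp (a * m) *
          (Cσ * r ^ δ * Real.exp (κ + a * (γ * (-Real.log r - c))))) ^ p *
          ENNReal.ofReal (Real.exp (b * m)) ^ (1 - p)) := by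
        rw [hgint]
        gcongr
    _ ≤ _ := by
        have hrδ : 0 ≤ r ^ δ := (Real.rpow_pos_of_pos hr δ).le
        rw [ENNReal.ofReal_rpow_of_nonneg (by positivity) hp0,
          ENNReal.ofReal_rpow_of_nonneg (by positivity) h1p, ← ENNReal.ofReal_mul (by positivity),
          ← ENNReal.ofReal_mul (by positivity)]
        refine ENNReal.ofReal_le_ofReal ?_
        rw [Real.mul_rpow (by positivity) (by positivity), Real.mul_rpow (by positivity)
          (by positivity), Real.mul_rpow hCσ hrδ, ← Real.exp_mul, ← Real.exp_mul, ← Real.exp_mul,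
          ← Real.rpow_mul hr.le]
        have e3 : r ^ (multifractalExponent δ γ p) =
            r ^ (δ * p) * Real.exp (Real.log r * (γ ^ 2 * p * (1 - p) / 2)) := by
          rw [multifractalExponent, Real.rpow_add hr, Real.rpow_def_of_pos hr (γ ^ 2 * _ * _ / 2)]
        rw [e3]
        have e4 : Real.exp (v * γ ^ 2 * p * (1 - p) / 2) * (Real.exp (a * m * p) *
            (Cσ ^ p * r ^ (δ * p) * Real.exp ((κ + a * (γ * (-Real.log r - c))) * p)) *
            Real.exp (b * m * (1 - p))) = Cσ ^ p * r ^ (δ * p) *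
            Real.exp (v * γ ^ 2 * p * (1 - p) / 2 + a * m * p +
              (κ + a * (γ * (-Real.log r - c))) * p + b * m * (1 - p)) := by
          rw [Real.exp_add, Real.exp_add, Real.exp_add]; ring
        have e5 : Cσ ^ p * Real.exp (γ ^ 2 * p * (1 - p) * (3 / 2 * c)) *
            (r ^ (δ * p) * Real.exp (Real.log r * (γ ^ 2 * p * (1 - p) / 2)) *
              Real.exp (p * κ)) = Cσ ^ p * r ^ (δ * p) *
            Real.exp (γ ^ 2 * p * (1 - p) * (3 / 2 * c) +
              Real.log r * (γ ^ 2 * p * (1 - p) / 2) + p * κ) := by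
          rw [Real.exp_add, Real.exp_add]; ring
        rw [e4, e5]
        refine mul_le_mul_of_nonneg_left (Real.exp_le_exp.2 ?_) (by positivity)
        rw [ha, hb]
        have hk : 0 ≤ γ ^ 2 * p * (1 - p) / 2 := by positivity
        have := mul_le_mul_of_nonneg_left hNN hk
        linarith

end ChaosMass

section PositiveMoments

lemma ENNReal.tsum_mul_rpow_le {ι : Type*} (w b : ι → ℝ≥0∞) {p : ℝ} (hp : 0 < p) :
    (∑' k, w k * b k) ^ p ≤ (∑' k, w k) ^ p * ∑' k, b k ^ p := by
  have h1 : ∀ k, b k ≤ (∑' k, b k ^ p) ^ p⁻¹ := fun k => by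
    rw [ENNReal.le_rpow_inv_iff hp]
    exact ENNReal.le_tsum k
  calc _ ≤ ((∑' k, w k) * (∑' k, b k ^ p) ^ p⁻¹) ^ p := by
        rw [← ENNReal.tsum_mul_right]
        gcongr with k
        exact h1 k
    _ = _ := by rw [ENNReal.mul_rpow_of_nonneg _ _ hp.le, ENNReal.rpow_inv_rpow hp.ne']

variable {E : Type*} [PseudoMetricSpace E]

/-- Dyadic annuli about `x`, in terms of the distance to `x` truncated below at `ε`. -/
def dyadicShell (x : E) (s ε : ℝ) (k : ℕ) : Set E :=
  {y | s * (1 / 2) ^ (k + 1) < max (dist y x) ε ∧ max (dist y x) ε ≤ s * (1 / 2) ^ k}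

lemma dyadicShell_subset_closedBall (x : E) (s ε : ℝ) (k : ℕ) :
    dyadicShell x s ε k ⊆ Metric.closedBall x (s * (1 / 2) ^ k) := fun _ hy =>
  Metric.mem_closedBall.2 ((le_max_left _ _).trans hy.2)

lemma closedBall_subset_iUnion_dyadicShell (x : E) {s ε : ℝ} (hε : 0 < ε) (hεs : ε ≤ s) :
    Metric.closedBall x s ⊆ ⋃ k, dyadicShell x s ε k := by
  intro y hy
  have hs : 0 < s := hε.trans_le hεs
  obtain ⟨n, hn1, hn2⟩ := exists_nat_pow_near_of_lt_one (x := max (dist y x) ε / s)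
    (y := (1 / 2 : ℝ)) (by positivity)
    ((div_le_one hs).2 (max_le (Metric.mem_closedBall.1 hy) hεs)) (by norm_num) (by norm_num)
  rw [lt_div_iff₀' hs] at hn1
  rw [div_le_iff₀' hs] at hn2
  exact Set.mem_iUnion.2 ⟨n, hn1, hn2⟩

variable [MeasurableSpace E]

lemma measurableSet_dyadicShell [OpensMeasurableSpace E] (x : E) (s ε : ℝ) (k : ℕ) :
    MeasurableSet (dyadicShell x s ε k) := by
  have h : Continuous fun y : E => max (dist y x) ε := by fun_prop
  exact (measurableSet_lt measurable_const h.measurable).inter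
    (measurableSet_le h.measurable measurable_const)

variable {Ω : Type*} [MeasurableSpace Ω]
  {P : Measure Ω} {H : Submodule ℝ (Ω → ℝ)} {σ : Measure E} {Y : E → Ω → ℝ}
  {γ C₀ ε : ℝ}

/-- The sum over dyadic shells about `x` of the chaos mass, with geometric weights `l ^ k`. -/
def shellSum (P : Measure Ω) (σ : Measure E) (Y : E → Ω → ℝ) (ε l s : ℝ) (A : Set E) (x : E)
    (ω : Ω) : ℝ≥0∞ :=
  ∑' k : ℕ, ENNReal.ofReal (l ^ k) * chaosMass P σ Y (A ∩ dyadicShell x s ε k) ω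

lemma chaosMass_le_shellSum {l s : ℝ} (hl : 1 ≤ l) (hε : 0 < ε) (hεs : ε ≤ s) {A : Set E}
    {x : E} (hA : A ⊆ Metric.closedBall x s) (ω : Ω) :
    chaosMass P σ Y A ω ≤ shellSum P σ Y ε l s A x ω := by
  have h1 : A ⊆ ⋃ k, A ∩ dyadicShell x s ε k := by
    rw [← Set.inter_iUnion]
    exact Set.subset_inter le_rfl (hA.trans (closedBall_subset_iUnion_dyadicShell x hε hεs))
  refine (chaosMass_mono h1 ω).trans ((lintegral_iUnion_le _ _).trans ?_)
  refine ENNReal.tsum_le_tsum fun k => ?_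
  refine le_mul_of_one_le_left (zero_le) ?_
  rw [ENNReal.one_le_ofReal]
  exact one_le_pow₀ hl

/-- The exponent governing singular integrals of order `p` against the chaos. -/
def shellExponent (δ γ p : ℝ) : ℝ := δ - γ ^ 2 * (p + 1) / 2

/-- The constant in `HasMomentBound.lintegral_shellSum_le`. -/
def shellConst (δ γ C₀ R p l C : ℝ) : ℝ :=
  ((1 - l⁻¹)⁻¹) ^ p * (C * (2 ^ (p * shellExponent δ γ p) *
    Real.exp (p * (γ ^ 2 * (Real.log 2 + (C₀ + Real.log (2 * R)))))) *
    (1 - l ^ (2 * p) * (1 / 2 : ℝ) ^ (p * shellExponent δ γ p))⁻¹)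

lemma shellConst_nonneg {δ R p l C : ℝ} (hC : 0 ≤ C) (hl : 1 < l)
    (hlα : l ^ (2 * p) * (1 / 2 : ℝ) ^ (p * shellExponent δ γ p) < 1) :
    0 ≤ shellConst δ γ C₀ R p l C := by
  have h1 : 0 < 1 - l⁻¹ := sub_pos.2 (inv_lt_one_of_one_lt₀ hl)
  have h2 := sub_pos.2 hlα
  unfold shellConst
  positivity

lemma HasMomentBound.lintegral_shellSum_le [SFinite P] [SFinite σ] (hP : IsGaussianSpace P H)
    (hY : IsLogField P H γ C₀ ε Y) (hε : 0 < ε) (hε1 : ε ≤ 1) [OpensMeasurableSpace E]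
    {δ R p l C : ℝ} (hR : 1 ≤ R) (hp : 0 < p) (hC : 0 ≤ C) (hl : 1 < l)
    (hlα : l ^ (2 * p) * (1 / 2 : ℝ) ^ (p * shellExponent δ γ p) < 1)
    (hB : HasMomentBound P H σ Y ε (2 * R) p (multifractalExponent δ γ p) C)
    {L : Ω → ℝ} (hL : L ∈ H) (x : E) {r : ℝ} {A : Set E} {κ : ℝ} (hεr : ε ≤ r) (hrR : r ≤ R)
    (hA : MeasurableSet A) (hκ : ∀ y ∈ A, mixedMoment P L (Y y) ≤ κ) :
    ∫⁻ ω, wickExp P (L + Y x) ω * shellSum P σ Y ε l (2 * r) A x ω ^ p ∂P ≤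
      ENNReal.ofReal (shellConst δ γ C₀ R p l C *
        (r ^ (p * shellExponent δ γ p) * Real.exp (p * κ))) := by
  have hr : 0 < r := hε.trans_le hεr
  have hl0 : 0 < l := by linarith
  set α := shellExponent δ γ p with hα
  set c := C₀ + Real.log (2 * R) with hc
  have hLx : L + Y x ∈ H := H.add_mem hL (hY.mem x)
  set W := Real.exp (p * (γ ^ 2 * (Real.log 2 + c))) with hW
  have hshell : ∀ k : ℕ, ∫⁻ ω, wickExp P (L + Y x) ω *
      chaosMass P σ Y (A ∩ dyadicShell x (2 * r) ε k) ω ^ p ∂P ≤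
      ENNReal.ofReal (C * (2 ^ (p * α) * W) * (r ^ (p * α) * Real.exp (p * κ)) *
        ((1 / 2 : ℝ) ^ (p * α)) ^ k) := by
    intro k
    set ρ := 2 * r * (1 / 2 : ℝ) ^ k with hρ
    have hρ0 : 0 < ρ := by positivity
    rcases (A ∩ dyadicShell x (2 * r) ε k).eq_empty_or_nonempty with h0 | ⟨y₀, -, hy₀⟩
    · simp [h0, chaosMass, hp]
    have hερ : ε ≤ ρ := (le_max_right _ _).trans hy₀.2
    have hρR : ρ ≤ 2 * R := by
      have : (1 / 2 : ℝ) ^ k ≤ 1 := pow_le_one₀ (by norm_num) (by norm_num)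
      nlinarith
    refine (hB (L + Y x) hLx x ρ (A ∩ dyadicShell x (2 * r) ε k)
      (κ + γ ^ 2 * (-Real.log (ρ / 2) + c)) hερ hρR
      (hA.inter (measurableSet_dyadicShell x _ ε k))
      (Set.inter_subset_right.trans (dyadicShell_subset_closedBall x _ ε k)) ?_).trans ?_
    · rintro y ⟨hyA, hy1, hy2⟩
      rw [hP.mixedMoment_add_left hL (hY.mem x) (hY.mem y)]
      refine add_le_add (hκ y hyA) ?_
      rw [mixedMoment_comm]
      refine (hY.le_of_dist_le hε hε1 (R := 2 * R) (by linarith)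
        (((le_max_left _ _).trans hy2).trans hρR)).trans
        (mul_le_mul_of_nonneg_left ?_ (sq_nonneg γ))
      have : Real.log (ρ / 2) ≤ Real.log (max (dist y x) ε) := by
        refine Real.log_le_log (by positivity) (le_of_eq_of_le ?_ hy1.le)
        rw [hρ, pow_succ]; ring
      linarith
    · refine ENNReal.ofReal_le_ofReal (le_of_eq ?_)
      have e1 : ρ ^ (multifractalExponent δ γ p) * Real.exp (p * (κ + γ ^ 2 *
          (-Real.log (ρ / 2) + c))) = ρ ^ (p * α) * W * Real.exp (p * κ) := by
        rw [Real.rpow_def_of_pos hρ0, Real.rpow_def_of_pos hρ0, hW, ← Real.exp_add, ← Real.exp_add,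
          ← Real.exp_add, Real.log_div hρ0.ne' two_ne_zero, hα, shellExponent,
          multifractalExponent]
        ring_nf
      have e2 : ρ ^ (p * α) = 2 ^ (p * α) * r ^ (p * α) * ((1 / 2 : ℝ) ^ (p * α)) ^ k := by
        rw [hρ, Real.mul_rpow (by positivity) (by positivity), Real.mul_rpow (by positivity) hr.le,
          ← Real.rpow_natCast, ← Real.rpow_natCast, ← Real.rpow_mul (by norm_num),
          ← Real.rpow_mul (by norm_num), mul_comm (k : ℝ)]
      rw [e1, e2]
      ring
  have hinv : l⁻¹ < 1 := inv_lt_one_of_one_lt₀ hl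
  have hpt : ∀ ω, shellSum P σ Y ε l (2 * r) A x ω ^ p ≤ ENNReal.ofReal (((1 - l⁻¹)⁻¹) ^ p) *
      ∑' k : ℕ, ENNReal.ofReal ((l ^ (2 * p)) ^ k) *
        chaosMass P σ Y (A ∩ dyadicShell x (2 * r) ε k) ω ^ p := by
    intro ω
    have h1 : shellSum P σ Y ε l (2 * r) A x ω = ∑' k : ℕ, ENNReal.ofReal (l⁻¹ ^ k) *
        (ENNReal.ofReal ((l ^ 2) ^ k) * chaosMass P σ Y (A ∩ dyadicShell x (2 * r) ε k) ω) := by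
      refine tsum_congr fun k => ?_
      rw [← mul_assoc, ← ENNReal.ofReal_mul (by positivity), ← mul_pow]
      congr 3
      field_simp
    have h2 : ∑' k : ℕ, ENNReal.ofReal (l⁻¹ ^ k) = ENNReal.ofReal ((1 - l⁻¹)⁻¹) := by
      rw [← tsum_geometric_of_lt_one (by positivity) hinv, ENNReal.ofReal_tsum_of_nonneg
        (fun k => by positivity) (summable_geometric_of_lt_one (by positivity) hinv)]
    rw [h1]
    refine (ENNReal.tsum_mul_rpow_le _ _ hp).trans ?_
    rw [h2, ENNReal.ofReal_rpow_of_nonneg (inv_nonneg.2 (by linarith)) hp.le]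
    gcongr with k
    rw [ENNReal.mul_rpow_of_nonneg _ _ hp.le, ENNReal.ofReal_rpow_of_nonneg (by positivity) hp.le]
    refine le_of_eq ?_
    congr 2
    rw [← pow_mul, ← Real.rpow_natCast, ← Real.rpow_natCast, ← Real.rpow_mul hl0.le,
      ← Real.rpow_mul hl0.le]
    push_cast
    ring_nf
  have hmeas : ∀ k, Measurable fun ω => wickExp P (L + Y x) ω *
      chaosMass P σ Y (A ∩ dyadicShell x (2 * r) ε k) ω ^ p := fun k =>
    (hP.measurable_wickExp hLx).mul ((hY.measurable_chaosMass _).pow_const p)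
  set b := (1 / 2 : ℝ) ^ (p * α) with hb
  have hb0 : 0 ≤ b := by positivity
  calc _ ≤ ∫⁻ ω, ENNReal.ofReal (((1 - l⁻¹)⁻¹) ^ p) * ∑' k : ℕ, ENNReal.ofReal ((l ^ (2 * p)) ^ k) *
        (wickExp P (L + Y x) ω * chaosMass P σ Y (A ∩ dyadicShell x (2 * r) ε k) ω ^ p) ∂P := by
        refine lintegral_mono fun ω => ?_
        refine (mul_le_mul_right (hpt ω) _).trans (le_of_eq ?_)
        rw [mul_left_comm, ← ENNReal.tsum_mul_left]
        congr 1
        exact tsum_congr fun k => by rw [mul_left_comm]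
    _ = ENNReal.ofReal (((1 - l⁻¹)⁻¹) ^ p) * ∑' k : ℕ, ENNReal.ofReal ((l ^ (2 * p)) ^ k) *
        ∫⁻ ω, wickExp P (L + Y x) ω * chaosMass P σ Y (A ∩ dyadicShell x (2 * r) ε k) ω ^ p ∂P := by
        rw [lintegral_const_mul' _ _ ENNReal.ofReal_ne_top,
          lintegral_tsum fun k => ((hmeas k).const_mul _).aemeasurable]
        congr 1
        exact tsum_congr fun k => lintegral_const_mul' _ _ ENNReal.ofReal_ne_top
    _ ≤ ENNReal.ofReal (((1 - l⁻¹)⁻¹) ^ p) * ∑' k : ℕ, ENNReal.ofReal ((l ^ (2 * p)) ^ k) *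
        ENNReal.ofReal (C * (2 ^ (p * α) * W) * (r ^ (p * α) * Real.exp (p * κ)) * b ^ k) := by
        gcongr with k
        exact hshell k
    _ = ENNReal.ofReal (((1 - l⁻¹)⁻¹) ^ p) * ENNReal.ofReal (∑' k : ℕ,
        C * (2 ^ (p * α) * W) * (r ^ (p * α) * Real.exp (p * κ)) * (l ^ (2 * p) * b) ^ k) := by
        rw [ENNReal.ofReal_tsum_of_nonneg (fun k => by positivity)
          ((summable_geometric_of_lt_one (by positivity) hlα).mul_left _)]
        congr 1
        refine tsum_congr fun k => ?_
        rw [← ENNReal.ofReal_mul (by positivity), mul_pow]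
        ring_nf
    _ = _ := by
        have : 0 < 1 - l⁻¹ := by linarith
        rw [tsum_mul_left, tsum_geometric_of_lt_one (by positivity) hlα,
          ← ENNReal.ofReal_mul (by positivity), shellConst, ← hα, ← hb, ← hc, ← hW]
        ring_nf

lemma HasMomentBound.add_one [SFinite P] [SFinite σ] (hP : IsGaussianSpace P H)
    (hY : IsLogField P H γ C₀ ε Y) (hε : 0 < ε) (hε1 : ε ≤ 1) [OpensMeasurableSpace E]
    {δ Cσ R p l C : ℝ} (hR : 1 ≤ R) (hσ : IsBallRegular σ δ Cσ ε) (hp : 0 < p)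
    (hC : 0 ≤ C) (hl : 1 < l)
    (hlα : l ^ (2 * p) * (1 / 2 : ℝ) ^ (p * shellExponent δ γ p) < 1)
    (hB : HasMomentBound P H σ Y ε (2 * R) p (multifractalExponent δ γ p) C) :
    HasMomentBound P H σ Y ε R (p + 1) (multifractalExponent δ γ (p + 1))
      (Cσ * shellConst δ γ C₀ R p l C) := by
  intro L hL z r A κ hεr hrR hA hAr hκ
  have hr : 0 < r := hε.trans_le hεr
  have hK := shellConst_nonneg (γ := γ) (C₀ := C₀) (R := R) hC hl hlα
  set K := shellConst δ γ C₀ R p l C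
  have hmC := hY.measurable_chaosMass (σ := σ) A
  have h1 : ∀ ω, wickExp P L ω * chaosMass P σ Y A ω ^ (p + 1) =
      wickExp P L ω * chaosMass P σ Y A ω ^ p * chaosMass P σ Y A ω := fun ω => by
    rw [ENNReal.rpow_add_of_nonneg _ _ hp.le zero_le_one, ENNReal.rpow_one, mul_assoc]
  simp_rw [h1]
  rw [hY.lintegral_mul_chaosMass A (F := fun ω => wickExp P L ω * chaosMass P σ Y A ω ^ p)
    ((hP.measurable_wickExp hL).mul (hmC.pow_const p))]
  have h2 : ∀ x ∈ A, ∫⁻ ω, wickExp P L ω * chaosMass P σ Y A ω ^ p * wickExp P (Y x) ω ∂P ≤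
      ENNReal.ofReal (K * (r ^ (p * shellExponent δ γ p) * Real.exp ((p + 1) * κ))) := by
    intro x hx
    have h3 : A ⊆ Metric.closedBall x (2 * r) := fun y hy => by
      have e1 := Metric.mem_closedBall.1 (hAr hy)
      have e2 := Metric.mem_closedBall.1 (hAr hx)
      have := dist_triangle_right y x z
      exact Metric.mem_closedBall.2 (by linarith)
    calc _ = ∫⁻ ω, ENNReal.ofReal (Real.exp (mixedMoment P L (Y x))) *
          (wickExp P (L + Y x) ω * chaosMass P σ Y A ω ^ p) ∂P := by
          refine lintegral_congr fun ω => ?_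
          rw [mul_right_comm, hP.wickExp_mul_wickExp hL (hY.mem x), mul_assoc]
      _ ≤ ENNReal.ofReal (Real.exp κ) *
          ∫⁻ ω, wickExp P (L + Y x) ω * shellSum P σ Y ε l (2 * r) A x ω ^ p ∂P := by
          rw [lintegral_const_mul' _ _ ENNReal.ofReal_ne_top]
          gcongr with ω
          · exact hκ x hx
          · exact chaosMass_le_shellSum hl.le hε (by linarith) h3 ω
      _ ≤ ENNReal.ofReal (Real.exp κ) * ENNReal.ofReal (K *
          (r ^ (p * shellExponent δ γ p) * Real.exp (p * κ))) := by
          gcongr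
          exact hB.lintegral_shellSum_le hP hY hε hε1 hR hp hC hl hlα hL x hεr hrR hA hκ
      _ = _ := by
          rw [← ENNReal.ofReal_mul (Real.exp_pos _).le, add_mul, one_mul, Real.exp_add]
          ring_nf
  calc _ ≤ ∫⁻ _ in A, ENNReal.ofReal
        (K * (r ^ (p * shellExponent δ γ p) * Real.exp ((p + 1) * κ))) ∂σ :=
        setLIntegral_mono' hA h2
    _ ≤ ENNReal.ofReal (K * (r ^ (p * shellExponent δ γ p) * Real.exp ((p + 1) * κ))) *
        ENNReal.ofReal (Cσ * r ^ δ) := by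
        rw [setLIntegral_const]
        gcongr
        exact (measure_mono hAr).trans (hσ z r hεr)
    _ = _ := by
        have e : r ^ multifractalExponent δ γ (p + 1) =
            r ^ δ * r ^ (p * shellExponent δ γ p) := by
          rw [← Real.rpow_add hr, multifractalExponent, shellExponent]
          ring_nf
        rw [← ENNReal.ofReal_mul (by positivity), e]
        ring_nf

/-- The weight `l = 2 ^ (α / 4)` is admissible in the shell estimates. -/
lemma exists_shell_weight {δ p : ℝ} (hp : 0 < p) (hα : 0 < shellExponent δ γ p) :
    ∃ l : ℝ, 1 < l ∧ l ^ (2 * p) * (1 / 2 : ℝ) ^ (p * shellExponent δ γ p) < 1 := by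
  refine ⟨2 ^ (shellExponent δ γ p / 4), Real.one_lt_rpow (by norm_num) (by positivity), ?_⟩
  rw [one_div, Real.inv_rpow (by norm_num), ← Real.rpow_mul (by norm_num), ← Real.rpow_neg
    (by norm_num), ← Real.rpow_add (by norm_num)]
  refine Real.rpow_lt_one_of_one_lt_of_neg (by norm_num) ?_
  have := mul_pos hp hα
  nlinarith

universe u v

/-- Moments of order `p < 2δ/γ²` of the chaos of a log-correlated field scale with the
multifractal exponent, uniformly over the field and the base measure. -/
lemma exists_hasMomentBound {δ γ C₀ Cσ : ℝ} (hγ : 0 ≤ γ) (hCσ : 0 ≤ Cσ) {p : ℝ} (hp : 0 < p)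
    (hpq : γ ^ 2 * p < 2 * δ) (R : ℝ) (hR : 1 ≤ R) :
    ∃ C, 0 ≤ C ∧ ∀ {Ω : Type u} [MeasurableSpace Ω] (P : Measure Ω) [SFinite P]
      (H : Submodule ℝ (Ω → ℝ)) {E : Type v} [PseudoMetricSpace E] [MeasurableSpace E]
      [OpensMeasurableSpace E] (σ : Measure E) [SFinite σ] (Y : E → Ω → ℝ) (ε : ℝ),
      IsGaussianSpace P H → IsLogField P H γ C₀ ε Y → 0 < ε → ε ≤ 1 → IsBallRegular σ δ Cσ ε →
      HasMomentBound P H σ Y ε R p (multifractalExponent δ γ p) C := by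
  obtain ⟨n, s, hs0, hs1, rfl⟩ : ∃ (n : ℕ) (s : ℝ), 0 < s ∧ s ≤ 1 ∧ p = s + n := by
    refine ⟨⌈p⌉₊ - 1, p - (⌈p⌉₊ - 1 : ℕ), ?_, ?_, by ring⟩
    · have h := Nat.ceil_lt_add_one hp.le
      have h1 : 1 ≤ ⌈p⌉₊ := Nat.one_le_ceil_iff.2 hp
      push_cast [Nat.cast_sub h1]
      linarith
    · have h := Nat.le_ceil p
      have h1 : 1 ≤ ⌈p⌉₊ := Nat.one_le_ceil_iff.2 hp
      push_cast [Nat.cast_sub h1]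
      linarith
  clear hp
  induction n generalizing R with
  | zero =>
    refine ⟨Cσ ^ s * Real.exp (γ ^ 2 * s * (1 - s) * (3 / 2 * (C₀ + Real.log R))), by positivity,
      ?_⟩
    intro Ω _ P _ H E _ _ _ σ _ Y ε hP hY hε hε1 hσ
    simpa using hY.hasMomentBound_of_le_one hP hγ hε hε1 hR hCσ hσ hs0.le hs1
  | succ n ih =>
    have hp' : 0 < s + n := by positivity
    push_cast at hpq ⊢
    obtain ⟨C, hC, h⟩ := ih (2 * R) (by linarith) (by nlinarith [sq_nonneg γ])
    obtain ⟨l, hl, hlα⟩ := exists_shell_weight (δ := δ) (γ := γ) hp'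
      (by rw [shellExponent]; nlinarith)
    refine ⟨_, mul_nonneg hCσ (shellConst_nonneg (C₀ := C₀) (R := R) hC hl hlα),
      ?_⟩
    intro Ω _ P _ H E _ _ _ σ _ Y ε hP hY hε hε1 hσ
    rw [← add_assoc]
    exact (h P H σ Y ε hP hY hε hε1 hσ).add_one hP hY hε hε1 hR hσ hp' hC hl hlα

end PositiveMoments

section CriticalMoment

lemma ENNReal.sum_rpow_le_rpow_sum {ι : Type*} (s : Finset ι) (a : ι → ℝ≥0∞) {q : ℝ}
    (hq : 1 ≤ q) : ∑ i ∈ s, a i ^ q ≤ (∑ i ∈ s, a i) ^ q := by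
  induction s using Finset.cons_induction with
  | empty => simp
  | cons i s hi ih =>
    rw [Finset.sum_cons, Finset.sum_cons]
    exact (add_le_add_right ih _).trans (ENNReal.add_rpow_le_rpow_add _ _ hq)

lemma ENNReal.tsub_rpow_le {a T : ℝ≥0∞} {s t : ℝ} (hs : 0 < s) (ht : 0 ≤ t) (hT0 : T ≠ 0) :
    (a - T) ^ s ≤ T ^ (-t) * a ^ (s + t) := by
  rcases le_total a T with h | h
  · simp [tsub_eq_zero_of_le h, hs]
  rcases eq_or_ne T ⊤ with rfl | hT
  · simp [hs]
  · have h1 : 1 ≤ T ^ (-t) * a ^ t := by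
      rw [ENNReal.rpow_neg, mul_comm, ← div_eq_mul_inv]
      rw [ENNReal.le_div_iff_mul_le (Or.inl (by simp [ENNReal.rpow_eq_zero_iff, hT0, hT]))
        (Or.inl (ENNReal.rpow_ne_top_of_nonneg ht hT)), one_mul]
      exact ENNReal.rpow_le_rpow h ht
    calc (a - T) ^ s ≤ a ^ s := ENNReal.rpow_le_rpow tsub_le_self hs.le
      _ ≤ a ^ s * (T ^ (-t) * a ^ t) := le_mul_of_one_le_right zero_le h1
      _ = _ := by rw [ENNReal.rpow_add_of_nonneg _ _ hs.le ht]; ring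

variable {Ω : Type*} [MeasurableSpace Ω] {P : Measure Ω}

/-- A superadditive family cannot have a finite moment of an order at which the small scales carry
a fixed amount of moment while some lower moment of the small scales is negligible. -/
lemma lintegral_rpow_eq_top_of_superadditive {ι : ℕ → Type*} [∀ n, Fintype (ι n)] {p q : ℝ}
    (hp : 0 < p) (hpq : p ≤ q) (hq : 1 ≤ q) {Z : Ω → ℝ≥0∞} {m : ∀ n, ι n → Ω → ℝ≥0∞}
    (hm : ∀ n i, Measurable (m n i)) (hsum : ∀ n ω, ∑ i, m n i ω ≤ Z ω) {c : ℝ≥0∞} (hc : c ≠ 0)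
    (hlow : ∀ n, c ≤ ∑ i, ∫⁻ ω, m n i ω ^ q ∂P)
    (hup : ∑' n, ∑ i, ∫⁻ ω, m n i ω ^ p ∂P ≠ ⊤) : ∫⁻ ω, Z ω ^ q ∂P = ⊤ := by
  by_contra hfin
  have hmp : ∀ n, Measurable fun ω => ∑ i, m n i ω ^ p := fun n =>
    Finset.measurable_sum _ fun i _ => (hm n i).pow_const p
  have hmq : ∀ n, Measurable fun ω => ∑ i, m n i ω ^ q := fun n =>
    Finset.measurable_sum _ fun i _ => (hm n i).pow_const q
  have h1 : ∀ᵐ ω ∂P, ∑' n, ∑ i, m n i ω ^ p ≠ ⊤ := by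
    refine (ae_lt_top (Measurable.tsum hmp) ?_).mono fun ω h => h.ne
    rw [lintegral_tsum fun n => (hmp n).aemeasurable]
    simpa only [lintegral_finsetSum _ fun i _ => (hm _ i).pow_const p] using hup
  have h2 : ∀ᵐ ω ∂P, Tendsto (fun n => ∑ i, m n i ω ^ q) atTop (𝓝 0) := by
    filter_upwards [h1] with ω hω
    have h3 := ENNReal.tendsto_atTop_zero_of_tsum_ne_top hω
    have h4 := (ENNReal.continuous_rpow_const (y := q / p)).continuousAt.tendsto.comp h3
    rw [ENNReal.zero_rpow_of_pos (by positivity)] at h4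
    refine tendsto_of_tendsto_of_tendsto_of_le_of_le tendsto_const_nhds h4 (fun n => zero_le)
      fun n => ?_
    refine le_trans (le_of_eq ?_) (ENNReal.sum_rpow_le_rpow_sum Finset.univ
      (fun i => m n i ω ^ p) ((one_le_div hp).2 hpq))
    refine Finset.sum_congr rfl fun i _ => ?_
    rw [← ENNReal.rpow_mul, mul_div_cancel₀ _ hp.ne']
  have h5 := tendsto_lintegral_of_dominated_convergence (μ := P) (fun ω => Z ω ^ q) hmq
    (fun n => ae_of_all _ fun ω => (ENNReal.sum_rpow_le_rpow_sum _ _ hq).trans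
      (ENNReal.rpow_le_rpow (hsum n ω) (by linarith))) hfin h2
  simp only [lintegral_finsetSum _ fun i _ => (hm _ i).pow_const q, lintegral_zero] at h5
  exact hc (le_antisymm (ge_of_tendsto' h5 hlow) zero_le)

variable {E : Type*} [PseudoMetricSpace E] [MeasurableSpace E] {H : Submodule ℝ (Ω → ℝ)}
  {σ : Measure E} {γ C₀ : ℝ}

/-- Lower bound for the moments of the limiting chaos at scale `ρ`, by a change of measure. -/
lemma IsLogField.le_lintegral_limit_rpow [IsProbabilityMeasure P] [SFinite σ]
    (hP : IsGaussianSpace P H) (hγ : 0 < γ) {Y : ℕ → E → Ω → ℝ} {ε : ℕ → ℝ}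
    (hY : ∀ n, IsLogField P H γ C₀ (ε n) (Y n)) {ρ : ℝ} (hρ : 0 < ρ) (hρ1 : ρ ≤ 1)
    (hερ : ∀ n, ε n ≤ ρ) {z : E} {A : Set E} (hA : MeasurableSet A)
    (hAρ : A ⊆ Metric.closedBall z ρ) {a : ℝ} (ha : 0 ≤ a) (haA : ENNReal.ofReal a ≤ σ A)
    {m : Ω → ℝ≥0∞}
    (hm : ∀ᵐ ω ∂P, Tendsto (fun n => chaosMass P σ (Y n) A ω) atTop (𝓝 (m ω)))
    {u : ℝ} (hu : 1 < u) {C : ℝ≥0∞} (hC : C ≠ ⊤)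
    (hmom : ∀ n, ∫⁻ ω, chaosMass P σ (Y n) A ω ^ u ∂P ≤ C) {q : ℝ} (hq : 1 < q) :
    ENNReal.ofReal (a ^ q * Real.exp (-(q * (q - 1) * γ ^ 2 * (3 / 2 * C₀))) *
      ρ ^ (-(γ ^ 2 * q * (q - 1) / 2))) ≤ ∫⁻ ω, m ω ^ q ∂P := by
  set b := γ * (q - 1) with hb
  have hb0 : 0 < b := mul_pos hγ (by linarith)
  set w := -Real.log ρ + C₀ with hw
  choose N hN hNN hNY using fun n => (hY n).coarse z ρ (hερ n) hρ1
  have hbN : ∀ n, b • N n ∈ H := fun n => H.smul_mem b (hN n)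
  set g : ℕ → Ω → ℝ≥0∞ := fun n => wickExp P (b • N n)
  have hgm : ∀ n, Measurable (g n) := fun n => hP.measurable_wickExp (hbN n)
  set Mn : ℕ → Ω → ℝ≥0∞ := fun n => chaosMass P σ (Y n) A
  have hMm : ∀ n, Measurable (Mn n) := fun n => (hY n).measurable_chaosMass A
  have hgint : ∀ r : ℝ, 1 < r → ∀ n, (∫⁻ ω, g n ω ^ (r / (r - 1)) ∂P) ^ (1 / (r / (r - 1))) ≤
      ENNReal.ofReal (Real.exp (b ^ 2 * w / (2 * (r - 1)))) := by
    intro r hr n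
    have hr1 : 0 < r - 1 := by linarith
    simp only [g]
    rw [hP.lintegral_wickExp_rpow (hbN n), ENNReal.ofReal_rpow_of_pos (Real.exp_pos _),
      ← Real.exp_mul, mixedMoment_smul_left, mixedMoment_smul_right]
    refine ENNReal.ofReal_le_ofReal (Real.exp_le_exp.2 ?_)
    have e : (((r / (r - 1)) ^ 2 - r / (r - 1)) * (b * (b * mixedMoment P (N n) (N n))) / 2 *
        (1 / (r / (r - 1)))) = b ^ 2 * mixedMoment P (N n) (N n) / (2 * (r - 1)) := by
      have : r ≠ 0 := by linarith
      field_simp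
      ring
    rw [e]
    have := hNN n
    gcongr
  have hlow : ∀ n, ENNReal.ofReal (a * Real.exp (b * (γ * (-Real.log ρ - C₀)))) ≤
      ∫⁻ ω, Mn n ω * g n ω ∂P := by
    intro n
    simp_rw [mul_comm (Mn n _)]
    rw [(hY n).lintegral_wickExp_mul_chaosMass hP A (hbN n), ENNReal.ofReal_mul ha, mul_comm]
    calc _ ≤ ENNReal.ofReal (Real.exp (b * (γ * (-Real.log ρ - C₀)))) * σ A := by gcongr
      _ = ∫⁻ _ in A, ENNReal.ofReal (Real.exp (b * (γ * (-Real.log ρ - C₀)))) ∂σ := by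
        rw [setLIntegral_const]
      _ ≤ _ := by
        refine setLIntegral_mono' hA fun y hy =>
          ENNReal.ofReal_le_ofReal (Real.exp_le_exp.2 ?_)
        rw [mixedMoment_smul_left]
        refine mul_le_mul_of_nonneg_left (le_trans (le_of_eq ?_) (hNY n y)) hb0.le
        rw [max_eq_right (Metric.mem_closedBall.1 (hAρ hy))]
  set s := (1 + u) / 2 with hs
  set t := (u - 1) / 2 with ht
  have hs1 : 1 < s := by rw [hs]; linarith
  have ht0 : 0 < t := by rw [ht]; linarith
  have hstu : s + t = u := by rw [hs, ht]; ring
  set G := ENNReal.ofReal (Real.exp (b ^ 2 * w / (2 * (q - 1)))) with hG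
  set G' := ENNReal.ofReal (Real.exp (b ^ 2 * w / (2 * (s - 1))))
  have hconj : ∀ r : ℝ, 1 < r → r.HolderConjugate (r / (r - 1)) := fun r hr =>
    Real.HolderConjugate.conjExponent hr
  have hT : ∀ (T : ℕ), T ≠ 0 → ∀ n, ENNReal.ofReal (a * Real.exp (b * (γ * (-Real.log ρ - C₀)))) ≤
      (∫⁻ ω, min (Mn n ω) T ^ q ∂P) ^ (1 / q) * G + ((T : ℝ≥0∞) ^ (-t) * C) ^ (1 / s) * G' := by
    intro T hT0 n
    have hTm : Measurable fun ω => Mn n ω - (T : ℝ≥0∞) := (hMm n).sub measurable_const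
    refine (hlow n).trans ?_
    have hsplit : ∀ ω, Mn n ω * g n ω = min (Mn n ω) T * g n ω + (Mn n ω - T) * g n ω := by
      intro ω
      rw [← add_mul]
      congr 1
      rcases le_total (Mn n ω) T with h | h
      · rw [min_eq_left h, tsub_eq_zero_of_le h, add_zero]
      · rw [min_eq_right h, add_tsub_cancel_of_le h]
    simp_rw [hsplit]
    rw [lintegral_add_left (f := fun ω => min (Mn n ω) T * g n ω)
      (((hMm n).min measurable_const).mul (hgm n))]
    refine add_le_add ?_ ?_
    · refine (ENNReal.lintegral_mul_le_Lp_mul_Lq P (hconj q hq)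
        ((hMm n).min measurable_const).aemeasurable (hgm n).aemeasurable).trans ?_
      gcongr
      exact hgint q hq n
    · refine (ENNReal.lintegral_mul_le_Lp_mul_Lq P (hconj s hs1) hTm.aemeasurable
        (hgm n).aemeasurable).trans ?_
      gcongr
      · calc _ ≤ ∫⁻ ω, (T : ℝ≥0∞) ^ (-t) * Mn n ω ^ (s + t) ∂P := lintegral_mono fun ω =>
              ENNReal.tsub_rpow_le (by linarith) ht0.le (by exact_mod_cast hT0)
          _ = (T : ℝ≥0∞) ^ (-t) * ∫⁻ ω, Mn n ω ^ (s + t) ∂P :=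
              lintegral_const_mul _ ((hMm n).pow_const _)
          _ ≤ _ := by
              rw [hstu]
              gcongr
              exact hmom n
      · exact hgint s hs1 n
  have hlim : ∀ T : ℕ, T ≠ 0 → ENNReal.ofReal (a * Real.exp (b * (γ * (-Real.log ρ - C₀)))) ≤
      (∫⁻ ω, m ω ^ q ∂P) ^ (1 / q) * G + ((T : ℝ≥0∞) ^ (-t) * C) ^ (1 / s) * G' := by
    intro T hT0
    have h1 : Tendsto (fun n => ∫⁻ ω, min (Mn n ω) T ^ q ∂P) atTop
        (𝓝 (∫⁻ ω, min (m ω) T ^ q ∂P)) := by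
      refine tendsto_lintegral_of_dominated_convergence (fun _ => (T : ℝ≥0∞) ^ q)
        (fun n => ((hMm n).min measurable_const).pow_const q)
        (fun n => ae_of_all _ fun ω => ENNReal.rpow_le_rpow (min_le_right _ _) (by linarith)) ?_ ?_
      · simp [(by linarith : (0 : ℝ) ≤ q)]
      · filter_upwards [hm] with ω hω
        exact (ENNReal.continuous_rpow_const.tendsto _).comp (hω.min tendsto_const_nhds)
    have h2 := (((ENNReal.continuous_rpow_const (y := 1 / q)).tendsto _).comp h1)
    have h3 := (ENNReal.Tendsto.mul_const h2 (Or.inr ENNReal.ofReal_ne_top : _ ∨ G ≠ ⊤)).add_const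
      (((T : ℝ≥0∞) ^ (-t) * C) ^ (1 / s) * G')
    refine (ge_of_tendsto' h3 (hT T hT0)).trans ?_
    gcongr
    exact min_le_left _ _
  have hlim' : ENNReal.ofReal (a * Real.exp (b * (γ * (-Real.log ρ - C₀)))) ≤
      (∫⁻ ω, m ω ^ q ∂P) ^ (1 / q) * G := by
    have h1 : Tendsto (fun T : ℕ => (T : ℝ≥0∞) ^ (-t)) atTop (𝓝 0) := by
      simp_rw [ENNReal.rpow_neg]
      rw [← ENNReal.inv_top, tendsto_inv_iff]
      have h := ENNReal.tendsto_ofReal_atTop.comp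
        ((tendsto_rpow_atTop ht0).comp tendsto_natCast_atTop_atTop)
      refine h.congr fun T => ?_
      simp only [Function.comp]
      rw [← ENNReal.ofReal_rpow_of_nonneg (by positivity) ht0.le, ENNReal.ofReal_natCast]
    have h2 := ENNReal.Tendsto.mul_const h1 (Or.inr hC)
    have h3 := ((ENNReal.continuous_rpow_const (y := 1 / s)).tendsto _).comp h2
    have h4 := (ENNReal.Tendsto.mul_const h3 (Or.inr ENNReal.ofReal_ne_top : _ ∨ G' ≠ ⊤)).const_add
      ((∫⁻ ω, m ω ^ q ∂P) ^ (1 / q) * G)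
    rw [zero_mul, ENNReal.zero_rpow_of_pos (by positivity), zero_mul, add_zero] at h4
    refine ge_of_tendsto h4 ?_
    filter_upwards [eventually_ne_atTop 0] with T hT0
    exact hlim T hT0
  have hq0 : 0 < q := by linarith
  have h5 := ENNReal.rpow_le_rpow hlim' hq0.le
  rw [ENNReal.mul_rpow_of_nonneg _ _ hq0.le, ← ENNReal.rpow_mul, one_div_mul_cancel hq0.ne',
    ENNReal.rpow_one, hG, ENNReal.ofReal_rpow_of_nonneg (by positivity) hq0.le,
    ENNReal.ofReal_rpow_of_pos (Real.exp_pos _), ← Real.exp_mul] at h5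
  set y := b ^ 2 * w / (2 * (q - 1)) * q with hy
  calc _ = ENNReal.ofReal ((a * Real.exp (b * (γ * (-Real.log ρ - C₀)))) ^ q) *
        ENNReal.ofReal (Real.exp (-y)) := by
        rw [← ENNReal.ofReal_mul (by positivity), Real.mul_rpow ha (by positivity), ← Real.exp_mul,
          Real.rpow_def_of_pos hρ, mul_assoc (a ^ q), mul_assoc (a ^ q), ← Real.exp_add,
          ← Real.exp_add, hy, hw, hb]
        have : q - 1 ≠ 0 := by linarith
        congr 3
        field_simp
        ring
    _ ≤ (∫⁻ ω, m ω ^ q ∂P) * ENNReal.ofReal (Real.exp y) * ENNReal.ofReal (Real.exp (-y)) := by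
        gcongr
    _ = _ := by
        rw [mul_assoc, ← ENNReal.ofReal_mul (by positivity), ← Real.exp_add]
        simp

/-- Upper bound for the moments of the limiting chaos at scale `ρ`. -/
lemma HasMomentBound.lintegral_limit_rpow_le [SFinite P] [SFinite σ] {Y : ℕ → E → Ω → ℝ}
    {ε : ℕ → ℝ} (hY : ∀ n, IsLogField P H γ C₀ (ε n) (Y n)) {R p ζ C : ℝ}
    (hB : ∀ n, HasMomentBound P H σ (Y n) (ε n) R p ζ C) {ρ : ℝ} (hρR : ρ ≤ R)
    (hερ : ∀ n, ε n ≤ ρ) {z : E} {A : Set E} (hA : MeasurableSet A)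
    (hAρ : A ⊆ Metric.closedBall z ρ) {m : Ω → ℝ≥0∞}
    (hm : ∀ᵐ ω ∂P, Tendsto (fun n => chaosMass P σ (Y n) A ω) atTop (𝓝 (m ω))) :
    ∫⁻ ω, m ω ^ p ∂P ≤ ENNReal.ofReal (C * ρ ^ ζ) := by
  have h1 : ∀ n, ∫⁻ ω, chaosMass P σ (Y n) A ω ^ p ∂P ≤ ENNReal.ofReal (C * ρ ^ ζ) := fun n => by
    have := hB n 0 H.zero_mem z ρ A 0 (hερ n) hρR hA hAρ (by simp [mixedMoment])
    simpa [wickExp, mixedMoment] using this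
  calc _ = ∫⁻ ω, liminf (fun n => chaosMass P σ (Y n) A ω ^ p) atTop ∂P := by
        refine lintegral_congr_ae ?_
        filter_upwards [hm] with ω hω
        exact ((ENNReal.continuous_rpow_const.tendsto _).comp hω).liminf_eq.symm
    _ ≤ liminf (fun n => ∫⁻ ω, chaosMass P σ (Y n) A ω ^ p ∂P) atTop :=
        lintegral_liminf_le fun n => ((hY n).measurable_chaosMass A).pow_const p
    _ ≤ _ := liminf_le_of_le (by isBoundedDefault) fun b hb => by
        obtain ⟨n, hn⟩ := hb.exists
        exact hn.trans (h1 n)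

end CriticalMoment

section GaussianConcentration

variable {ι : Type*} [Fintype ι]

/-- The log-sum-exp function at inverse temperature `β`, with offsets `c`. -/
def logSumExp (β : ℝ) (c x : ι → ℝ) : ℝ := Real.log (∑ k, Real.exp (β * (x k + c k))) / β

/-- The Gibbs weights, which form the gradient of `logSumExp`. -/
def gibbsWeight (β : ℝ) (c x : ι → ℝ) (k : ι) : ℝ :=
  Real.exp (β * (x k + c k)) / ∑ j, Real.exp (β * (x j + c j))

variable [Nonempty ι]

lemma sum_exp_pos (f : ι → ℝ) : 0 < ∑ k, Real.exp (f k) :=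
  Finset.sum_pos (fun _ _ => Real.exp_pos _) Finset.univ_nonempty

lemma gibbsWeight_nonneg (β : ℝ) (c x : ι → ℝ) (k : ι) : 0 ≤ gibbsWeight β c x k :=
  div_nonneg (Real.exp_pos _).le (sum_exp_pos _).le

lemma sum_gibbsWeight (β : ℝ) (c x : ι → ℝ) : ∑ k, gibbsWeight β c x k = 1 := by
  simp only [gibbsWeight]
  rw [← Finset.sum_div, div_self (sum_exp_pos _).ne']

lemma continuous_gibbsWeight (β : ℝ) (c : ι → ℝ) (k : ι) :
    Continuous fun x => gibbsWeight β c x k := by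
  unfold gibbsWeight
  exact Continuous.div (by fun_prop) (by fun_prop) fun x => (sum_exp_pos _).ne'

lemma continuous_logSumExp (β : ℝ) (c : ι → ℝ) : Continuous (logSumExp β c) := by
  unfold logSumExp
  exact (Continuous.log (by fun_prop) fun x => (sum_exp_pos _).ne').div_const _

lemma le_logSumExp {β : ℝ} (hβ : 0 < β) (c x : ι → ℝ) (k : ι) :
    x k + c k ≤ logSumExp β c x := by
  rw [logSumExp, le_div_iff₀' hβ, Real.le_log_iff_exp_le (sum_exp_pos _)]
  exact Finset.single_le_sum (f := fun k => Real.exp (β * (x k + c k)))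
    (fun _ _ => (Real.exp_pos _).le) (Finset.mem_univ k)

lemma exists_logSumExp_le (c x : ι → ℝ) :
    ∃ k, logSumExp (Fintype.card ι) c x ≤ x k + c k + 1 := by
  obtain ⟨k, -, hk⟩ := Finset.exists_max_image Finset.univ (fun k => x k + c k)
    Finset.univ_nonempty
  have hβ : (0 : ℝ) < Fintype.card ι := by exact_mod_cast Fintype.card_pos
  refine ⟨k, ?_⟩
  rw [logSumExp, div_le_iff₀' hβ]
  have h1 : ∑ j, Real.exp (Fintype.card ι * (x j + c j)) ≤
      Fintype.card ι * Real.exp (Fintype.card ι * (x k + c k)) := by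
    rw [← nsmul_eq_mul, ← Finset.card_univ]
    refine Finset.sum_le_card_nsmul _ _ _ fun j hj => ?_
    exact Real.exp_le_exp.2 (mul_le_mul_of_nonneg_left (hk j hj) (by positivity))
  refine (Real.log_le_log (sum_exp_pos _) h1).trans ?_
  rw [Real.log_mul hβ.ne' (Real.exp_pos _).ne', Real.log_exp]
  have := Real.log_le_sub_one_of_pos hβ
  rw [mul_add _ (x k + c k) 1]
  linarith

lemma hasDerivAt_logSumExp {β : ℝ} (hβ : β ≠ 0) (c : ι → ℝ) {u : ℝ → ι → ℝ} {u' : ι → ℝ} {t : ℝ}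
    (hu : ∀ k, HasDerivAt (fun s => u s k) (u' k) t) :
    HasDerivAt (fun s => logSumExp β c (u s)) (∑ k, gibbsWeight β c (u t) k * u' k) t := by
  have h1 : HasDerivAt (fun s => ∑ k, Real.exp (β * (u s k + c k)))
      (∑ k, Real.exp (β * (u t k + c k)) * (β * u' k)) t :=
    HasDerivAt.fun_sum fun k _ => (((hu k).add_const (c k)).const_mul β).exp
  have h2 := (h1.log (sum_exp_pos _).ne').div_const β
  refine h2.congr_deriv ?_
  unfold gibbsWeight
  rw [Finset.sum_div, Finset.sum_div]
  refine Finset.sum_congr rfl fun k _ => ?_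
  have := (sum_exp_pos fun k => β * (u t k + c k)).ne'
  field_simp

/-- Convexity bound for an increment of `logSumExp` along the rotation of the pair `(x, y)`. -/
lemma exp_mul_logSumExp_sub_le {β : ℝ} (hβ : β ≠ 0) (c x y : ι → ℝ) (a : ℝ) :
    ENNReal.ofReal (Real.exp (a * (logSumExp β c y - logSumExp β c x))) ≤
      ENNReal.ofReal (2 / Real.pi) * ∫⁻ θ in Set.Ioc 0 (Real.pi / 2), ENNReal.ofReal
        (∑ k, gibbsWeight β c (ContinuousLinearMap.rotation θ (x, y)).1 k *
          Real.exp (a * (Real.pi / 2) * (ContinuousLinearMap.rotation θ (x, y)).2 k)) := by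
  have hπ := Real.pi_pos
  set A := a * (logSumExp β c y - logSumExp β c x) with hA
  set b := a * (Real.pi / 2) with hb
  simp only [ContinuousLinearMap.rotation_apply]
  set u : ℝ → ι → ℝ := fun θ => Real.cos θ • x + Real.sin θ • y with hu
  set u' : ℝ → ι → ℝ := fun θ => -Real.sin θ • x + Real.cos θ • y with hu'
  have huc : Continuous u := by fun_prop
  have huc' : ∀ k, Continuous fun θ => u' θ k := fun k => by
    simp only [hu', Pi.add_apply, Pi.smul_apply]; fun_prop
  have hder : ∀ θ k, HasDerivAt (fun s => u s k) (u' θ k) θ := fun θ k => by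
    simp only [hu, hu', Pi.add_apply, Pi.smul_apply, smul_eq_mul]
    exact ((Real.hasDerivAt_cos θ).mul_const _).add ((Real.hasDerivAt_sin θ).mul_const _)
  set D : ℝ → ℝ := fun θ => ∑ k, gibbsWeight β c (u θ) k * u' θ k
  have hgc : ∀ k, Continuous fun θ => gibbsWeight β c (u θ) k := fun k =>
    (continuous_gibbsWeight β c k).comp huc
  have hDc : Continuous D :=
    continuous_finsetSum _ fun k _ => (hgc k).mul (huc' k)
  have hftc : ∫ θ in (0 : ℝ)..(Real.pi / 2), D θ = logSumExp β c y - logSumExp β c x := by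
    rw [intervalIntegral.integral_eq_sub_of_hasDerivAt
      (fun θ _ => hasDerivAt_logSumExp hβ c (hder θ)) (hDc.intervalIntegrable _ _)]
    simp [hu]
  set h : ℝ → ℝ := fun θ => ∑ k, gibbsWeight β c (u θ) k * Real.exp (b * u' θ k)
  have hhc : Continuous h :=
    continuous_finsetSum _ fun k _ => (hgc k).mul (Real.continuous_exp.comp ((huc' k).const_mul b))
  have hh0 : ∀ θ, 0 ≤ h θ := fun θ =>
    Finset.sum_nonneg fun k _ => mul_nonneg (gibbsWeight_nonneg _ _ _ _) (Real.exp_pos _).le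
  have hpt : ∀ θ, Real.exp A * (1 - A + b * D θ) ≤ h θ := by
    intro θ
    have h1 : ∀ z : ℝ, Real.exp A * (1 - A + z) ≤ Real.exp z := fun z => by
      have h2 : Real.exp z = Real.exp A * Real.exp (z - A) := by rw [← Real.exp_add]; ring_nf
      rw [h2]
      refine mul_le_mul_of_nonneg_left ?_ (Real.exp_pos _).le
      linarith [Real.add_one_le_exp (z - A)]
    calc _ = ∑ k, gibbsWeight β c (u θ) k * (Real.exp A * (1 - A + b * u' θ k)) := by
          have h3 : ∀ k, gibbsWeight β c (u θ) k * (Real.exp A * (1 - A + b * u' θ k)) =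
              Real.exp A * (1 - A) * gibbsWeight β c (u θ) k +
              Real.exp A * b * (gibbsWeight β c (u θ) k * u' θ k) := fun k => by ring
          simp_rw [h3]
          rw [Finset.sum_add_distrib, ← Finset.mul_sum, ← Finset.mul_sum, sum_gibbsWeight]
          ring
      _ ≤ _ := Finset.sum_le_sum fun k _ =>
          mul_le_mul_of_nonneg_left (h1 _) (gibbsWeight_nonneg _ _ _ _)
  have hint : Real.pi / 2 * Real.exp A ≤ ∫ θ in (0 : ℝ)..(Real.pi / 2), h θ := by
    have h4 := intervalIntegral.integral_mono_on (μ := volume) (a := 0) (b := Real.pi / 2)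
      (by positivity)
      (Continuous.intervalIntegrable (by fun_prop) _ _) (hhc.intervalIntegrable _ _)
      fun θ _ => hpt θ
    rw [intervalIntegral.integral_const_mul, intervalIntegral.integral_add
      ((continuous_const (y := 1 - A)).intervalIntegrable _ _)
      ((hDc.const_mul b).intervalIntegrable _ _), intervalIntegral.integral_const_mul, hftc,
      intervalIntegral.integral_const, smul_eq_mul] at h4
    refine le_trans (le_of_eq ?_) h4
    rw [hb, hA]
    ring
  rw [intervalIntegral.integral_of_le (by positivity)] at hint
  rw [← ofReal_integral_eq_lintegral_ofReal
    ((hhc.integrableOn_Icc (a := 0) (b := Real.pi / 2)).mono_set Set.Ioc_subset_Icc_self)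
    (ae_of_all _ hh0), ← ENNReal.ofReal_mul (by positivity)]
  refine ENNReal.ofReal_le_ofReal ?_
  calc Real.exp A = 2 / Real.pi * (Real.pi / 2 * Real.exp A) := by field_simp
    _ ≤ _ := by gcongr

variable {Ω : Type*} [MeasurableSpace Ω] {P : Measure Ω} {H : Submodule ℝ (Ω → ℝ)}

/-- Gaussian concentration for `logSumExp`, by the rotation argument of Maurey and Pisier. -/
lemma IsGaussianSpace.lintegral_exp_logSumExp_mul_le [IsProbabilityMeasure P]
    (hP : IsGaussianSpace P H) {ξ : ι → Ω → ℝ} (hξ : ∀ k, ξ k ∈ H) {T : ℝ}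
    (hT : ∀ k, mixedMoment P (ξ k) (ξ k) ≤ T) {β : ℝ} (hβ : β ≠ 0) (c : ι → ℝ) (a : ℝ) :
    (∫⁻ ω, ENNReal.ofReal (Real.exp (-(a * logSumExp β c fun k => ξ k ω))) ∂P) *
      (∫⁻ ω, ENNReal.ofReal (Real.exp (a * logSumExp β c fun k => ξ k ω)) ∂P) ≤
      ENNReal.ofReal (Real.exp ((a * (Real.pi / 2)) ^ 2 * T / 2)) := by
  classical
  have hξm : Measurable fun ω k => ξ k ω :=
    measurable_pi_lambda _ fun k => hP.measurable _ (hξ k)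
  set μ : Measure (ι → ℝ) := P.map fun ω k => ξ k ω with hμ
  have : IsProbabilityMeasure μ := Measure.isProbabilityMeasure_map hξm.aemeasurable
  set b := a * (Real.pi / 2) with hb
  have hL : ∀ L : (ι → ℝ) →L[ℝ] ℝ, μ.map L = gaussianReal 0
      (mixedMoment P (∑ k, L (Pi.single k 1) • ξ k) (∑ k, L (Pi.single k 1) • ξ k)).toNNReal := by
    intro L
    rw [← hP.law_eq (H.sum_mem fun k _ => H.smul_mem _ (hξ k)), hμ,
      Measure.map_map L.continuous.measurable hξm]
    congr 1
    ext ω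
    simp only [Function.comp, Finset.sum_apply, Pi.smul_apply, smul_eq_mul]
    conv_lhs => rw [pi_eq_sum_univ' (fun k => ξ k ω)]
    rw [map_sum]
    refine Finset.sum_congr rfl fun k _ => ?_
    rw [map_smul, smul_eq_mul, mul_comm]
  have hG : IsGaussian μ := isGaussian_of_map_eq_gaussianReal fun L => ⟨_, _, hL L⟩
  have hmean : ∀ L : StrongDual ℝ (ι → ℝ), μ[L] = 0 := fun L => by
    have := integral_map (μ := μ) L.continuous.measurable.aemeasurable
      (f := fun x : ℝ => x) (by fun_prop)
    rw [← this, hL L, integral_id_gaussianReal]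
  have hrot := fun θ => IsGaussian.map_rotation_eq_self_of_forall_strongDual_eq_zero hmean θ
  set h : (ι → ℝ) × (ι → ℝ) → ℝ≥0∞ := fun z =>
    ENNReal.ofReal (∑ k, gibbsWeight β c z.1 k * Real.exp (b * z.2 k))
  have hhc : Continuous fun z : (ι → ℝ) × (ι → ℝ) =>
      ∑ k, gibbsWeight β c z.1 k * Real.exp (b * z.2 k) :=
    continuous_finsetSum _ fun k _ =>
      ((continuous_gibbsWeight β c k).comp continuous_fst).mul (by fun_prop)
  have hhm : Measurable h := hhc.measurable.ennreal_ofReal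
  have hφ := (continuous_logSumExp β c).measurable
  have hbound : ∫⁻ z, h z ∂(μ.prod μ) ≤ ENNReal.ofReal (Real.exp (b ^ 2 * T / 2)) := by
    rw [lintegral_prod _ hhm.aemeasurable]
    have h1 : ∀ x, ∫⁻ y, h (x, y) ∂μ ≤ ENNReal.ofReal (Real.exp (b ^ 2 * T / 2)) := by
      intro x
      have h2 : ∀ y, h (x, y) = ∑ k, ENNReal.ofReal (gibbsWeight β c x k) *
          ENNReal.ofReal (Real.exp (b * y k)) := fun y => by
        simp only [h]
        rw [ENNReal.ofReal_sum_of_nonneg fun k _ =>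
          mul_nonneg (gibbsWeight_nonneg _ _ _ _) (Real.exp_pos _).le]
        exact Finset.sum_congr rfl fun k _ => ENNReal.ofReal_mul (gibbsWeight_nonneg _ _ _ _)
      simp_rw [h2]
      rw [lintegral_finsetSum _ fun k _ => by fun_prop]
      have h3 : ∀ k, ∫⁻ y : ι → ℝ, ENNReal.ofReal (gibbsWeight β c x k) *
          ENNReal.ofReal (Real.exp (b * y k)) ∂μ ≤ ENNReal.ofReal (gibbsWeight β c x k) *
          ENNReal.ofReal (Real.exp (b ^ 2 * T / 2)) := fun k => by
        rw [lintegral_const_mul' _ _ ENNReal.ofReal_ne_top, hμ, lintegral_map (by fun_prop) hξm]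
        gcongr
        have h4 := hP.lintegral_exp (H.smul_mem b (hξ k))
        simp only [Pi.smul_apply, smul_eq_mul] at h4
        rw [h4, mixedMoment_smul_left, mixedMoment_smul_right]
        refine ENNReal.ofReal_le_ofReal (Real.exp_le_exp.2 ?_)
        have := mul_le_mul_of_nonneg_left (hT k) (sq_nonneg b)
        linarith
      refine (Finset.sum_le_sum fun k _ => h3 k).trans ?_
      rw [← Finset.sum_mul, ← ENNReal.ofReal_sum_of_nonneg fun k _ => gibbsWeight_nonneg _ _ _ _,
        sum_gibbsWeight, ENNReal.ofReal_one, one_mul]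
    refine (lintegral_mono h1).trans ?_
    simp
  have hm1 : Measurable fun x : ι → ℝ => ENNReal.ofReal (Real.exp (-(a * logSumExp β c x))) := by
    fun_prop
  have hm2 : Measurable fun x : ι → ℝ => ENNReal.ofReal (Real.exp (a * logSumExp β c x)) := by
    fun_prop
  have hprod : (∫⁻ ω, ENNReal.ofReal (Real.exp (-(a * logSumExp β c fun k => ξ k ω))) ∂P) *
      (∫⁻ ω, ENNReal.ofReal (Real.exp (a * logSumExp β c fun k => ξ k ω)) ∂P) =
      ∫⁻ z, ENNReal.ofReal (Real.exp (a * (logSumExp β c z.2 - logSumExp β c z.1)))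
        ∂(μ.prod μ) := by
    rw [← lintegral_map hm1 hξm, ← lintegral_map hm2 hξm, ← hμ,
      ← lintegral_prod_mul hm1.aemeasurable hm2.aemeasurable]
    refine lintegral_congr fun z => ?_
    rw [← ENNReal.ofReal_mul (Real.exp_pos _).le, ← Real.exp_add]
    ring_nf
  have hrc : Continuous fun q : ℝ × ((ι → ℝ) × (ι → ℝ)) =>
      ContinuousLinearMap.rotation q.1 q.2 := by
    simp only [ContinuousLinearMap.rotation_apply]
    fun_prop
  rw [hprod]
  have hπ := Real.pi_pos
  calc _ ≤ ∫⁻ z, (ENNReal.ofReal (2 / Real.pi) * ∫⁻ θ in Set.Ioc 0 (Real.pi / 2),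
        h (ContinuousLinearMap.rotation θ z)) ∂(μ.prod μ) :=
        lintegral_mono fun z => exp_mul_logSumExp_sub_le hβ c z.1 z.2 a
    _ = ENNReal.ofReal (2 / Real.pi) * ∫⁻ θ in Set.Ioc 0 (Real.pi / 2), (∫⁻ z,
        h (ContinuousLinearMap.rotation θ z) ∂(μ.prod μ)) := by
        rw [lintegral_const_mul' _ _ ENNReal.ofReal_ne_top, lintegral_lintegral_swap]
        exact (hhm.comp (hrc.measurable.comp measurable_swap)).aemeasurable
    _ = ENNReal.ofReal (2 / Real.pi) *
        ∫⁻ θ in Set.Ioc 0 (Real.pi / 2), (∫⁻ z, h z ∂(μ.prod μ)) := by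
        congr 1
        refine lintegral_congr fun θ => ?_
        conv_rhs => rw [← hrot θ]
        rw [lintegral_map hhm (ContinuousLinearMap.rotation θ).continuous.measurable]
    _ = ∫⁻ z, h z ∂(μ.prod μ) := by
        rw [setLIntegral_const, Real.volume_Ioc, mul_left_comm,
          ← ENNReal.ofReal_mul (by positivity)]
        have : 2 / Real.pi * (Real.pi / 2 - 0) = 1 := by field_simp; ring
        rw [this, ENNReal.ofReal_one, mul_one]
    _ ≤ _ := hbound

end GaussianConcentration

section NegativeMoments

/-- Any set is covered, up to half of its outer measure, by finitely many unit cubes (for the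
coordinates `X`) centred at its points. -/
lemma exists_finite_cube_cover {Ω ι : Type*} [Fintype ι] [MeasurableSpace Ω] {P : Measure Ω}
    (X : ι → Ω → ℝ) {G : Set Ω} {t : ℝ} (ht : 0 < t) (hG : ENNReal.ofReal t ≤ P G) :
    ∃ (N : ℕ) (c : Fin (N + 1) → Ω), (∀ k, c k ∈ G) ∧
      ENNReal.ofReal (t / 2) ≤ P {ω | ∃ k, ∀ i, |X i ω - X i (c k)| ≤ 1} := by
  have hne : G.Nonempty := by
    rw [Set.nonempty_iff_ne_empty]
    rintro rfl
    simp [ht.not_ge] at hG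
  obtain ⟨ω₁, hω₁⟩ := hne
  obtain ⟨e, he⟩ := exists_surjective_nat (ι → ℤ)
  classical
  let c : ℕ → Ω := fun n =>
    if h : ∃ ω ∈ G, (fun i => ⌊X i ω⌋) = e n then h.choose else ω₁
  have hc : ∀ n, c n ∈ G := by
    intro n
    by_cases h : ∃ ω ∈ G, (fun i => ⌊X i ω⌋) = e n
    · simp only [c, dif_pos h]; exact h.choose_spec.1
    · simp only [c, dif_neg h]; exact hω₁
  set B : ℕ → Set Ω := fun n => {ω | ∀ i, |X i ω - X i (c n)| ≤ 1}
  have hcover : G ⊆ ⋃ n, B n := by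
    intro ω hω
    obtain ⟨n, hn⟩ := he fun i => ⌊X i ω⌋
    have h : ∃ ω ∈ G, (fun i => ⌊X i ω⌋) = e n := ⟨ω, hω, hn.symm⟩
    have hcn : (fun i => ⌊X i (c n)⌋) = e n := by
      simp only [c, dif_pos h]; exact h.choose_spec.2
    refine Set.mem_iUnion.2 ⟨n, fun i => ?_⟩
    refine (Int.abs_sub_lt_one_of_floor_eq_floor ?_).le
    exact congrFun (hn.symm.trans hcn.symm) i
  have h1 : ENNReal.ofReal (t / 2) < P (⋃ n, B n) :=
    lt_of_lt_of_le (by rw [ENNReal.ofReal_lt_ofReal_iff ht]; linarith)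
      (hG.trans (measure_mono hcover))
  rw [measure_iUnion_eq_iSup_accumulate, lt_iSup_iff] at h1
  obtain ⟨N, hN⟩ := h1
  refine ⟨N, fun k => c k, fun k => hc k, hN.le.trans (measure_mono ?_)⟩
  intro ω hω
  obtain ⟨n, hn, hω⟩ := Set.mem_accumulate.1 hω
  exact ⟨⟨n, Nat.lt_succ_of_le hn⟩, hω⟩

variable {ι : Type*} [Fintype ι]

/-- Gibbs-type lower bound: the weights of `x₀` restricted to `A` linearise the exponential sum
from below. -/
lemma exists_weights_le_sum_exp {w v x₀ : ι → ℝ} (hw : ∀ i, 0 ≤ w i) {κ : ι → ι → ℝ} {m T : ℝ}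
    (hm : 0 < m) {A : Finset ι} (hA : m ≤ ∑ i ∈ A, w i * Real.exp (x₀ i - v i))
    (hT : ∑ i ∈ A, ∑ j ∈ A, κ i j * (w i * Real.exp (x₀ i - v i) * (w j * Real.exp (x₀ j - v j))) ≤
      T * (∑ i ∈ A, w i * Real.exp (x₀ i - v i)) ^ 2) :
    ∃ p : ι → ℝ, (∀ i, 0 ≤ p i) ∧ ∑ i, p i = 1 ∧ ∑ i, ∑ j, p i * p j * κ i j ≤ T ∧
      ∀ x : ι → ℝ, m * Real.exp (∑ i, p i * (x i - x₀ i)) ≤ ∑ i, w i * Real.exp (x i - v i) := by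
  classical
  set u : ι → ℝ := fun i => w i * Real.exp (x₀ i - v i) with hu
  have hu0 : ∀ i, 0 ≤ u i := fun i => mul_nonneg (hw i) (Real.exp_pos _).le
  set S := ∑ i ∈ A, u i with hS
  have hS0 : 0 < S := hm.trans_le hA
  set p : ι → ℝ := fun i => if i ∈ A then u i / S else 0 with hp
  have hp0 : ∀ i, 0 ≤ p i := fun i => by
    simp only [hp]; split_ifs
    · exact div_nonneg (hu0 i) hS0.le
    · exact le_rfl
  have hsum : ∀ F : ι → ℝ, ∑ i, p i * F i = (∑ i ∈ A, u i * F i) / S := fun F => by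
    simp only [hp, ite_mul, zero_mul]
    rw [Finset.sum_ite_mem, Finset.univ_inter, Finset.sum_div]
    exact Finset.sum_congr rfl fun i _ => by ring
  have hp1 : ∑ i, p i = 1 := by
    have := hsum fun _ => 1
    simp only [mul_one] at this
    rw [this, ← hS, div_self hS0.ne']
  refine ⟨p, hp0, hp1, ?_, fun x => ?_⟩
  · have h1 : ∑ i, ∑ j, p i * p j * κ i j = (∑ i ∈ A, ∑ j ∈ A, κ i j * (u i * u j)) / S ^ 2 := by
      simp_rw [mul_assoc, ← Finset.mul_sum, hsum]
      rw [pow_two, ← div_div]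
      congr 1
      rw [Finset.sum_div]
      refine Finset.sum_congr rfl fun i _ => ?_
      rw [mul_div_assoc', Finset.mul_sum]
      congr 1
      exact Finset.sum_congr rfl fun j _ => by ring
    rw [h1, div_le_iff₀ (by positivity)]
    exact hT
  · set z := ∑ i, p i * (x i - x₀ i) with hz
    have h2 : ∀ i, u i * (Real.exp z * (1 + (x i - x₀ i) - z)) ≤ w i * Real.exp (x i - v i) := by
      intro i
      have h3 : w i * Real.exp (x i - v i) = u i * (Real.exp z * Real.exp (x i - x₀ i - z)) := by
        simp only [hu]
        rw [mul_assoc, ← Real.exp_add, ← Real.exp_add]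
        ring_nf
      rw [h3]
      refine mul_le_mul_of_nonneg_left (mul_le_mul_of_nonneg_left ?_ (Real.exp_pos _).le) (hu0 i)
      linarith [Real.add_one_le_exp (x i - x₀ i - z)]
    have h4 : ∑ i ∈ A, u i * (x i - x₀ i) = z * S := by
      rw [hz, hsum, div_mul_cancel₀ _ hS0.ne']
    calc m * Real.exp z ≤ S * Real.exp z := by gcongr
      _ = ∑ i ∈ A, u i * (Real.exp z * (1 + (x i - x₀ i) - z)) := by
        have h5 : ∀ i, u i * (Real.exp z * (1 + (x i - x₀ i) - z)) =
            Real.exp z * (1 - z) * u i + Real.exp z * (u i * (x i - x₀ i)) := fun i => by ring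
        simp_rw [h5]
        rw [Finset.sum_add_distrib, ← Finset.mul_sum, ← Finset.mul_sum, h4, ← hS]
        ring
      _ ≤ ∑ i ∈ A, w i * Real.exp (x i - v i) := Finset.sum_le_sum fun i _ => h2 i
      _ ≤ _ := Finset.sum_le_sum_of_subset_of_nonneg (Finset.subset_univ _) fun i _ _ =>
        mul_nonneg (hw i) (Real.exp_pos _).le

variable {Ω : Type*} [MeasurableSpace Ω] {P : Measure Ω} {H : Submodule ℝ (Ω → ℝ)}

lemma IsGaussianSpace.mixedMoment_sum_left {ι : Type*} (hP : IsGaussianSpace P H) {X : ι → Ω → ℝ}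
    (hX : ∀ i, X i ∈ H) {L : Ω → ℝ} (hL : L ∈ H) (s : Finset ι) :
    mixedMoment P (∑ i ∈ s, X i) L = ∑ i ∈ s, mixedMoment P (X i) L := by
  classical
  induction s using Finset.induction_on with
  | empty => simpa using mixedMoment_smul_left (P := P) 0 L L
  | insert i s hi ih =>
    rw [Finset.sum_insert hi, Finset.sum_insert hi,
      hP.mixedMoment_add_left (hX i) (H.sum_mem fun j _ => hX j) hL, ih]

lemma IsGaussianSpace.mixedMoment_sum_smul_self (hP : IsGaussianSpace P H) {X : ι → Ω → ℝ}
    (hX : ∀ i, X i ∈ H) (p : ι → ℝ) :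
    mixedMoment P (∑ i, p i • X i) (∑ i, p i • X i) =
      ∑ i, ∑ j, p i * p j * mixedMoment P (X i) (X j) := by
  have hpX : ∀ i, p i • X i ∈ H := fun i => H.smul_mem _ (hX i)
  rw [hP.mixedMoment_sum_left hpX (H.sum_mem fun i _ => hpX i)]
  refine Finset.sum_congr rfl fun i _ => ?_
  rw [mixedMoment_comm, hP.mixedMoment_sum_left hpX (hpX i)]
  refine Finset.sum_congr rfl fun j _ => ?_
  rw [mixedMoment_comm, mixedMoment_smul_left, mixedMoment_smul_right]
  ring

/-- Negative moments of a finite Gaussian exponential sum, from a positive lower bound on the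
probability that it carries a sub-sum of bounded energy. -/
lemma IsGaussianSpace.lintegral_sum_exp_rpow_neg_le [IsProbabilityMeasure P]
    (hP : IsGaussianSpace P H) {X : ι → Ω → ℝ} (hX : ∀ i, X i ∈ H) {w v : ι → ℝ}
    (hw : ∀ i, 0 ≤ w i) {m T t a : ℝ} (hm : 0 < m) (ht : 0 < t) (ha : 0 < a)
    (hgood : ENNReal.ofReal t ≤ P {ω | ∃ A : Finset ι, m ≤ ∑ i ∈ A, w i * Real.exp (X i ω - v i) ∧
      ∑ i ∈ A, ∑ j ∈ A, mixedMoment P (X i) (X j) *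
        (w i * Real.exp (X i ω - v i) * (w j * Real.exp (X j ω - v j))) ≤
      T * (∑ i ∈ A, w i * Real.exp (X i ω - v i)) ^ 2}) :
    ∫⁻ ω, ENNReal.ofReal (∑ i, w i * Real.exp (X i ω - v i)) ^ (-a) ∂P ≤
      ENNReal.ofReal (m ^ (-a) * Real.exp a *
        (Real.exp ((a * (Real.pi / 2)) ^ 2 * T / 2) * (Real.exp a * (2 / t)))) := by
  obtain ⟨N, c, hc, hcov⟩ := exists_finite_cube_cover X ht hgood
  choose A hA hAT using hc
  choose p hp0 hp1 hpT hlow using fun k =>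
    exists_weights_le_sum_exp (x₀ := fun i => X i (c k)) hw hm (hA k) (hAT k)
  set ξ : Fin (N + 1) → Ω → ℝ := fun k => ∑ i, p k i • X i with hξ
  have hξH : ∀ k, ξ k ∈ H := fun k => H.sum_mem fun i _ => H.smul_mem _ (hX i)
  have hξv : ∀ k ω, ∑ i, p k i * (X i ω - X i (c k)) = ξ k ω + -ξ k (c k) := fun k ω => by
    simp only [hξ, Finset.sum_apply, Pi.smul_apply, smul_eq_mul, mul_sub, Finset.sum_sub_distrib]
    ring
  set β : ℝ := ((Fintype.card (Fin (N + 1)) : ℕ) : ℝ) with hβ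
  have hβ0 : 0 < β := by rw [hβ]; exact_mod_cast Fintype.card_pos
  set φ : Ω → ℝ := fun ω => logSumExp β (fun k => -ξ k (c k)) fun k => ξ k ω with hφ
  have hconc := hP.lintegral_exp_logSumExp_mul_le hξH (T := T)
    (fun k => by rw [hξ, hP.mixedMoment_sum_smul_self hX]; exact hpT k) hβ0.ne'
    (fun k => -ξ k (c k)) a
  have hφm : Measurable φ := (continuous_logSumExp _ _).measurable.comp
    (measurable_pi_lambda _ fun k => hP.measurable _ (hξH k))
  have hpt : ∀ ω, ENNReal.ofReal (∑ i, w i * Real.exp (X i ω - v i)) ^ (-a) ≤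
      ENNReal.ofReal (m ^ (-a) * Real.exp a) * ENNReal.ofReal (Real.exp (-(a * φ ω))) := by
    intro ω
    obtain ⟨k, hk⟩ := exists_logSumExp_le (fun k => -ξ k (c k)) fun k => ξ k ω
    have h1 : m * Real.exp (φ ω - 1) ≤ ∑ i, w i * Real.exp (X i ω - v i) := by
      refine le_trans ?_ (hlow k fun i => X i ω)
      rw [hξv]
      refine mul_le_mul_of_nonneg_left (Real.exp_le_exp.2 ?_) hm.le
      linarith
    have h0 : 0 < m * Real.exp (φ ω - 1) := by positivity
    rw [ENNReal.ofReal_rpow_of_pos (h0.trans_le h1), ← ENNReal.ofReal_mul (by positivity)]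
    refine ENNReal.ofReal_le_ofReal
      ((Real.rpow_le_rpow_of_nonpos h0 h1 (by linarith)).trans (le_of_eq ?_))
    rw [Real.mul_rpow hm.le (Real.exp_pos _).le, ← Real.exp_mul, mul_assoc, ← Real.exp_add]
    ring_nf
  have hlo : ENNReal.ofReal (Real.exp (-a)) * ENNReal.ofReal (t / 2) ≤
      ∫⁻ ω, ENNReal.ofReal (Real.exp (a * φ ω)) ∂P := by
    refine le_trans ?_ (mul_meas_ge_le_lintegral (by fun_prop) (ENNReal.ofReal (Real.exp (-a))))
    gcongr
    refine hcov.trans (measure_mono ?_)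
    rintro ω ⟨k, hk⟩
    refine ENNReal.ofReal_le_ofReal (Real.exp_le_exp.2 ?_)
    have h1 : -1 ≤ ∑ i, p k i * (X i ω - X i (c k)) := by
      rw [← neg_neg (∑ i, _), neg_le_neg_iff, ← Finset.sum_neg_distrib, ← hp1 k]
      refine Finset.sum_le_sum fun i _ => ?_
      rw [← mul_neg]
      refine mul_le_of_le_one_right (hp0 k i) ?_
      linarith [abs_le.1 (hk i)]
    have h2 := le_logSumExp hβ0 (fun k => -ξ k (c k)) (fun k => ξ k ω) k
    rw [hξv] at h1
    nlinarith [h1.trans h2]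
  have hneg : ∫⁻ ω, ENNReal.ofReal (Real.exp (-(a * φ ω))) ∂P ≤
      ENNReal.ofReal (Real.exp ((a * (Real.pi / 2)) ^ 2 * T / 2) * (Real.exp a * (2 / t))) := by
    have h1 : ENNReal.ofReal (Real.exp (-a)) * ENNReal.ofReal (t / 2) *
        ENNReal.ofReal (Real.exp a * (2 / t)) = 1 := by
      rw [← ENNReal.ofReal_mul (Real.exp_pos _).le, ← ENNReal.ofReal_mul (by positivity)]
      have : Real.exp (-a) * (t / 2) * (Real.exp a * (2 / t)) =
          Real.exp (-a) * Real.exp a := by field_simp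
      rw [this, ← Real.exp_add]; simp
    calc _ = (∫⁻ ω, ENNReal.ofReal (Real.exp (-(a * φ ω))) ∂P) *
          (ENNReal.ofReal (Real.exp (-a)) * ENNReal.ofReal (t / 2)) *
          ENNReal.ofReal (Real.exp a * (2 / t)) := by rw [mul_assoc, h1, mul_one]
      _ ≤ ENNReal.ofReal (Real.exp ((a * (Real.pi / 2)) ^ 2 * T / 2)) *
          ENNReal.ofReal (Real.exp a * (2 / t)) := by
          gcongr
          exact (mul_le_mul_right hlo _).trans hconc
      _ = _ := (ENNReal.ofReal_mul (Real.exp_pos _).le).symm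
  refine (lintegral_mono hpt).trans ?_
  rw [lintegral_const_mul' _ _ ENNReal.ofReal_ne_top, ENNReal.ofReal_mul (q := _ * (_ * _))
    (by positivity)]
  gcongr

end NegativeMoments

section DiscreteNegativeMoments

/-- A Paley–Zygmund inequality. -/
lemma exists_le_measure_half_le_of_lintegral_rpow_le {m₁ p C : ℝ} (hm₁ : 0 < m₁) (hp : 1 < p)
    (hC : 0 ≤ C) :
    ∃ t : ℝ, 0 < t ∧ ∀ {Ω : Type*} [MeasurableSpace Ω] (P : Measure Ω) [IsProbabilityMeasure P]
      (Z : Ω → ℝ≥0∞), Measurable Z → ENNReal.ofReal m₁ ≤ ∫⁻ ω, Z ω ∂P →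
      ∫⁻ ω, Z ω ^ p ∂P ≤ ENNReal.ofReal C →
      ENNReal.ofReal t ≤ P {ω | ENNReal.ofReal (m₁ / 2) ≤ Z ω} := by
  obtain ⟨lam, hlam, hlamC⟩ : ∃ lam : ℝ, 0 < lam ∧ C * lam ^ (1 - p) ≤ m₁ / 4 := by
    have h1 : Tendsto (fun x : ℝ => C * x ^ (1 - p)) atTop (𝓝 (C * 0)) := by
      refine Tendsto.const_mul _ ?_
      have := tendsto_rpow_neg_atTop (y := p - 1) (by linarith)
      simpa using this
    rw [mul_zero] at h1
    obtain ⟨x, hx0, hx⟩ := ((eventually_gt_atTop 0).and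
      (h1.eventually (ge_mem_nhds (show (0 : ℝ) < m₁ / 4 by linarith)))).exists
    exact ⟨x, hx0, hx⟩
  refine ⟨m₁ / 4 / lam, by positivity, fun {Ω} _ P _ Z hZ h1 h2 => ?_⟩
  set B := {ω | ENNReal.ofReal (m₁ / 2) ≤ Z ω} with hB
  have hBm : MeasurableSet B := measurableSet_le measurable_const hZ
  have hpt : ∀ ω, Z ω ≤ ENNReal.ofReal (m₁ / 2) + (B.indicator (fun _ => ENNReal.ofReal lam) ω +
      Z ω ^ p * ENNReal.ofReal (lam ^ (1 - p))) := by
    intro ω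
    by_cases hω : ω ∈ B
    · rw [Set.indicator_of_mem hω]
      rcases le_total (Z ω) (ENNReal.ofReal lam) with h | h
      · exact h.trans (le_self_add.trans le_add_self)
      · refine le_trans ?_ (le_add_self.trans le_add_self)
        rcases eq_or_ne (Z ω) ⊤ with h3 | h3
        · rw [h3, ENNReal.top_rpow_of_pos (by linarith), ENNReal.top_mul]
          exact (ENNReal.ofReal_pos.2 (by positivity)).ne'
        · have h0 : Z ω ≠ 0 := fun h0 => by
            rw [h0] at h
            exact (ENNReal.ofReal_pos.2 hlam).not_ge h
          calc Z ω = Z ω ^ p * Z ω ^ (1 - p) := by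
                rw [← ENNReal.rpow_add _ _ h0 h3]; simp
            _ ≤ _ := by
                rw [← ENNReal.ofReal_rpow_of_pos hlam]
                refine mul_le_mul' le_rfl ?_
                rw [← neg_sub p 1, ENNReal.rpow_neg, ENNReal.rpow_neg, ENNReal.inv_le_inv]
                exact ENNReal.rpow_le_rpow h (by linarith)
    · exact (not_le.1 hω).le.trans le_self_add
  have h3 : ENNReal.ofReal m₁ ≤ ENNReal.ofReal (m₁ / 2) + (ENNReal.ofReal lam * P B +
      ENNReal.ofReal (m₁ / 4)) := by
    refine h1.trans ((lintegral_mono hpt).trans ?_)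
    rw [lintegral_add_left measurable_const, lintegral_add_left (measurable_const.indicator hBm),
      lintegral_indicator_const hBm, lintegral_mul_const' _ _ ENNReal.ofReal_ne_top]
    simp only [lintegral_const, measure_univ, mul_one]
    gcongr
    calc _ ≤ ENNReal.ofReal C * ENNReal.ofReal (lam ^ (1 - p)) := by gcongr
      _ = ENNReal.ofReal (C * lam ^ (1 - p)) := (ENNReal.ofReal_mul hC).symm
      _ ≤ _ := ENNReal.ofReal_le_ofReal hlamC
  have hPB : P B ≠ ⊤ := measure_ne_top _ _
  rw [← ENNReal.ofReal_toReal hPB, ← ENNReal.ofReal_mul hlam.le, ← ENNReal.ofReal_add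
    (by positivity) (by positivity), ← ENNReal.ofReal_add (by positivity) (by positivity),
    ENNReal.ofReal_le_ofReal_iff (by positivity)] at h3
  rw [← ENNReal.ofReal_toReal hPB]
  refine ENNReal.ofReal_le_ofReal ?_
  rw [div_le_iff₀ hlam]
  linarith

variable {Ω : Type*} [MeasurableSpace Ω] {E : Type*} [PseudoMetricSpace E] [MeasurableSpace E]
  {P : Measure Ω} {H : Submodule ℝ (Ω → ℝ)} {σ : Measure E} {Y : E → Ω → ℝ}
  {γ C₀ ε : ℝ}

/-- The constant in `IsLogField.mixedMoment_le_of_mem_dyadicShell`. -/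
def shellKernelConst (γ C₀ l s : ℝ) : ℝ :=
  γ ^ 2 * (|Real.log s| + Real.log 2 * (1 + (l - 1)⁻¹) + |C₀|)

lemma shellKernelConst_nonneg {l s : ℝ} (hl : 1 < l) : 0 ≤ shellKernelConst γ C₀ l s := by
  have h1 : 0 < l - 1 := sub_pos.2 hl
  have h2 := Real.log_nonneg (show (1 : ℝ) ≤ 2 by norm_num)
  unfold shellKernelConst
  positivity

lemma IsLogField.mixedMoment_le_of_mem_dyadicShell (hY : IsLogField P H γ C₀ ε Y) {l s : ℝ}
    (hl : 1 < l) (hs : 0 < s) {x y : E} {k : ℕ} (hy : y ∈ dyadicShell x s ε k) :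
    mixedMoment P (Y x) (Y y) ≤ shellKernelConst γ C₀ l s * l ^ k := by
  have h2 := Real.log_nonneg (show (1 : ℝ) ≤ 2 by norm_num)
  have hl1 : 0 < l - 1 := sub_pos.2 hl
  have hlk : 1 ≤ l ^ k := one_le_pow₀ hl.le
  have hk : (k : ℝ) ≤ (l - 1)⁻¹ * l ^ k := by
    have := one_add_mul_le_pow (a := l - 1) (by linarith) k
    rw [inv_mul_eq_div, le_div_iff₀ hl1]
    have h3 : 1 + (l - 1) = l := by ring
    rw [h3] at this
    linarith
  have hlog : -Real.log (max (dist x y) ε) ≤ |Real.log s| + (k + 1) * Real.log 2 := by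
    have h4 : Real.log (s * (1 / 2) ^ (k + 1)) ≤ Real.log (max (dist x y) ε) := by
      rw [dist_comm x y]
      exact Real.log_le_log (by positivity) hy.1.le
    rw [Real.log_mul hs.ne' (by positivity), Real.log_pow, one_div, Real.log_inv] at h4
    push_cast at h4
    linarith [neg_abs_le (Real.log s)]
  have hmax : max (-Real.log (max (dist x y) ε)) 0 ≤ |Real.log s| + (k + 1) * Real.log 2 :=
    max_le hlog (by positivity)
  refine (hY.le x y).trans ?_
  rw [shellKernelConst, mul_assoc]
  refine mul_le_mul_of_nonneg_left ?_ (sq_nonneg γ)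
  have h5 : |Real.log s| ≤ |Real.log s| * l ^ k := le_mul_of_one_le_right (abs_nonneg _) hlk
  have h6 : |C₀| ≤ |C₀| * l ^ k := le_mul_of_one_le_right (abs_nonneg _) hlk
  have h7 : Real.log 2 ≤ Real.log 2 * l ^ k := le_mul_of_one_le_right h2 hlk
  have h8 := mul_le_mul_of_nonneg_left hk h2
  nlinarith [le_abs_self C₀]

lemma IsLogField.setLIntegral_mixedMoment_mul_le (hY : IsLogField P H γ C₀ ε Y)
    [OpensMeasurableSpace E] (hε : 0 < ε) {l s : ℝ} (hl : 1 < l) (hεs : ε ≤ s) {A : Set E}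
    (hA : MeasurableSet A) {x : E} (hAs : A ⊆ Metric.closedBall x s) (ω : Ω) :
    ∫⁻ y in A, ENNReal.ofReal (mixedMoment P (Y x) (Y y)) * wickExp P (Y y) ω ∂σ ≤
      ENNReal.ofReal (shellKernelConst γ C₀ l s) * shellSum P σ Y ε l s A x ω := by
  have h1 : A ⊆ ⋃ k, A ∩ dyadicShell x s ε k := by
    rw [← Set.inter_iUnion]
    exact Set.subset_inter le_rfl (hAs.trans (closedBall_subset_iUnion_dyadicShell x hε hεs))
  refine (lintegral_mono_set h1).trans ((lintegral_iUnion_le _ _).trans ?_)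
  rw [shellSum, ← ENNReal.tsum_mul_left]
  refine ENNReal.tsum_le_tsum fun k => ?_
  rw [← mul_assoc, ← ENNReal.ofReal_mul (shellKernelConst_nonneg hl), chaosMass,
    ← lintegral_const_mul' _ _ ENNReal.ofReal_ne_top]
  refine setLIntegral_mono' (hA.inter (measurableSet_dyadicShell _ _ _ _)) fun y hy => ?_
  gcongr
  exact hY.mixedMoment_le_of_mem_dyadicShell hl (hε.trans_le hεs) hy.2

section Discrete

variable {ι : Type*} [Fintype ι]

/-- The finitely supported measure with atoms `t i` of mass `w i`. -/
def atomicMeasure (w : ι → ℝ) (t : ι → E) : Measure E :=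
  ∑ i, ENNReal.ofReal (w i) • Measure.dirac (t i)

instance (w : ι → ℝ) (t : ι → E) : IsFiniteMeasure (atomicMeasure w t) := by
  refine ⟨?_⟩
  simp [atomicMeasure, Measure.finsetSum_apply, ENNReal.sum_lt_top]

lemma setLIntegral_atomicMeasure {E : Type*} [MeasurableSpace E] [MeasurableSingletonClass E]
    (w : ι → ℝ) (t : ι → E) {S : Set E}
    (hS : MeasurableSet S) (ht : ∀ i, t i ∈ S) (F : E → ℝ≥0∞) :
    ∫⁻ x in S, F x ∂(atomicMeasure w t) = ∑ i, ENNReal.ofReal (w i) * F (t i) := by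
  rw [← lintegral_indicator hS, atomicMeasure, lintegral_finsetSum_measure]
  refine Finset.sum_congr rfl fun i _ => ?_
  rw [lintegral_smul_measure, lintegral_dirac, Set.indicator_of_mem (ht i), smul_eq_mul]

lemma wickExp_zero (ω : Ω) : wickExp P (0 : Ω → ℝ) ω = 1 := by
  simp [wickExp, mixedMoment]

lemma IsLogField.measurable_shellSum [SFinite P] [SFinite σ] (hY : IsLogField P H γ C₀ ε Y)
    (l s : ℝ) (A : Set E) (x : E) : Measurable (shellSum P σ Y ε l s A x) := by
  unfold shellSum
  exact Measurable.tsum fun k => (hY.measurable_chaosMass _).const_mul _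

/-- Deterministic core of the second-moment argument: if the total mass is not small and the
`s`-energy `∑ uᵢ Vᵢˢ` is not large, then some sub-sum has comparable mass and bounded energy. -/
lemma exists_subset_sum_and_energy_le {ι : Type*} [Fintype ι] {u : ι → ℝ} {V : ι → ℝ≥0∞}
    {κ : ι → ι → ℝ} {s m b c T : ℝ} (hu : ∀ i, 0 ≤ u i) (hs : 0 < s) (hm : 0 < m) (hc : 0 ≤ c)
    (hT : 0 < T) (hbT : b ≤ m / 2 * T ^ s) (hmass : 2 * m ≤ ∑ i, u i)
    (henergy : ∑ i, ENNReal.ofReal (u i) * V i ^ s < ENNReal.ofReal b)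
    (hV : ∀ i, ∑ j, ENNReal.ofReal (κ i j) * ENNReal.ofReal (u j) ≤ ENNReal.ofReal c * V i) :
    ∃ A : Finset ι, m ≤ ∑ i ∈ A, u i ∧
      ∑ i ∈ A, ∑ j ∈ A, κ i j * (u i * u j) ≤ c * T / m * (∑ i ∈ A, u i) ^ 2 := by
  classical
  have hTs : 0 < T ^ s := by positivity
  set A := Finset.univ.filter fun i => V i ≤ ENNReal.ofReal T with hA
  have h1 : ∑ i ∈ Aᶜ, u i ≤ m := by
    have h2 : ENNReal.ofReal (T ^ s * ∑ i ∈ Aᶜ, u i) ≤ ENNReal.ofReal b := by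
      rw [Finset.mul_sum, ENNReal.ofReal_sum_of_nonneg fun i _ => mul_nonneg hTs.le (hu i)]
      calc _ ≤ ∑ i ∈ Aᶜ, ENNReal.ofReal (u i) * V i ^ s := by
            refine Finset.sum_le_sum fun i hi => ?_
            rw [mul_comm, ENNReal.ofReal_mul (hu i), ← ENNReal.ofReal_rpow_of_pos hT]
            gcongr
            simp only [hA, Finset.mem_compl, Finset.mem_filter, Finset.mem_univ, true_and,
              not_le] at hi
            exact hi.le
        _ ≤ ∑ i, ENNReal.ofReal (u i) * V i ^ s :=
            Finset.sum_le_sum_of_subset (Finset.subset_univ _)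
        _ ≤ _ := henergy.le
    have hb : 0 ≤ b := by
      by_contra hb
      rw [ENNReal.ofReal_of_nonpos (not_le.1 hb).le] at henergy
      exact not_lt_zero henergy
    rw [ENNReal.ofReal_le_ofReal_iff hb] at h2
    have h3 : T ^ s * ∑ i ∈ Aᶜ, u i ≤ T ^ s * m := by nlinarith
    exact le_of_mul_le_mul_left h3 hTs
  have h4 : m ≤ ∑ i ∈ A, u i := by
    have := Finset.sum_add_sum_compl A u
    linarith
  refine ⟨A, h4, ?_⟩
  have h5 : ∀ i ∈ A, ∑ j ∈ A, κ i j * u j ≤ c * T := by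
    intro i hi
    have h6 : ENNReal.ofReal (∑ j ∈ A, κ i j * u j) ≤ ENNReal.ofReal (c * T) := by
      calc _ ≤ ENNReal.ofReal (∑ j ∈ A, max (κ i j) 0 * u j) :=
            ENNReal.ofReal_le_ofReal (Finset.sum_le_sum fun j _ =>
              mul_le_mul_of_nonneg_right (le_max_left _ _) (hu j))
        _ = ∑ j ∈ A, ENNReal.ofReal (κ i j) * ENNReal.ofReal (u j) := by
            rw [ENNReal.ofReal_sum_of_nonneg fun j _ => mul_nonneg (le_max_right _ _) (hu j)]
            refine Finset.sum_congr rfl fun j _ => ?_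
            rw [ENNReal.ofReal_mul (le_max_right _ _), ENNReal.ofReal_max, ENNReal.ofReal_zero,
              max_eq_left zero_le]
        _ ≤ ∑ j, ENNReal.ofReal (κ i j) * ENNReal.ofReal (u j) :=
            Finset.sum_le_sum_of_subset (Finset.subset_univ _)
        _ ≤ ENNReal.ofReal c * V i := hV i
        _ ≤ ENNReal.ofReal c * ENNReal.ofReal T := by
            gcongr
            exact (Finset.mem_filter.1 hi).2
        _ = _ := (ENNReal.ofReal_mul hc).symm
    exact (ENNReal.ofReal_le_ofReal_iff (by positivity)).1 h6
  calc ∑ i ∈ A, ∑ j ∈ A, κ i j * (u i * u j) = ∑ i ∈ A, u i * ∑ j ∈ A, κ i j * u j := by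
        refine Finset.sum_congr rfl fun i _ => ?_
        rw [Finset.mul_sum]
        exact Finset.sum_congr rfl fun j _ => by ring
    _ ≤ ∑ i ∈ A, u i * (c * T) :=
        Finset.sum_le_sum fun i hi => mul_le_mul_of_nonneg_left (h5 i hi) (hu i)
    _ = c * T / m * (m * ∑ i ∈ A, u i) := by rw [← Finset.sum_mul]; field_simp
    _ ≤ _ := by
        rw [pow_two]
        have : 0 ≤ ∑ i ∈ A, u i := hm.le.trans h4
        gcongr

universe u v w

/-- Uniform bound on the negative moments of the chaos with respect to a finitely supported base
measure. -/
lemma exists_lintegral_atomic_rpow_neg_le {δ γ C₀ Cσ r m a : ℝ} (hγ : 0 ≤ γ)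
    (hγδ : γ ^ 2 < 2 * δ) (hCσ : 0 ≤ Cσ) (hr : 0 < r) (hm : 0 < m) (ha : 0 < a) :
    ∃ C : ℝ, ∀ {Ω : Type u} [MeasurableSpace Ω] (P : Measure Ω) [IsProbabilityMeasure P]
      (H : Submodule ℝ (Ω → ℝ)) {E : Type v} [PseudoMetricSpace E] [MeasurableSpace E]
      [OpensMeasurableSpace E] [MeasurableSingletonClass E] (Y : E → Ω → ℝ) (ε : ℝ) {ι : Type w}
      [Fintype ι] (w : ι → ℝ) (t : ι → E) (z : E),
      IsGaussianSpace P H → IsLogField P H γ C₀ ε Y → 0 < ε → ε ≤ 1 → ε ≤ r →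
      IsBallRegular (atomicMeasure w t) δ Cσ ε → (∀ i, 0 ≤ w i) → m ≤ ∑ i, w i →
      (∀ i, t i ∈ Metric.closedBall z r) →
      ∫⁻ ω, (∑ i, ENNReal.ofReal (w i) * wickExp P (Y (t i)) ω) ^ (-a) ∂P ≤ ENNReal.ofReal C := by
  obtain ⟨s, hs, hsδ⟩ : ∃ s : ℝ, 0 < s ∧ γ ^ 2 * (s + 1) < 2 * δ := by
    set e := 2 * δ - γ ^ 2 with he
    have he0 : 0 < e := by linarith
    refine ⟨e / (γ ^ 2 + e), by positivity, ?_⟩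
    have : γ ^ 2 * (e / (γ ^ 2 + e)) < e := by
      rw [mul_div_assoc', div_lt_iff₀ (by positivity)]
      nlinarith [mul_pos he0 he0]
    linarith
  have hα : 0 < shellExponent δ γ s := by unfold shellExponent; linarith
  obtain ⟨l, hl, hlα⟩ := exists_shell_weight hs hα
  set R := max r 1 with hR
  have hR1 : 1 ≤ R := le_max_right _ _
  obtain ⟨Cs, hCs, hBs⟩ := exists_hasMomentBound.{u, v} (δ := δ) (C₀ := C₀) hγ hCσ hs
    (by nlinarith [sq_nonneg γ]) (2 * R) (by linarith)
  obtain ⟨Cp, hCp, hBp⟩ := exists_hasMomentBound.{u, v} (C₀ := C₀) hγ hCσ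
    (show 0 < s + 1 by linarith) hsδ R hR1
  set C₂ := Cp * r ^ multifractalExponent δ γ (s + 1) with hC₂
  obtain ⟨τ, hτ, hPZ⟩ := exists_le_measure_half_le_of_lintegral_rpow_le hm
    (show 1 < s + 1 by linarith) (show 0 ≤ C₂ by positivity)
  set C₃ := shellConst δ γ C₀ R s l Cs * r ^ (s * shellExponent δ γ s) with hC₃
  have hC₃0 : 0 ≤ C₃ := mul_nonneg (shellConst_nonneg hCs hl hlα) (by positivity)
  set C₄ := Cσ * r ^ δ * C₃ with hC₄
  have hC₄0 : 0 ≤ C₄ := by positivity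
  set b := 2 * (C₄ + 1) / τ with hb
  have hb0 : 0 < b := by positivity
  set T := (8 * b / m) ^ s⁻¹ with hT
  have hT0 : 0 < T := by positivity
  have hTs : T ^ s = 8 * b / m := by
    rw [hT, ← Real.rpow_mul (by positivity), inv_mul_cancel₀ hs.ne', Real.rpow_one]
  set c := shellKernelConst γ C₀ l (2 * r) with hc
  have hc0 : 0 ≤ c := shellKernelConst_nonneg hl
  refine ⟨(m / 4) ^ (-a) * Real.exp a * (Real.exp ((a * (Real.pi / 2)) ^ 2 *
    (c * T / (m / 4)) / 2) * (Real.exp a * (2 / (τ / 2)))),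
    fun {Ω} _ P _ H {E} _ _ _ _ Y ε {ι} _ w t z hP hY hε hε1 hεr hσ hw hwm ht => ?_⟩
  set σ := atomicMeasure w t with hσdef
  set S := Metric.closedBall z r with hS
  have hSm : MeasurableSet S := measurableSet_closedBall
  have hmass : ∀ ω, chaosMass P σ Y S ω = ∑ i, ENNReal.ofReal (w i) * wickExp P (Y (t i)) ω :=
    fun ω => setLIntegral_atomicMeasure w t hSm ht _
  have hwS : ∑ i, ENNReal.ofReal (w i) ≤ ENNReal.ofReal (Cσ * r ^ δ) := by
    have h1 := setLIntegral_atomicMeasure w t hSm ht fun _ => 1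
    simp only [lintegral_const, Measure.restrict_apply_univ, one_mul, mul_one] at h1
    rw [← h1]
    exact hσ z r hεr
  have hwick : ∀ x, Measurable (wickExp P (Y x)) := fun x => hP.measurable_wickExp (hY.mem x)
  set V : ι → Ω → ℝ≥0∞ := fun i => shellSum P σ Y ε l (2 * r) S (t i) with hVdef
  have hVm : ∀ i, Measurable (V i) := fun i => hY.measurable_shellSum _ _ _ _
  set Z : Ω → ℝ≥0∞ := fun ω => ∑ i, ENNReal.ofReal (w i) * wickExp P (Y (t i)) ω with hZ
  set W : Ω → ℝ≥0∞ := fun ω =>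
    ∑ i, ENNReal.ofReal (w i) * (wickExp P (Y (t i)) ω * V i ω ^ s) with hW
  have hZm : Measurable Z := Finset.measurable_fun_sum _ fun i _ => (hwick _).const_mul _
  have hWm' : ∀ i, Measurable fun ω => wickExp P (Y (t i)) ω * V i ω ^ s :=
    fun i => (hwick _).mul ((hVm i).pow_const s)
  have hWm : Measurable W := Finset.measurable_fun_sum _ fun i _ => (hWm' i).const_mul _
  have hZ1 : ENNReal.ofReal m ≤ ∫⁻ ω, Z ω ∂P := by
    rw [lintegral_finsetSum _ fun i _ => (hwick _).const_mul _]
    simp_rw [lintegral_const_mul' _ _ ENNReal.ofReal_ne_top, hP.lintegral_wickExp (hY.mem _),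
      mul_one]
    rw [← ENNReal.ofReal_sum_of_nonneg fun i _ => hw i]
    exact ENNReal.ofReal_le_ofReal hwm
  have hZ2 : ∫⁻ ω, Z ω ^ (s + 1) ∂P ≤ ENNReal.ofReal C₂ := by
    have h1 := hBp P H σ Y ε hP hY hε hε1 hσ 0 H.zero_mem z r S 0 hεr (le_max_left _ _) hSm le_rfl
      fun y _ => by simp [mixedMoment]
    simpa only [wickExp_zero, one_mul, hmass, mul_zero, Real.exp_zero, mul_one] using h1
  have hW1 : ∫⁻ ω, W ω ∂P ≤ ENNReal.ofReal C₄ := by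
    rw [lintegral_finsetSum _ fun i _ => (hWm' i).const_mul _, hC₄,
      ENNReal.ofReal_mul (by positivity)]
    refine le_trans ?_ (mul_le_mul_left hwS _)
    rw [Finset.sum_mul]
    refine Finset.sum_le_sum fun i _ => ?_
    rw [lintegral_const_mul' _ _ ENNReal.ofReal_ne_top]
    refine mul_le_mul' le_rfl ?_
    have h1 := (hBs P H σ Y ε hP hY hε hε1 hσ).lintegral_shellSum_le hP hY hε hε1 hR1 hs hCs hl hlα
      H.zero_mem (t i) (κ := 0) hεr (le_max_left _ _) hSm fun y _ => by simp [mixedMoment]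
    simpa only [zero_add, mul_zero, Real.exp_zero, mul_one] using h1
  have hgood : ENNReal.ofReal (τ / 2) ≤ P {ω | ENNReal.ofReal (m / 2) ≤ Z ω ∧
      W ω < ENNReal.ofReal b} := by
    have h1 : P {ω | ENNReal.ofReal b ≤ W ω} ≤ ENNReal.ofReal (τ / 2) := by
      refine (meas_ge_le_lintegral_div hWm.aemeasurable (ENNReal.ofReal_pos.2 hb0).ne'
        ENNReal.ofReal_ne_top).trans ?_
      refine (ENNReal.div_le_div_right hW1 _).trans ?_
      rw [← ENNReal.ofReal_div_of_pos hb0]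
      refine ENNReal.ofReal_le_ofReal ?_
      rw [div_le_iff₀ hb0, hb]
      have : τ / 2 * (2 * (C₄ + 1) / τ) = C₄ + 1 := by field_simp
      linarith
    have h2 : ENNReal.ofReal (τ / 2) + ENNReal.ofReal (τ / 2) ≤
        P {ω | ENNReal.ofReal (m / 2) ≤ Z ω ∧ W ω < ENNReal.ofReal b} +
          ENNReal.ofReal (τ / 2) := by
      rw [← ENNReal.ofReal_add (by positivity) (by positivity), add_halves]
      refine (hPZ P Z hZm hZ1 hZ2).trans ((measure_mono ?_).trans
        ((measure_union_le _ _).trans (add_le_add_right h1 _)))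
      intro ω hω
      rcases lt_or_ge (W ω) (ENNReal.ofReal b) with h | h
      · exact Or.inl ⟨hω, h⟩
      · exact Or.inr h
    exact (ENNReal.add_le_add_iff_right ENNReal.ofReal_ne_top).1 h2
  have hterm : ∀ i ω, ENNReal.ofReal (w i) * wickExp P (Y (t i)) ω = ENNReal.ofReal
      (w i * Real.exp (Y (t i) ω - mixedMoment P (Y (t i)) (Y (t i)) / 2)) := fun i ω =>
    (ENNReal.ofReal_mul (hw i)).symm
  have hu0 : ∀ i ω, 0 ≤ w i * Real.exp (Y (t i) ω - mixedMoment P (Y (t i)) (Y (t i)) / 2) :=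
    fun i ω => mul_nonneg (hw i) (Real.exp_pos _).le
  have hZeq : ∀ ω, Z ω = ENNReal.ofReal
      (∑ i, w i * Real.exp (Y (t i) ω - mixedMoment P (Y (t i)) (Y (t i)) / 2)) := fun ω => by
    rw [ENNReal.ofReal_sum_of_nonneg fun i _ => hu0 i ω]
    exact Finset.sum_congr rfl fun i _ => hterm i ω
  have hfin := hP.lintegral_sum_exp_rpow_neg_le (X := fun i => Y (t i)) (fun i => hY.mem _) (w := w)
    (v := fun i => mixedMoment P (Y (t i)) (Y (t i)) / 2) hw (m := m / 4) (T := c * T / (m / 4))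
    (t := τ / 2) (a := a) (by positivity) (by positivity) ha ?_
  · refine (lintegral_congr fun ω => ?_).trans_le hfin
    exact congrArg (· ^ (-a)) (hZeq ω)
  · refine hgood.trans (measure_mono ?_)
    rintro ω ⟨h1, h2⟩
    refine exists_subset_sum_and_energy_le (V := fun i => V i ω) (s := s) (b := b)
      (fun i => hu0 i ω) hs (by positivity) hc0 hT0 ?_ ?_ ?_ fun i => ?_
    · rw [hTs]
      have : m / 4 / 2 * (8 * b / m) = b := by field_simp; ring
      exact this.ge
    · rw [hZeq, ENNReal.ofReal_le_ofReal_iff (Finset.sum_nonneg fun i _ => hu0 i ω)] at h1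
      linarith
    · refine lt_of_eq_of_lt (Finset.sum_congr rfl fun i _ => ?_) h2
      rw [← mul_assoc, hterm]
    · have h3 := hY.setLIntegral_mixedMoment_mul_le (σ := σ) hε (l := l) (s := 2 * r) hl
        (by linarith) hSm (x := t i) (fun y hy => ?_) ω
      · rw [hσdef, setLIntegral_atomicMeasure w t hSm ht] at h3
        refine le_trans (le_of_eq (Finset.sum_congr rfl fun j _ => ?_)) h3
        rw [← hterm]
        ring
      · have := dist_triangle_right y (t i) z
        have h4 := Metric.mem_closedBall.1 (ht i)
        rw [Metric.mem_closedBall] at hy ⊢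
        linarith

end Discrete

end DiscreteNegativeMoments

section NegativeMomentsOfChaos

/-- A totally bounded set has a finite measurable partition of small mesh. -/
lemma exists_finite_partition {E : Type*} [PseudoMetricSpace E] [MeasurableSpace E]
    [OpensMeasurableSpace E] {S : Set E} (hS : MeasurableSet S) (hSb : TotallyBounded S) {h : ℝ}
    (hh : 0 < h) :
    ∃ (N : ℕ) (B : Fin N → Set E), (∀ i, MeasurableSet (B i)) ∧
      Pairwise (Function.onFun Disjoint B) ∧ ⋃ i, B i = S ∧
        ∀ i, ∀ x ∈ B i, ∀ y ∈ B i, dist x y ≤ h := by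
  obtain ⟨t, ht, hSt⟩ := Metric.totallyBounded_iff.1 hSb (h / 2) (by positivity)
  obtain ⟨N, c, -, hc⟩ := ht.fin_param
  set f : ℕ → Set E := fun i => if hi : i < N then S ∩ Metric.ball (c ⟨i, hi⟩) (h / 2)
    else ∅ with hf
  have hfm : ∀ i, MeasurableSet (f i) := fun i => by
    simp only [hf]
    split_ifs
    · exact hS.inter measurableSet_ball
    · exact MeasurableSet.empty
  have hfi : ∀ i : Fin N, f i = S ∩ Metric.ball (c i) (h / 2) := fun i => by simp [hf]
  refine ⟨N, fun i => disjointed f i, fun i => MeasurableSet.disjointed hfm i, ?_, ?_, ?_⟩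
  · exact fun i j hij => disjoint_disjointed f fun h => hij (Fin.ext h)
  · have h1 : ⋃ i : Fin N, disjointed f i = ⋃ i, disjointed f i := by
      refine Set.Subset.antisymm (Set.iUnion_subset fun i => Set.subset_iUnion (disjointed f) i)
        (Set.iUnion_subset fun i => ?_)
      by_cases hi : i < N
      · exact Set.subset_iUnion (fun i : Fin N => disjointed f i) ⟨i, hi⟩
      · have : f i = ∅ := by simp [hf, hi]
        exact (disjointed_subset f i).trans (this ▸ Set.empty_subset _)
    rw [h1, iUnion_disjointed]
    refine Set.Subset.antisymm (Set.iUnion_subset fun i => ?_) fun x hx => ?_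
    · by_cases hi : i < N
      · simp only [hf, dif_pos hi]; exact Set.inter_subset_left
      · simp only [hf, dif_neg hi]; exact Set.empty_subset _
    · obtain ⟨y, hy, hxy⟩ := Set.mem_iUnion₂.1 (hSt hx)
      rw [← hc] at hy
      obtain ⟨i, rfl⟩ := hy
      exact Set.mem_iUnion.2 ⟨i, by rw [hfi]; exact ⟨hx, hxy⟩⟩
  · intro i x hx y hy
    have hx' := disjointed_subset f i hx
    have hy' := disjointed_subset f i hy
    rw [hfi] at hx' hy'
    have h1 := Metric.mem_ball.1 hx'.2
    have h2 := Metric.mem_ball.1 hy'.2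
    linarith [dist_triangle_right x y (c i)]

/-- Jensen's inequality for a negative power. -/
lemma rpow_neg_lintegral_le {α : Type*} [MeasurableSpace α] {π : Measure α} [IsProbabilityMeasure π]
    {F : α → ℝ≥0∞} (hF : Measurable F) (hF0 : ∀ x, F x ≠ 0) (hFtop : ∀ x, F x ≠ ⊤) {a : ℝ}
    (ha : 0 < a) : (∫⁻ x, F x ∂π) ^ (-a) ≤ ∫⁻ x, F x ^ (-a) ∂π := by
  have h1 := ENNReal.lintegral_mul_norm_pow_le (μ := π) hF.aemeasurable
    (hF.pow_const (-a)).aemeasurable (p := a / (1 + a)) (q := 1 / (1 + a)) (by positivity)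
    (by positivity) (by field_simp; ring)
  have h2 : ∀ x, F x ^ (a / (1 + a)) * (F x ^ (-a)) ^ (1 / (1 + a)) = 1 := fun x => by
    rw [← ENNReal.rpow_mul, ← ENNReal.rpow_add _ _ (hF0 x) (hFtop x)]
    have : a / (1 + a) + -a * (1 / (1 + a)) = 0 := by ring
    rw [this, ENNReal.rpow_zero]
  simp_rw [h2] at h1
  simp only [lintegral_const, measure_univ, mul_one] at h1
  have h3 := ENNReal.rpow_le_rpow h1 (show 0 ≤ 1 + a by linarith)
  rw [ENNReal.one_rpow, ENNReal.mul_rpow_of_nonneg _ _ (by linarith), ← ENNReal.rpow_mul,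
    ← ENNReal.rpow_mul] at h3
  have h4 : a / (1 + a) * (1 + a) = a := by field_simp
  have h5 : 1 / (1 + a) * (1 + a) = 1 := by field_simp
  rw [h4, h5, ENNReal.rpow_one] at h3
  set I := ∫⁻ x, F x ∂π with hI
  have hI0 : I ≠ 0 := by
    rw [hI, Ne, lintegral_eq_zero_iff hF]
    intro h
    obtain ⟨x, hx⟩ := h.exists
    exact hF0 x hx
  rw [ENNReal.rpow_neg]
  rcases eq_or_ne I ⊤ with hI1 | hI1
  · rw [hI1, ENNReal.top_rpow_of_pos ha, ENNReal.inv_top]; exact zero_le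
  · refine (ENNReal.inv_le_iff_le_mul ?_ ?_).2 h3
    · intro h6
      have := ENNReal.rpow_pos (p := a) (pos_iff_ne_zero.2 hI0) hI1
      simp_all
    · intro h6
      exact absurd h6 (ENNReal.rpow_ne_top_of_nonneg ha.le hI1)

universe u v

/-- Uniform bound on the negative moments of the chaos of a log-correlated field. -/
lemma exists_lintegral_chaosMass_rpow_neg_le {δ γ C₀ Cσ r m a : ℝ} (hγ : 0 ≤ γ)
    (hγδ : γ ^ 2 < 2 * δ) (hCσ : 0 ≤ Cσ) (hr : 0 < r) (hm : 0 < m) (ha : 0 < a) :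
    ∃ C : ℝ, ∀ {Ω : Type u} [MeasurableSpace Ω] (P : Measure Ω) [IsProbabilityMeasure P]
      (H : Submodule ℝ (Ω → ℝ)) {E : Type v} [PseudoMetricSpace E] [MeasurableSpace E]
      [OpensMeasurableSpace E] [MeasurableSingletonClass E] (σ : Measure E) [IsFiniteMeasure σ]
      (Y : E → Ω → ℝ) (ε : ℝ) (z : E) (S : Set E),
      IsGaussianSpace P H → IsLogField P H γ C₀ ε Y → 0 < ε → ε ≤ 1 → ε ≤ r →
      IsBallRegular σ δ Cσ ε → MeasurableSet S → TotallyBounded S → S ⊆ Metric.closedBall z r →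
      ENNReal.ofReal m ≤ σ S →
      ∫⁻ ω, chaosMass P σ Y S ω ^ (-a) ∂P ≤ ENNReal.ofReal C := by
  obtain ⟨C, hC⟩ := exists_lintegral_atomic_rpow_neg_le.{u, v, 0} (δ := δ) (γ := γ) (C₀ := C₀)
    (Cσ := Cσ * 2 ^ δ) (r := r) (m := m) (a := a) hγ hγδ (by positivity) hr hm ha
  refine ⟨C, fun {Ω} _ P _ H {E} _ _ _ _ σ _ Y ε z S hP hY hε hε1 hεr hσ hS hSb hSz hmS => ?_⟩
  obtain ⟨N, B, hBm, hBd, hBU, hBε⟩ := exists_finite_partition hS hSb hε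
  let ι := {i : Fin N // σ (B i) ≠ 0}
  let w : ι → ℝ := fun i => (σ (B i)).toReal
  let ν : ι → Measure E := fun i => cond σ (B i)
  have hν : ∀ i, IsProbabilityMeasure (ν i) := fun i => cond_isProbabilityMeasure i.2
  have hwσ : ∀ i : ι, ENNReal.ofReal (w i) = σ (B i) := fun i =>
    ENNReal.ofReal_toReal (measure_ne_top _ _)
  have hBS : ∀ i, B i ⊆ S := fun i => hBU ▸ Set.subset_iUnion B i
  let F : (ι → E) → Ω → ℝ≥0∞ := fun t ω => ∑ i, ENNReal.ofReal (w i) * wickExp P (Y (t i)) ω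
  have hFm : Measurable (Function.uncurry F) := by
    refine Finset.measurable_fun_sum _ fun i _ => Measurable.const_mul ?_ _
    exact hY.measurable_uncurry_wickExp.comp (f := fun q : (ι → E) × Ω => (q.1 i, q.2))
      (((measurable_pi_apply i).comp measurable_fst).prodMk measurable_snd)
  have hsum_subtype : ∀ G : Fin N → ℝ≥0∞, (∀ i, σ (B i) = 0 → G i = 0) →
      ∑ i, G i = ∑ i : ι, G i := fun G hG => by
    classical
    rw [← Finset.sum_subtype (Finset.univ.filter fun i => σ (B i) ≠ 0) (by simp) G,
      Finset.sum_filter_of_ne]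
    exact fun i _ hi hi' => hi (hG i hi')
  have hmass : ∀ ω, ∫⁻ t, F t ω ∂(Measure.pi ν) = chaosMass P σ Y S ω := by
    intro ω
    have hwick : Measurable fun x => wickExp P (Y x) ω :=
      hY.measurable_uncurry_wickExp.comp measurable_prodMk_right
    show ∫⁻ t, ∑ i, ENNReal.ofReal (w i) * wickExp P (Y (t i)) ω ∂(Measure.pi ν) = _
    rw [lintegral_finsetSum (f := fun (i : ι) (t : ι → E) => ENNReal.ofReal (w i) *
      wickExp P (Y (t i)) ω) _ fun i _ => (hwick.comp (measurable_pi_apply i)).const_mul _]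
    have h1 : ∀ i : ι, ∫⁻ t, ENNReal.ofReal (w i) * wickExp P (Y (t i)) ω ∂(Measure.pi ν) =
        ∫⁻ x in B i, wickExp P (Y x) ω ∂σ := by
      intro i
      rw [lintegral_const_mul' _ _ ENNReal.ofReal_ne_top,
        (measurePreserving_eval ν i).lintegral_comp hwick, hwσ]
      show _ * ∫⁻ x, _ ∂((σ (B i))⁻¹ • σ.restrict (B i)) = _
      rw [lintegral_smul_measure, smul_eq_mul, ← mul_assoc,
        ENNReal.mul_inv_cancel i.2 (measure_ne_top _ _), one_mul]
    simp_rw [h1]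
    rw [← hsum_subtype fun i => ∫⁻ x in B i, wickExp P (Y x) ω ∂σ, chaosMass, ← hBU,
      lintegral_iUnion hBm hBd, tsum_fintype]
    exact fun i hi => setLIntegral_measure_zero _ _ hi
  have hsumS : ∑ i : ι, σ (B i) = σ S := by
    rw [← hsum_subtype (fun i => σ (B i)) fun _ h => h, ← hBU, measure_iUnion hBd hBm, tsum_fintype]
  have hSpos : σ S ≠ 0 := fun h => by
    rw [h, nonpos_iff_eq_zero, ENNReal.ofReal_eq_zero] at hmS
    linarith
  have hne : Nonempty ι := by
    by_contra h
    rw [not_nonempty_iff] at h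
    exact hSpos (by rw [← hsumS]; simp)
  have hwpos : ∀ i, 0 < w i := fun i => ENNReal.toReal_pos i.2 (measure_ne_top _ _)
  have hwick0 : ∀ (L : Ω → ℝ) ω, wickExp P L ω ≠ 0 := fun L ω => by
    simp [wickExp, Real.exp_pos]
  have hF0 : ∀ ω t, F t ω ≠ 0 := fun ω t => by
    obtain ⟨i⟩ := hne
    refine ne_of_gt (lt_of_lt_of_le ?_ (Finset.single_le_sum
      (f := fun i => ENNReal.ofReal (w i) * wickExp P (Y (t i)) ω) (fun _ _ => zero_le)
      (Finset.mem_univ i)))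
    exact ENNReal.mul_pos (by simpa using hwpos i) (hwick0 _ _)
  have hFtop : ∀ ω t, F t ω ≠ ⊤ := fun ω t => by
    refine ENNReal.sum_ne_top.2 fun i _ => ENNReal.mul_ne_top ENNReal.ofReal_ne_top ?_
    simp [wickExp]
  have hmem : ∀ᵐ t ∂(Measure.pi ν), ∀ i : ι, t i ∈ B i := by
    refine ae_all_iff.2 fun i => ?_
    refine (Measure.tendsto_eval_ae_ae (μ := ν) (i := i)).eventually ?_
    show ∀ᵐ x ∂((σ (B i))⁻¹ • σ.restrict (B i)), x ∈ B i
    exact Measure.ae_smul_measure (ae_restrict_mem (hBm i)) _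
  calc ∫⁻ ω, chaosMass P σ Y S ω ^ (-a) ∂P
      ≤ ∫⁻ ω, ∫⁻ t, F t ω ^ (-a) ∂(Measure.pi ν) ∂P := by
        refine lintegral_mono fun ω => ?_
        rw [← hmass ω]
        exact rpow_neg_lintegral_le (hFm.comp measurable_prodMk_right) (hF0 ω) (hFtop ω) ha
    _ = ∫⁻ t, ∫⁻ ω, F t ω ^ (-a) ∂P ∂(Measure.pi ν) :=
        lintegral_lintegral_swap ((hFm.comp measurable_swap).pow_const _).aemeasurable
    _ ≤ ∫⁻ _, ENNReal.ofReal C ∂(Measure.pi ν) := by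
        refine lintegral_mono_ae (hmem.mono fun t ht => ?_)
        refine hC P H Y ε w t z hP hY hε hε1 hεr ?_ (fun i => (hwpos i).le) ?_
          fun i => hSz (hBS _ (ht i))
        · intro z' ρ hρ
          have hρ0 : 0 < ρ := hε.trans_le hρ
          classical
          have h1 : atomicMeasure w t (Metric.closedBall z' ρ) =
              ∑ i with t i ∈ Metric.closedBall z' ρ, σ (B i) := by
            rw [atomicMeasure, Measure.finsetSum_apply, Finset.sum_filter]
            refine Finset.sum_congr rfl fun i _ => ?_
            rw [Measure.smul_apply, Measure.dirac_apply' _ measurableSet_closedBall, smul_eq_mul,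
              hwσ, Set.indicator_apply]
            split_ifs <;> simp
          rw [h1, ← measure_biUnion_finset]
          · refine (measure_mono (t := Metric.closedBall z' (2 * ρ)) ?_).trans
              ((hσ z' (2 * ρ) (by linarith)).trans (le_of_eq ?_))
            · refine Set.iUnion₂_subset fun i hi x hx => ?_
              have h2 := hBε i x hx _ (ht i)
              have h3 : dist (t i) z' ≤ ρ := (Finset.mem_filter.1 hi).2
              exact Metric.mem_closedBall.2 (by linarith [dist_triangle x (t i) z'])
            · rw [Real.mul_rpow (by norm_num) hρ0.le]; ring_nf
          · exact fun i _ j _ hij => hBd fun h => hij (Subtype.ext h)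
          · exact fun i _ => hBm i
        · have h1 : ∑ i, w i = (σ S).toReal := by
            rw [← hsumS, ENNReal.toReal_sum fun i _ => measure_ne_top _ _]
          rw [h1]
          exact (ENNReal.ofReal_le_iff_le_toReal (measure_ne_top _ _)).1 hmS
    _ = ENNReal.ofReal C := by simp

end NegativeMomentsOfChaos

section KernelEstimates

lemma max_log_inv_le_of_le {a b : ℝ} (ha : 0 < a) (hab : a ≤ b) :
    max (Real.log b⁻¹) 0 ≤ max (Real.log a⁻¹) 0 := by
  refine max_le_max ?_ le_rfl
  rw [Real.log_inv, Real.log_inv]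
  exact neg_le_neg (Real.log_le_log ha hab)

lemma max_log_inv_mul_le {a b : ℝ} (ha : 0 < a) (ha1 : a ≤ 1) (hb : 0 ≤ b) :
    max (Real.log (a * b)⁻¹) 0 ≤ -Real.log a + max (Real.log b⁻¹) 0 := by
  have h0 : Real.log a ≤ 0 := Real.log_nonpos ha.le ha1
  rcases hb.eq_or_lt with rfl | hb
  · simpa using h0
  · rw [Real.log_inv, Real.log_inv, Real.log_mul ha.ne' hb.ne']
    refine max_le ?_ ?_
    · linarith [le_max_left (-Real.log b) 0]
    · linarith [le_max_right (-Real.log b) 0]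

/-- The positive part of the logarithmic kernel is integrable. -/
lemma integrable_max_log_inv_norm (hd : 1 ≤ d) :
    Integrable fun v : EuclideanSpace ℝ (Fin d) => max (Real.log ‖v‖⁻¹) 0 := by
  have : Nonempty (Fin d) := ⟨⟨0, hd⟩⟩
  rw [integrable_fun_norm_addHaar volume (f := fun y => max (Real.log y⁻¹) 0)]
  have h1 : IntegrableOn Real.log (Set.Ioc 0 1) :=
    (intervalIntegrable_iff_integrableOn_Ioc_of_le zero_le_one).1
      intervalIntegral.intervalIntegrable_log'
  have h2 : IntegrableOn
      (fun y : ℝ => y ^ (Module.finrank ℝ (EuclideanSpace ℝ (Fin d)) - 1) • max (Real.log y⁻¹) 0)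
      (Set.Ioc 0 1) := by
    refine Integrable.mono h1 (by fun_prop) ?_
    refine (ae_restrict_mem measurableSet_Ioc).mono fun y hy => ?_
    have h3 : Real.log y ≤ 0 := Real.log_nonpos hy.1.le hy.2
    rw [Real.log_inv, max_eq_left (by linarith), smul_eq_mul, norm_mul, norm_neg]
    refine mul_le_of_le_one_left (norm_nonneg _) ?_
    rw [norm_pow, Real.norm_of_nonneg hy.1.le]
    exact pow_le_one₀ hy.1.le hy.2
  refine h2.of_forall_sdiff_eq_zero measurableSet_Ioi fun y hy => ?_
  have h3 : 1 < y := by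
    by_contra h
    exact hy.2 ⟨hy.1, not_lt.1 h⟩
  rw [Real.log_inv, max_eq_right (by linarith [Real.log_pos h3]), smul_zero]

/-- The probability measure with density `θ`. -/
def mollifierMeasure (θ : EuclideanSpace ℝ (Fin d) → ℝ) : Measure (EuclideanSpace ℝ (Fin d)) :=
  volume.withDensity fun x => ENNReal.ofReal (θ x)

namespace IsMollifier

variable {θ : EuclideanSpace ℝ (Fin d) → ℝ}

lemma integrable (hθ : IsMollifier θ) : Integrable θ :=
  hθ.1.continuous.integrable_of_hasCompactSupport hθ.2.1

lemma isProbabilityMeasure (hθ : IsMollifier θ) : IsProbabilityMeasure (mollifierMeasure θ) := by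
  refine ⟨?_⟩
  rw [mollifierMeasure, withDensity_apply _ MeasurableSet.univ, Measure.restrict_univ,
    ← ofReal_integral_eq_lintegral_ofReal hθ.integrable (Eventually.of_forall hθ.2.2.1), hθ.2.2.2,
    ENNReal.ofReal_one]

lemma exists_ae_norm_le (hθ : IsMollifier θ) :
    ∃ S, 1 ≤ S ∧ ∀ᵐ u ∂(mollifierMeasure θ), ‖u‖ ≤ S := by
  obtain ⟨S, hS⟩ := hθ.2.1.isCompact.isBounded.exists_norm_le
  refine ⟨max S 1, le_max_right _ _, ?_⟩
  rw [mollifierMeasure, ae_withDensity_iff hθ.1.continuous.measurable.ennreal_ofReal]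
  refine Eventually.of_forall fun u hu => (hS u ?_).trans (le_max_left _ _)
  refine subset_tsupport _ fun h => hu ?_
  rw [h, ENNReal.ofReal_zero]

lemma exists_le_smul_volume (hθ : IsMollifier θ) :
    ∃ T : ℝ≥0, mollifierMeasure θ ≤ T • volume := by
  obtain ⟨T, hT⟩ := hθ.1.continuous.bounded_above_of_compact_support hθ.2.1
  refine ⟨T.toNNReal, ?_⟩
  have h1 : (T.toNNReal • volume : Measure (EuclideanSpace ℝ (Fin d))) =
      volume.withDensity fun _ => (T.toNNReal : ℝ≥0∞) := by
    rw [withDensity_const]; rfl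
  rw [h1]
  refine withDensity_mono (Eventually.of_forall fun x => ?_)
  exact ENNReal.ofReal_le_ofReal ((le_abs_self _).trans (hT x))

lemma integral_mollifierScaled_mul (hθ : IsMollifier θ) {ε : ℝ} (hε : 0 < ε)
    (F : EuclideanSpace ℝ (Fin d) → ℝ) :
    ∫ u, mollifierScaled θ ε u * F u = ∫ u, F (ε • u) ∂(mollifierMeasure θ) := by
  have h1 : ∫ u, F (ε • u) ∂(mollifierMeasure θ) = ∫ u, θ u * F (ε • u) := by
    rw [mollifierMeasure, integral_withDensity_eq_integral_toReal_smul
      hθ.1.continuous.measurable.ennreal_ofReal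
      (Eventually.of_forall fun _ => ENNReal.ofReal_lt_top)]
    refine integral_congr_ae (Eventually.of_forall fun u => ?_)
    simp only [ENNReal.toReal_ofReal (hθ.2.2.1 u), smul_eq_mul]
  have h2 := Measure.integral_comp_smul_of_nonneg (volume : Measure (EuclideanSpace ℝ (Fin d)))
    (fun u => θ (ε⁻¹ • u) * F u) ε (hR := hε.le)
  simp only [inv_smul_smul₀ hε.ne', finrank_euclideanSpace_fin, smul_eq_mul] at h2
  rw [h1, h2, ← integral_const_mul]
  simp only [mollifierScaled, mul_assoc]

lemma mollifiedCov_eq (hθ : IsMollifier θ)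
    (K : EuclideanSpace ℝ (Fin d) → EuclideanSpace ℝ (Fin d) → ℝ) {ε δ : ℝ} (hε : 0 < ε)
    (hδ : 0 < δ) (x y : EuclideanSpace ℝ (Fin d)) :
    mollifiedCov K θ θ ε δ x y =
      ∫ u, ∫ v, K (x - ε • u) (y - δ • v) ∂(mollifierMeasure θ) ∂(mollifierMeasure θ) := by
  simp only [mollifiedCov, mul_assoc, integral_const_mul]
  rw [hθ.integral_mollifierScaled_mul hε fun u => ∫ v, mollifierScaled θ δ v * K (x - u) (y - v)]
  simp only [hθ.integral_mollifierScaled_mul hδ]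

/-- The logarithmic potential of a rescaled mollifier is at most `-log ε` up to a constant. -/
lemma exists_integral_max_log_inv_le (hd : 1 ≤ d) (hθ : IsMollifier θ) :
    ∃ C, 0 ≤ C ∧ ∀ ε : ℝ, 0 < ε → ε ≤ 1 → ∀ w : EuclideanSpace ℝ (Fin d),
      Integrable (fun v => max (Real.log (dist w (ε • v))⁻¹) 0) (mollifierMeasure θ) ∧
      ∫ v, max (Real.log (dist w (ε • v))⁻¹) 0 ∂(mollifierMeasure θ) ≤ -Real.log ε + C := by
  have := hθ.isProbabilityMeasure
  obtain ⟨T, hT⟩ := hθ.exists_le_smul_volume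
  set I := ∫ v : EuclideanSpace ℝ (Fin d), max (Real.log ‖v‖⁻¹) 0 with hI
  have hI0 : 0 ≤ I := integral_nonneg fun _ => le_max_right _ _
  refine ⟨T * I, by positivity, fun ε hε hε1 w => ?_⟩
  have h1 : Integrable fun v : EuclideanSpace ℝ (Fin d) => max (Real.log ‖ε⁻¹ • w - v‖⁻¹) 0 :=
    (integrable_max_log_inv_norm hd).comp_sub_left (ε⁻¹ • w)
  have h2 : Integrable (fun v : EuclideanSpace ℝ (Fin d) => max (Real.log ‖ε⁻¹ • w - v‖⁻¹) 0)
      (T • volume) := h1.smul_measure_nnreal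
  have h3 := h2.mono_measure hT
  have h4 : ∀ v, max (Real.log (dist w (ε • v))⁻¹) 0 ≤
      -Real.log ε + max (Real.log ‖ε⁻¹ • w - v‖⁻¹) 0 := fun v => by
    have h5 : dist w (ε • v) = ε * ‖ε⁻¹ • w - v‖ := by
      rw [← Real.norm_of_nonneg hε.le, ← norm_smul, Real.norm_of_nonneg hε.le, smul_sub,
        smul_inv_smul₀ hε.ne', dist_eq_norm]
    rw [h5]
    exact max_log_inv_mul_le hε hε1 (norm_nonneg _)
  have h6 : Integrable (fun v => -Real.log ε + max (Real.log ‖ε⁻¹ • w - v‖⁻¹) 0)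
      (mollifierMeasure θ) := (integrable_const _).add h3
  have h7 : Integrable (fun v => max (Real.log (dist w (ε • v))⁻¹) 0) (mollifierMeasure θ) := by
    refine h6.mono' ((Real.measurable_log.comp (by fun_prop)).max
      measurable_const).aestronglyMeasurable (Eventually.of_forall fun v => ?_)
    rw [Real.norm_of_nonneg (le_max_right _ _)]
    exact h4 v
  refine ⟨h7, (integral_mono h7 h6 h4).trans ?_⟩
  rw [integral_add (integrable_const _) h3]
  have h8 : ∫ v, max (Real.log ‖ε⁻¹ • w - v‖⁻¹) 0 ∂(mollifierMeasure θ) ≤ T * I := by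
    refine (integral_mono_measure hT (Eventually.of_forall fun v => le_max_right _ _) h2).trans
      (le_of_eq ?_)
    rw [integral_smul_nnreal_measure, hI,
      ← integral_sub_left_eq_self (fun v => max (Real.log ‖v‖⁻¹) 0) volume (ε⁻¹ • w)]
    rfl
  simpa using h8

end IsMollifier

variable {θ : EuclideanSpace ℝ (Fin d) → ℝ}
  {g : EuclideanSpace ℝ (Fin d) → EuclideanSpace ℝ (Fin d) → ℝ}

lemma IsBoundedMeasurable.measurable_logKernel (hg : IsBoundedMeasurable g) :
    Measurable (Function.uncurry (logKernel g)) := by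
  have h1 : Measurable fun p : EuclideanSpace ℝ (Fin d) × EuclideanSpace ℝ (Fin d) =>
      max (Real.log (dist p.1 p.2)⁻¹) 0 :=
    (Real.measurable_log.comp (by fun_prop)).max measurable_const
  exact h1.add hg.1

/-- The inner integral defining the mollified covariance: integrability and upper bound. -/
lemma exists_integral_logKernel_le (hd : 1 ≤ d) (hg : IsBoundedMeasurable g)
    (hθ : IsMollifier θ) :
    ∃ C, 0 ≤ C ∧ ∀ ε : ℝ, 0 < ε → ε ≤ 1 → ∀ p y : EuclideanSpace ℝ (Fin d),
      Integrable (fun v => logKernel g p (y - ε • v)) (mollifierMeasure θ) ∧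
      ∫ v, logKernel g p (y - ε • v) ∂(mollifierMeasure θ) ≤ -Real.log ε + C ∧
      -C ≤ ∫ v, logKernel g p (y - ε • v) ∂(mollifierMeasure θ) := by
  have := hθ.isProbabilityMeasure
  obtain ⟨C, hC0, hC⟩ := hθ.exists_integral_max_log_inv_le hd
  obtain ⟨G, hG⟩ := hg.2
  have hG0 : 0 ≤ G := (abs_nonneg _).trans (hG 0 0)
  refine ⟨C + G, by positivity, fun ε hε hε1 p y => ?_⟩
  obtain ⟨h1, h2⟩ := hC ε hε hε1 (y - p)
  have h3 : ∀ v, dist p (y - ε • v) = dist (y - p) (ε • v) := fun v => by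
    rw [dist_comm, dist_eq_norm, dist_eq_norm]
    congr 1
    abel
  have h4 : Integrable (fun v => g p (y - ε • v)) (mollifierMeasure θ) := by
    refine Integrable.of_bound (C := G) ?_ (Eventually.of_forall fun v => hG _ _)
    exact (hg.1.comp (f := fun v => (p, y - ε • v)) (by fun_prop)).aestronglyMeasurable
  have h5 : ∫ v, g p (y - ε • v) ∂(mollifierMeasure θ) ≤ G := by
    refine (integral_mono h4 (integrable_const G) fun v => (abs_le.1 (hG _ _)).2).trans ?_
    simp
  have h6 : -G ≤ ∫ v, g p (y - ε • v) ∂(mollifierMeasure θ) := by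
    refine le_trans ?_ (integral_mono (integrable_const (-G)) h4 fun v => (abs_le.1 (hG _ _)).1)
    simp
  simp only [logKernel, h3]
  refine ⟨h1.add h4, ?_, ?_⟩ <;> rw [integral_add h1 h4]
  · linarith
  · have h7 : 0 ≤ ∫ v, max (Real.log (dist (y - p) (ε • v))⁻¹) 0 ∂(mollifierMeasure θ) :=
      integral_nonneg fun v => le_max_right _ _
    linarith

lemma integrable_integral_logKernel (hd : 1 ≤ d) (hg : IsBoundedMeasurable g)
    (hθ : IsMollifier θ) {ε ε' : ℝ} (hε' : 0 < ε') (hε1 : ε' ≤ 1)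
    (x y : EuclideanSpace ℝ (Fin d)) :
    Integrable (fun u => ∫ v, logKernel g (x - ε • u) (y - ε' • v) ∂(mollifierMeasure θ))
      (mollifierMeasure θ) := by
  have := hθ.isProbabilityMeasure
  obtain ⟨C, hC0, hC⟩ := exists_integral_logKernel_le hd hg hθ
  have hlog : Real.log ε' ≤ 0 := Real.log_nonpos hε'.le hε1
  refine Integrable.of_bound (C := -Real.log ε' + C) ?_ (Eventually.of_forall fun u => ?_)
  · refine (StronglyMeasurable.integral_prod_right (f := fun u v =>
      logKernel g (x - ε • u) (y - ε' • v)) ?_).aestronglyMeasurable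
    exact (hg.measurable_logKernel.comp (f := fun q : EuclideanSpace ℝ (Fin d) ×
      EuclideanSpace ℝ (Fin d) => (x - ε • q.1, y - ε' • q.2)) (by fun_prop)).stronglyMeasurable
  · obtain ⟨-, h2, h3⟩ := hC ε' hε' hε1 (x - ε • u) y
    exact abs_le.2 ⟨by linarith, h2⟩

lemma dist_le_dist_add_of_norm_le {x y u v : EuclideanSpace ℝ (Fin d)} {ε ε' S : ℝ} (hε : 0 ≤ ε)
    (hε' : 0 ≤ ε') (hu : ‖u‖ ≤ S) (hv : ‖v‖ ≤ S) :
    |dist (x - ε • u) (y - ε' • v) - dist x y| ≤ (ε + ε') * S := by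
  have h1 : dist (x - ε • u) x ≤ ε * S := by
    rw [dist_eq_norm, sub_sub_cancel_left, norm_neg, norm_smul, Real.norm_of_nonneg hε]
    gcongr
  have h2 : dist (y - ε' • v) y ≤ ε' * S := by
    rw [dist_eq_norm, sub_sub_cancel_left, norm_neg, norm_smul, Real.norm_of_nonneg hε']
    gcongr
  have h3 := dist_triangle4 (x - ε • u) x y (y - ε' • v)
  have h4 := dist_triangle4 x (x - ε • u) (y - ε' • v) y
  rw [dist_comm y] at h3
  rw [dist_comm x (x - ε • u)] at h4
  exact abs_le.2 ⟨by linarith, by linarith⟩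

/-- Lower bound for the mollified covariance. -/
lemma exists_le_mollifiedCov_logKernel (hd : 1 ≤ d) (hg : IsBoundedMeasurable g)
    (hθ : IsMollifier θ) :
    ∃ C, 0 ≤ C ∧ ∀ ε ε' : ℝ, 0 < ε → 0 < ε' → ε ≤ 1 → ε' ≤ 1 →
      ∀ x y : EuclideanSpace ℝ (Fin d),
      -Real.log (max (dist x y) (max ε ε')) - C ≤ mollifiedCov (logKernel g) θ θ ε ε' x y ∧
      -C ≤ mollifiedCov (logKernel g) θ θ ε ε' x y := by
  have := hθ.isProbabilityMeasure
  obtain ⟨C, hC0, hC⟩ := exists_integral_logKernel_le hd hg hθ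
  obtain ⟨S, hS1, hS⟩ := hθ.exists_ae_norm_le
  obtain ⟨T, hT⟩ := hθ.exists_le_smul_volume
  obtain ⟨G, hG⟩ := hg.2
  have hG0 : 0 ≤ G := (abs_nonneg _).trans (hG 0 0)
  have hlogS : 0 ≤ Real.log (3 * S) := Real.log_nonneg (by linarith)
  refine ⟨G + Real.log (3 * S) + C, by positivity, fun ε ε' hε hε' hε1 hε1' x y => ?_⟩
  rw [hθ.mollifiedCov_eq _ hε hε']
  have hint := integrable_integral_logKernel hd hg hθ (ε := ε) hε' hε1' x y
  set m := max (dist x y) (max ε ε') with hm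
  have hm1 : dist x y ≤ m := le_max_left _ _
  have hm2 : ε ≤ m := (le_max_left _ _).trans (le_max_right _ _)
  have hm3 : ε' ≤ m := (le_max_right _ _).trans (le_max_right _ _)
  have hm0 : 0 < m := hε.trans_le hm2
  have hnull : ∀ w : EuclideanSpace ℝ (Fin d), mollifierMeasure θ {w} = 0 := fun w => by
    have : Nonempty (Fin d) := ⟨⟨0, hd⟩⟩
    exact Measure.absolutelyContinuous_of_le_smul (c := (T : ℝ≥0∞)) hT (measure_singleton w)
  constructor
  · have h1 : ∀ᵐ u ∂(mollifierMeasure θ), -Real.log m - (G + Real.log (3 * S) + C) ≤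
        ∫ v, logKernel g (x - ε • u) (y - ε' • v) ∂(mollifierMeasure θ) := by
      filter_upwards [hS] with u hu
      have h2 : ∀ᵐ v ∂(mollifierMeasure θ), -Real.log m - (G + Real.log (3 * S) + C) ≤
          logKernel g (x - ε • u) (y - ε' • v) := by
        have h3 : ∀ᵐ v ∂(mollifierMeasure θ), v ≠ ε'⁻¹ • (y - (x - ε • u)) :=
          measure_eq_zero_iff_ae_notMem.1 (hnull _)
        filter_upwards [hS, h3] with v hv hv'
        have h4 : 0 < dist (x - ε • u) (y - ε' • v) := by
          refine dist_pos.2 fun h => hv' ?_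
          rw [h, sub_sub_cancel, inv_smul_smul₀ hε'.ne']
        have h5 : dist (x - ε • u) (y - ε' • v) ≤ 3 * S * m := by
          have := (abs_le.1 (dist_le_dist_add_of_norm_le (x := x) (y := y) hε.le hε'.le hu hv)).2
          nlinarith [mul_le_mul_of_nonneg_right hm2 (zero_le_one.trans hS1),
            mul_le_mul_of_nonneg_right hm3 (zero_le_one.trans hS1),
            mul_le_mul_of_nonneg_right hS1 hm0.le]
        have h6 := Real.log_le_log h4 h5
        rw [Real.log_mul (by positivity) hm0.ne'] at h6
        have h7 := le_max_left (Real.log (dist (x - ε • u) (y - ε' • v))⁻¹) 0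
        rw [Real.log_inv] at h7
        have h8 := (abs_le.1 (hG (x - ε • u) (y - ε' • v))).1
        rw [logKernel, Real.log_inv]
        linarith
      have := integral_mono_ae (integrable_const _) (hC ε' hε' hε1' (x - ε • u) y).1 h2
      simpa using this
    have := integral_mono_ae (integrable_const _) hint h1
    simpa using this
  · have h1 : ∀ u, -(G + Real.log (3 * S) + C) ≤
        ∫ v, logKernel g (x - ε • u) (y - ε' • v) ∂(mollifierMeasure θ) := fun u => by
      linarith [(hC ε' hε' hε1' (x - ε • u) y).2.2]
    have := integral_mono (integrable_const _) hint h1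
    simpa using this

/-- Upper bound for the mollified covariance. -/
lemma exists_mollifiedCov_logKernel_le (hd : 1 ≤ d) (hg : IsBoundedMeasurable g)
    (hθ : IsMollifier θ) :
    ∃ C, 0 ≤ C ∧ ∀ ε : ℝ, 0 < ε → ε ≤ 1 → ∀ x y : EuclideanSpace ℝ (Fin d),
      mollifiedCov (logKernel g) θ θ ε ε x y ≤ max (-Real.log (max (dist x y) ε)) 0 + C := by
  have := hθ.isProbabilityMeasure
  obtain ⟨C, hC0, hC⟩ := exists_integral_logKernel_le hd hg hθ
  obtain ⟨S, hS1, hS⟩ := hθ.exists_ae_norm_le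
  obtain ⟨G, hG⟩ := hg.2
  have hG0 : 0 ≤ G := (abs_nonneg _).trans (hG 0 0)
  have hlogS : 0 ≤ Real.log (4 * S) := Real.log_nonneg (by linarith)
  refine ⟨C + G + Real.log (4 * S), by positivity, fun ε hε hε1 x y => ?_⟩
  rw [hθ.mollifiedCov_eq _ hε hε]
  have hint := integrable_integral_logKernel hd hg hθ (ε := ε) hε hε1 x y
  have h1 : ∀ᵐ u ∂(mollifierMeasure θ),
      ∫ v, logKernel g (x - ε • u) (y - ε • v) ∂(mollifierMeasure θ) ≤
        max (-Real.log (max (dist x y) ε)) 0 + (C + G + Real.log (4 * S)) := by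
    rcases le_total (dist x y) (4 * S * ε) with hxy | hxy
    · refine Eventually.of_forall fun u => ?_
      have h2 : max (dist x y) ε ≤ 4 * S * ε := max_le hxy (by nlinarith)
      have h3 := Real.log_le_log (hε.trans_le (le_max_right (dist x y) ε)) h2
      rw [Real.log_mul (by positivity) hε.ne'] at h3
      linarith [(hC ε hε hε1 (x - ε • u) y).2.1, le_max_left (-Real.log (max (dist x y) ε)) 0]
    · have hd0 : 0 < dist x y := lt_of_lt_of_le (by positivity) hxy
      have h2 : max (dist x y) ε = dist x y := max_eq_left (by nlinarith)
      rw [h2]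
      filter_upwards [hS] with u hu
      have h3 : ∀ᵐ v ∂(mollifierMeasure θ), logKernel g (x - ε • u) (y - ε • v) ≤
          max (-Real.log (dist x y)) 0 + (C + G + Real.log (4 * S)) := by
        filter_upwards [hS] with v hv
        have h4 := (abs_le.1 (dist_le_dist_add_of_norm_le (x := x) (y := y) hε.le hε.le hu hv)).1
        have h5 : 2⁻¹ * dist x y ≤ dist (x - ε • u) (y - ε • v) := by linarith
        have h6 := (max_log_inv_le_of_le (by positivity) h5).trans
          (max_log_inv_mul_le (by norm_num) (by norm_num) dist_nonneg)
        have h7 : -Real.log 2⁻¹ ≤ Real.log (4 * S) := by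
          rw [Real.log_inv, neg_neg]
          exact Real.log_le_log (by norm_num) (by linarith)
        have h8 := (abs_le.1 (hG (x - ε • u) (y - ε • v))).2
        rw [Real.log_inv (dist x y)] at h6
        rw [logKernel]
        linarith
      have := integral_mono_ae (hC ε hε hε1 (x - ε • u) y).1 (integrable_const _) h3
      simpa using this
  have := integral_mono_ae hint (integrable_const _) h1
  simpa using this

end KernelEstimates

section MollifiedField

variable {Ω : Type*} {X : ℝ → EuclideanSpace ℝ (Fin d) → Ω → ℝ}
  {Km : ℝ → ℝ → EuclideanSpace ℝ (Fin d) → EuclideanSpace ℝ (Fin d) → ℝ}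

/-- The linear span of the mollified field. -/
def fieldSpan (X : ℝ → EuclideanSpace ℝ (Fin d) → Ω → ℝ) : Submodule ℝ (Ω → ℝ) :=
  Submodule.span ℝ {L | ∃ ε ∈ Set.Ioc (0 : ℝ) 1, ∃ x, L = X ε x}

lemma mem_fieldSpan {ε : ℝ} (hε : 0 < ε) (hε1 : ε ≤ 1) (x : EuclideanSpace ℝ (Fin d)) :
    X ε x ∈ fieldSpan X :=
  Submodule.subset_span ⟨ε, ⟨hε, hε1⟩, x, rfl⟩

variable [MeasurableSpace Ω] {P : Measure Ω}

namespace IsGaussianFamily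

lemma measurable_apply (hX : IsGaussianFamily P X Km) (ε : ℝ) (x : EuclideanSpace ℝ (Fin d)) :
    Measurable (X ε x) :=
  hX.1.comp (f := fun ω => (ε, x, ω)) (by fun_prop)

lemma isGaussianSpace (hX : IsGaussianFamily P X Km) : IsGaussianSpace P (fieldSpan X) := by
  have key : ∀ L ∈ fieldSpan X, Measurable L ∧ ∃ v : ℝ≥0, P.map L = gaussianReal 0 v := by
    intro L hL
    obtain ⟨n, l, L', hL'⟩ := Submodule.mem_span_set'.1 hL
    choose ε hε x hx using fun i => (L' i).2
    have hL1 : L = fun ω => ∑ i, l i * X (ε i) (x i) ω := by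
      ext ω
      rw [← hL', Finset.sum_apply]
      exact Finset.sum_congr rfl fun i _ => by rw [Pi.smul_apply, hx i, smul_eq_mul]
    obtain ⟨v, -, hv⟩ := hX.2 n ε x hε l
    refine ⟨?_, v, by rw [hL1]; exact hv⟩
    rw [hL1]
    exact Finset.measurable_fun_sum _ fun i _ => (hX.measurable_apply _ _).const_mul _
  exact ⟨fun L hL => (key L hL).1, fun L hL => (key L hL).2⟩

lemma mixedMoment_self (hX : IsGaussianFamily P X Km) {ε : ℝ} (hε : 0 < ε) (hε1 : ε ≤ 1)
    (x : EuclideanSpace ℝ (Fin d)) : mixedMoment P (X ε x) (X ε x) = Km ε ε x x := by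
  obtain ⟨v, hv, hlaw⟩ := hX.2 1 (fun _ => ε) (fun _ => x) (fun _ => ⟨hε, hε1⟩) fun _ => 1
  simp only [Finset.univ_unique, Finset.sum_singleton, one_mul] at hv hlaw
  rw [hX.isGaussianSpace.mixedMoment_self_of_law (mem_fieldSpan hε hε1 x) hlaw, hv]

lemma mixedMoment_eq (hX : IsGaussianFamily P X Km) {ε ε' : ℝ} (hε : 0 < ε) (hε1 : ε ≤ 1)
    (hε' : 0 < ε') (hε1' : ε' ≤ 1) (x y : EuclideanSpace ℝ (Fin d)) :
    mixedMoment P (X ε x) (X ε' y) = (Km ε ε' x y + Km ε' ε y x) / 2 := by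
  obtain ⟨v, hv, hlaw⟩ := hX.2 2 ![ε, ε'] ![x, y]
    (by intro i; fin_cases i; exacts [⟨hε, hε1⟩, ⟨hε', hε1'⟩]) fun _ => 1
  simp only [Fin.sum_univ_two, Matrix.cons_val_zero, Matrix.cons_val_one, one_mul] at hv hlaw
  have hP := hX.isGaussianSpace
  have h1 := mem_fieldSpan (X := X) hε hε1 x
  have h2 := mem_fieldSpan (X := X) hε' hε1' y
  have h3 := hP.mixedMoment_self_of_law ((fieldSpan X).add_mem h1 h2) hlaw
  rw [hP.mixedMoment_add_self h1 h2, hv, hX.mixedMoment_self hε hε1,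
    hX.mixedMoment_self hε' hε1'] at h3
  linarith

end IsGaussianFamily

/-- The rescaled mollified field is log-correlated, uniformly in the mollification scale. -/
lemma exists_isLogField (hd : 1 ≤ d)
    {g : EuclideanSpace ℝ (Fin d) → EuclideanSpace ℝ (Fin d) → ℝ} (hg : IsBoundedMeasurable g)
    {θ : EuclideanSpace ℝ (Fin d) → ℝ} (hθ : IsMollifier θ)
    (hX : IsGaussianFamily P X (mollifiedCov (logKernel g) θ θ)) {γ : ℝ} (hγ : 0 ≤ γ) :
    ∃ C₀, 0 ≤ C₀ ∧ ∀ ε : ℝ, 0 < ε → ε ≤ 1 →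
      IsLogField P (fieldSpan X) γ C₀ ε fun x => γ • X ε x := by
  obtain ⟨C₁, hC₁, hlow⟩ := exists_le_mollifiedCov_logKernel hd hg hθ
  obtain ⟨C₂, hC₂, hup⟩ := exists_mollifiedCov_logKernel_le hd hg hθ
  refine ⟨max C₁ C₂, le_max_of_le_left hC₁, fun ε hε hε1 => ?_⟩
  have hmax1 := le_max_left C₁ C₂
  have hmax2 := le_max_right C₁ C₂
  refine ⟨fun x => (fieldSpan X).smul_mem _ (mem_fieldSpan hε hε1 x), ?_, fun x y => ?_,
    fun x y => ?_, fun z r hr hr1 => ⟨X r z, mem_fieldSpan (hε.trans_le hr) hr1 z, ?_, fun y => ?_⟩⟩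
  · exact (hX.1.comp (f := fun q : EuclideanSpace ℝ (Fin d) × Ω => (ε, q.1, q.2))
      (by fun_prop)).const_mul γ
  · rw [mixedMoment_smul_left, mixedMoment_smul_right, hX.mixedMoment_eq hε hε1 hε hε1, ← mul_assoc,
      ← pow_two]
    have h1 := hup ε hε hε1 x y
    have h2 := hup ε hε hε1 y x
    rw [dist_comm y] at h2
    gcongr
    linarith
  · rw [mixedMoment_smul_left, mixedMoment_smul_right, hX.mixedMoment_eq hε hε1 hε hε1, ← mul_assoc,
      ← pow_two, ← mul_neg]
    have h1 := (hlow ε ε hε hε hε1 hε1 x y).2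
    have h2 := (hlow ε ε hε hε hε1 hε1 y x).2
    gcongr
    linarith
  · have hr0 := hε.trans_le hr
    rw [hX.mixedMoment_self hr0 hr1]
    have h1 := hup r hr0 hr1 z z
    rw [dist_self, max_eq_right hr0.le,
      max_eq_left (neg_nonneg.2 (Real.log_nonpos hr0.le hr1))] at h1
    linarith
  · have hr0 := hε.trans_le hr
    rw [mixedMoment_smul_right, hX.mixedMoment_eq hr0 hr1 hε hε1]
    have h1 := (hlow r ε hr0 hε hr1 hε1 z y).1
    have h2 := (hlow ε r hε hr0 hε1 hr1 y z).1
    rw [max_eq_left hr, dist_comm] at h1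
    rw [max_eq_right hr] at h2
    gcongr
    linarith

end MollifiedField

section LimitMoments

/-- Disjoint dyadic families of small balls inside a ball. -/
lemma exists_disjoint_balls (hd : 1 ≤ d) (x : EuclideanSpace ℝ (Fin d)) {r : ℝ} (hr : 0 < r) :
    ∃ ρ : ℝ, 0 < ρ ∧ ρ ≤ 1 ∧ ∀ n : ℕ, ∃ c : (Fin d → Fin (2 ^ n)) → EuclideanSpace ℝ (Fin d),
      (∀ k, Metric.ball (c k) (ρ / 2 ^ n) ⊆ Metric.ball x r) ∧
      Pairwise (Function.onFun Disjoint fun k => Metric.ball (c k) (ρ / 2 ^ n)) := by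
  have hd' : (1 : ℝ) ≤ d := by exact_mod_cast hd
  set s := min (r / (2 * d)) 1 with hs
  have hs0 : 0 < s := lt_min (by positivity) one_pos
  have hsr : 2 * d * s ≤ r := by
    have := (le_div_iff₀ (by positivity)).1 (min_le_left (r / (2 * d)) 1)
    linarith
  refine ⟨s / 2, by positivity, by linarith [min_le_right (r / (2 * d)) 1], fun n => ?_⟩
  have h2n : (1 : ℝ) ≤ 2 ^ n := one_le_pow₀ (by norm_num)
  refine ⟨fun k => x + WithLp.toLp 2 fun i => s * ((k i : ℕ) / 2 ^ n : ℝ), fun k => ?_,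
    fun k l hkl => ?_⟩
  · have h1 : ‖(WithLp.toLp 2 fun i => s * ((k i : ℕ) / 2 ^ n : ℝ) :
        EuclideanSpace ℝ (Fin d))‖ ≤ d * s := by
      refine le_of_sq_le_sq ?_ (by positivity)
      rw [EuclideanSpace.norm_sq_eq]
      calc ∑ i, ‖s * ((k i : ℕ) / 2 ^ n : ℝ)‖ ^ 2 ≤ ∑ _i : Fin d, s ^ 2 := by
            refine Finset.sum_le_sum fun i _ => ?_
            have h3 : ((k i : ℕ) : ℝ) ≤ 2 ^ n := by exact_mod_cast (k i).2.le
            have h4 : ((k i : ℕ) / 2 ^ n : ℝ) ≤ 1 := (div_le_one (by positivity)).2 h3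
            rw [Real.norm_of_nonneg (by positivity)]
            gcongr
            exact mul_le_of_le_one_right hs0.le h4
        _ = d * s ^ 2 := by simp
        _ ≤ (d * s) ^ 2 := by nlinarith [sq_nonneg s]
    refine Metric.ball_subset_ball' ?_
    rw [dist_self_add_left]
    have h2 : s / 2 / 2 ^ n ≤ s / 2 := div_le_self (by positivity) h2n
    nlinarith
  · obtain ⟨i, hi⟩ := Function.ne_iff.1 hkl
    refine Metric.ball_disjoint_ball ?_
    rw [dist_add_left, dist_eq_norm]
    refine le_trans ?_ (PiLp.norm_apply_le _ i)
    have h1 : (1 : ℝ) ≤ |((k i : ℕ) : ℝ) - ((l i : ℕ) : ℝ)| := by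
      have h2 : ((k i : ℕ) : ℤ) - (l i : ℕ) ≠ 0 := by
        intro h
        exact hi (Fin.ext (by omega))
      exact_mod_cast Int.one_le_abs h2
    have h3 : (WithLp.toLp 2 (fun i => s * ((k i : ℕ) / 2 ^ n : ℝ)) -
        WithLp.toLp 2 (fun i => s * ((l i : ℕ) / 2 ^ n : ℝ)) : EuclideanSpace ℝ (Fin d)) i =
        s / 2 ^ n * (((k i : ℕ) : ℝ) - ((l i : ℕ) : ℝ)) := by
      simp only [PiLp.sub_apply]
      ring
    rw [h3, norm_mul, Real.norm_of_nonneg (by positivity), Real.norm_eq_abs]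
    calc s / 2 / 2 ^ n + s / 2 / 2 ^ n = s / 2 ^ n * 1 := by ring
      _ ≤ _ := by gcongr

variable {Ω : Type*} [MeasurableSpace Ω] {P : Measure Ω} {H : Submodule ℝ (Ω → ℝ)}
  {σ : Measure (EuclideanSpace ℝ (Fin d))} {Y : ℝ → EuclideanSpace ℝ (Fin d) → Ω → ℝ}
  {A : Set (EuclideanSpace ℝ (Fin d))} {m : Ω → ℝ≥0∞} {γ C₀ Cσ : ℝ}

/-- `m` is the almost sure limit of the mass of `A` along arbitrarily small scales. -/
def IsChaosLimit (P : Measure Ω) (σ : Measure (EuclideanSpace ℝ (Fin d)))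
    (Y : ℝ → EuclideanSpace ℝ (Fin d) → Ω → ℝ) (A : Set (EuclideanSpace ℝ (Fin d)))
    (m : Ω → ℝ≥0∞) : Prop :=
  ∀ ρ : ℝ, 0 < ρ → ∃ ε : ℕ → ℝ, (∀ n, 0 < ε n ∧ ε n ≤ 1 ∧ ε n ≤ ρ) ∧
    ∀ᵐ ω ∂P, Tendsto (fun n => chaosMass P σ (Y (ε n)) A ω) atTop (𝓝 (m ω))

namespace IsChaosLimit

lemma lintegral_rpow_neg_lt_top [IsProbabilityMeasure P] [IsFiniteMeasure σ]
    (hm : IsChaosLimit P σ Y A m) (hP : IsGaussianSpace P H)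
    (hY : ∀ ε, 0 < ε → ε ≤ 1 → IsLogField P H γ C₀ ε (Y ε)) (hγ : 0 ≤ γ)
    (hγd : γ ^ 2 < 2 * d) (hCσ : 0 ≤ Cσ) (hσ : ∀ ε, 0 < ε → IsBallRegular σ d Cσ ε)
    {x : EuclideanSpace ℝ (Fin d)} {r : ℝ} (hr : 0 < r) (hA : MeasurableSet A)
    (hAr : A ⊆ Metric.closedBall x r) (hσA : σ A ≠ 0) {a : ℝ} (ha : 0 < a) :
    ∫⁻ ω, m ω ^ (-a) ∂P < ⊤ := by
  obtain ⟨ε, hε, hlim⟩ := hm r hr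
  have hσA' : 0 < (σ A).toReal := ENNReal.toReal_pos hσA (measure_ne_top _ _)
  obtain ⟨C, hC⟩ := exists_lintegral_chaosMass_rpow_neg_le (δ := d) (γ := γ) (C₀ := C₀) (Cσ := Cσ)
    (r := r) (m := (σ A).toReal) (a := a) hγ hγd hCσ hr hσA' ha
  have hbd : TotallyBounded A :=
    (isCompact_closedBall x r).totallyBounded.subset hAr
  have h1 : ∀ n, ∫⁻ ω, chaosMass P σ (Y (ε n)) A ω ^ (-a) ∂P ≤ ENNReal.ofReal C := fun n =>
    hC P H σ (Y (ε n)) (ε n) x A hP (hY _ (hε n).1 (hε n).2.1) (hε n).1 (hε n).2.1 (hε n).2.2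
      (hσ _ (hε n).1) hA hbd hAr (ENNReal.ofReal_toReal (measure_ne_top _ _)).le
  calc ∫⁻ ω, m ω ^ (-a) ∂P
      = ∫⁻ ω, liminf (fun n => chaosMass P σ (Y (ε n)) A ω ^ (-a)) atTop ∂P := by
        refine lintegral_congr_ae ?_
        filter_upwards [hlim] with ω hω
        exact ((ENNReal.continuous_rpow_const.tendsto _).comp hω).liminf_eq.symm
    _ ≤ liminf (fun n => ∫⁻ ω, chaosMass P σ (Y (ε n)) A ω ^ (-a) ∂P) atTop :=
        lintegral_liminf_le fun n =>
          ((hY _ (hε n).1 (hε n).2.1).measurable_chaosMass A).pow_const _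
    _ ≤ ENNReal.ofReal C := liminf_le_of_le (by isBoundedDefault) fun b hb => by
        obtain ⟨n, hn⟩ := hb.exists
        exact hn.trans (h1 n)
    _ < ⊤ := ENNReal.ofReal_lt_top

lemma lintegral_rpow_lt_top [SFinite P] [SFinite σ]
    (hm : IsChaosLimit P σ Y A m) (hP : IsGaussianSpace P H)
    (hY : ∀ ε, 0 < ε → ε ≤ 1 → IsLogField P H γ C₀ ε (Y ε)) (hγ : 0 ≤ γ)
    (hCσ : 0 ≤ Cσ) (hσ : ∀ ε, 0 < ε → IsBallRegular σ d Cσ ε)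
    {x : EuclideanSpace ℝ (Fin d)} {r : ℝ} (hr : 0 < r) (hA : MeasurableSet A)
    (hAr : A ⊆ Metric.closedBall x r) {p : ℝ} (hp : 0 < p) (hpq : γ ^ 2 * p < 2 * d) :
    ∫⁻ ω, m ω ^ p ∂P < ⊤ := by
  obtain ⟨ε, hε, hlim⟩ := hm r hr
  obtain ⟨C, -, hC⟩ := exists_hasMomentBound (δ := d) (C₀ := C₀) (Cσ := Cσ) hγ hCσ hp hpq (max r 1)
    (le_max_right _ _)
  exact (HasMomentBound.lintegral_limit_rpow_le (fun n => hY _ (hε n).1 (hε n).2.1)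
    (fun n => hC P H σ (Y (ε n)) (ε n) hP (hY _ (hε n).1 (hε n).2.1) (hε n).1 (hε n).2.1
      (hσ _ (hε n).1)) (le_max_left r 1) (fun n => (hε n).2.2) hA hAr hlim).trans_lt
    ENNReal.ofReal_lt_top

end IsChaosLimit

/-- The critical moment of a limiting chaos measure is infinite. -/
lemma lintegral_rpow_critical_eq_top [IsProbabilityMeasure P] [IsFiniteMeasure σ]
    {M : Ω → Measure (EuclideanSpace ℝ (Fin d))} {x : EuclideanSpace ℝ (Fin d)} {r : ℝ}
    (hd : 1 ≤ d) (hr : 0 < r) (hP : IsGaussianSpace P H)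
    (hY : ∀ ε, 0 < ε → ε ≤ 1 → IsLogField P H γ C₀ ε (Y ε)) (hγ : 0 < γ)
    (hγd : γ ^ 2 < 2 * d) (hCσ : 0 ≤ Cσ) (hσ : ∀ ε, 0 < ε → IsBallRegular σ d Cσ ε)
    {b : ℝ} (hb : 0 < b) (hσb : ∀ z ρ, 0 < ρ → Metric.ball z ρ ⊆ Metric.ball x r →
      ENNReal.ofReal (b * ρ ^ (d : ℝ)) ≤ σ (Metric.ball z ρ))
    (hMm : ∀ A, MeasurableSet A → Measurable fun ω => M ω A)
    (hM : ∀ z ρ, Metric.ball z ρ ⊆ Metric.ball x r →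
      IsChaosLimit P σ Y (Metric.ball z ρ) fun ω => M ω (Metric.ball z ρ)) :
    ∫⁻ ω, M ω (Metric.ball x r) ^ (2 * d / γ ^ 2) ∂P = ⊤ := by
  have hγ2 : 0 < γ ^ 2 := by positivity
  set q : ℝ := 2 * d / γ ^ 2 with hq
  have hq1 : 1 < q := (one_lt_div hγ2).2 hγd
  have hγq : γ ^ 2 * q = 2 * d := by rw [hq]; field_simp
  obtain ⟨p, hp1, hpq⟩ := exists_between hq1
  have hp0 : 0 < p := by linarith
  have hγp : γ ^ 2 * p < 2 * d := by rw [← hγq]; gcongr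
  obtain ⟨C, hC0, hC⟩ := exists_hasMomentBound (δ := d) (C₀ := C₀) (Cσ := Cσ) hγ.le hCσ hp0 hγp 1
    le_rfl
  obtain ⟨ρ, hρ, hρ1, hballs⟩ := exists_disjoint_balls hd x hr
  choose c hcU hcd using hballs
  have hρn : ∀ n : ℕ, 0 < ρ / 2 ^ n := fun n => by positivity
  have hρn1 : ∀ n : ℕ, ρ / 2 ^ n ≤ 1 := fun n =>
    (div_le_self hρ.le (one_le_pow₀ (by norm_num))).trans hρ1
  set ζ := multifractalExponent d γ p with hζ
  have hζd : (d : ℝ) < ζ := by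
    rw [hζ, multifractalExponent]
    nlinarith [mul_pos (sub_pos.2 hp1) (sub_pos.2 hγp)]
  set κ : ℝ := b ^ q * Real.exp (-(q * (q - 1) * γ ^ 2 * (3 / 2 * C₀))) with hκ
  have hκ0 : 0 < κ := by positivity
  have hcard : ∀ n : ℕ, Fintype.card (Fin d → Fin (2 ^ n)) = (2 ^ n) ^ d := fun n => by simp
  refine lintegral_rpow_eq_top_of_superadditive (ι := fun n => Fin d → Fin (2 ^ n))
    hp0 hpq.le hq1.le
    (m := fun n k ω => M ω (Metric.ball (c n k) (ρ / 2 ^ n))) (fun n k => hMm _ measurableSet_ball)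
    (fun n ω => ?_) (c := ENNReal.ofReal (κ * ρ ^ (d : ℝ)))
    (ENNReal.ofReal_pos.2 (by positivity)).ne' (fun n => ?_) ?_
  · refine le_trans (le_of_eq ?_) (measure_mono (Set.iUnion_subset (hcU n)))
    rw [measure_iUnion (hcd n) fun _ => measurableSet_ball, tsum_fintype]
  · have h1 : ∀ k, ENNReal.ofReal (κ * (ρ / 2 ^ n) ^ (d : ℝ)) ≤
        ∫⁻ ω, M ω (Metric.ball (c n k) (ρ / 2 ^ n)) ^ q ∂P := by
      intro k
      obtain ⟨ε, hε, hlim⟩ := hM _ _ (hcU n k) _ (hρn n)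
      have hYn := fun j => hY (ε j) (hε j).1 (hε j).2.1
      have h2 := IsLogField.le_lintegral_limit_rpow hP hγ hYn (hρn n) (hρn1 n)
        (fun j => (hε j).2.2) measurableSet_ball Metric.ball_subset_closedBall
        (a := b * (ρ / 2 ^ n) ^ (d : ℝ)) (by positivity) (hσb _ _ (hρn n) (hcU n k)) hlim hp1
        ENNReal.ofReal_ne_top (fun j => by
          have := hC P H σ (Y (ε j)) (ε j) hP (hYn j) (hε j).1 (hε j).2.1 (hσ _ (hε j).1) 0
            H.zero_mem (c n k) _ _ 0 (hε j).2.2 (hρn1 n) measurableSet_ball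
            Metric.ball_subset_closedBall (by simp [mixedMoment])
          simpa [wickExp, mixedMoment] using this) hq1
      refine le_trans (le_of_eq ?_) h2
      congr 1
      rw [Real.mul_rpow hb.le (by positivity), ← Real.rpow_mul (hρn n).le, hκ]
      have h3 : ((ρ / 2 ^ n) ^ (d : ℝ)) = (ρ / 2 ^ n) ^ (d * q) *
          (ρ / 2 ^ n) ^ (-(γ ^ 2 * q * (q - 1) / 2)) := by
        rw [← Real.rpow_add (hρn n), hγq]
        congr 1
        ring
      rw [h3]
      ring
    calc ENNReal.ofReal (κ * ρ ^ (d : ℝ))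
        = ∑ _k : Fin d → Fin (2 ^ n), ENNReal.ofReal (κ * (ρ / 2 ^ n) ^ (d : ℝ)) := by
          rw [Finset.sum_const, Finset.card_univ, hcard, nsmul_eq_mul, ← ENNReal.ofReal_natCast,
            ← ENNReal.ofReal_mul (by positivity)]
          congr 1
          rw [Real.rpow_natCast, Real.rpow_natCast, div_pow]
          push_cast
          field_simp
      _ ≤ _ := Finset.sum_le_sum fun k _ => h1 k
  · have h1 : ∀ n k, ∫⁻ ω, M ω (Metric.ball (c n k) (ρ / 2 ^ n)) ^ p ∂P ≤
        ENNReal.ofReal (C * (ρ / 2 ^ n) ^ ζ) := by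
      intro n k
      obtain ⟨ε, hε, hlim⟩ := hM _ _ (hcU n k) _ (hρn n)
      exact HasMomentBound.lintegral_limit_rpow_le (fun j => hY _ (hε j).1 (hε j).2.1)
        (fun j => hC P H σ (Y (ε j)) (ε j) hP (hY _ (hε j).1 (hε j).2.1) (hε j).1 (hε j).2.1
          (hσ _ (hε j).1)) (hρn1 n) (fun j => (hε j).2.2) measurableSet_ball
        Metric.ball_subset_closedBall hlim
    have h2 : ∀ n, ∑ k, ∫⁻ ω, M ω (Metric.ball (c n k) (ρ / 2 ^ n)) ^ p ∂P ≤
        ENNReal.ofReal (C * ρ ^ ζ * ((2 : ℝ) ^ ((d : ℝ) - ζ)) ^ n) := by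
      intro n
      refine (Finset.sum_le_sum fun k _ => h1 n k).trans (le_of_eq ?_)
      rw [Finset.sum_const, Finset.card_univ, hcard, nsmul_eq_mul, ← ENNReal.ofReal_natCast,
        ← ENNReal.ofReal_mul (by positivity)]
      congr 1
      have h3 : ((2 : ℝ) ^ ((d : ℝ) - ζ)) ^ n = ((2 : ℝ) ^ n) ^ (d : ℝ) / ((2 : ℝ) ^ n) ^ ζ := by
        rw [← Real.rpow_sub (by positivity), ← Real.rpow_natCast, ← Real.rpow_natCast (2 : ℝ) n,
          ← Real.rpow_mul (by norm_num), ← Real.rpow_mul (by norm_num), mul_comm]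
      rw [h3, Real.div_rpow hρ.le (by positivity), Real.rpow_natCast]
      push_cast
      ring
    refine ne_top_of_le_ne_top ?_ (ENNReal.tsum_le_tsum h2)
    rw [← ENNReal.ofReal_tsum_of_nonneg (fun n => by positivity)]
    · exact ENNReal.ofReal_ne_top
    · exact (summable_geometric_of_lt_one (by positivity)
        (Real.rpow_lt_one_of_one_lt_of_neg (by norm_num) (by linarith))).mul_left _

end LimitMoments

section ReferenceMeasure

variable {f : EuclideanSpace ℝ (Fin d) → ℝ} {U A : Set (EuclideanSpace ℝ (Fin d))}

/-- The measure with density `f` on `U`. -/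
def densityMeasure (f : EuclideanSpace ℝ (Fin d) → ℝ) (U : Set (EuclideanSpace ℝ (Fin d))) :
    Measure (EuclideanSpace ℝ (Fin d)) :=
  (volume.restrict U).withDensity fun y => ENNReal.ofReal (f y)

lemma densityMeasure_apply_le (hU : MeasurableSet U) {C : ℝ} (hC : ∀ y ∈ U, f y ≤ C)
    (hA : MeasurableSet A) : densityMeasure f U A ≤ ENNReal.ofReal C * volume A := by
  rw [densityMeasure, withDensity_apply _ hA, Measure.restrict_restrict hA]
  calc ∫⁻ y in A ∩ U, ENNReal.ofReal (f y) ≤ ∫⁻ _ in A ∩ U, ENNReal.ofReal C :=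
        setLIntegral_mono' (hA.inter hU) fun y hy => ENNReal.ofReal_le_ofReal (hC y hy.2)
    _ ≤ ENNReal.ofReal C * volume A := by
        rw [setLIntegral_const]
        gcongr
        exact Set.inter_subset_left

lemma le_densityMeasure_apply {c : ℝ} (hc : ∀ y ∈ U, c ≤ f y) (hA : MeasurableSet A)
    (hAU : A ⊆ U) : ENNReal.ofReal c * volume A ≤ densityMeasure f U A := by
  rw [densityMeasure, withDensity_apply _ hA, Measure.restrict_restrict hA,
    Set.inter_eq_left.2 hAU, ← setLIntegral_const]
  exact setLIntegral_mono' hA fun y hy => ENNReal.ofReal_le_ofReal (hc y (hAU hy))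

lemma setLIntegral_densityMeasure (hf : Measurable f) (hA : MeasurableSet A) (hAU : A ⊆ U)
    {F : EuclideanSpace ℝ (Fin d) → ℝ≥0∞} (hF : Measurable F) :
    ∫⁻ y in A, F y ∂(densityMeasure f U) = ∫⁻ y in A, F y * ENNReal.ofReal (f y) := by
  rw [densityMeasure, restrict_withDensity hA, Measure.restrict_restrict hA,
    Set.inter_eq_left.2 hAU, lintegral_withDensity_eq_lintegral_mul _ hf.ennreal_ofReal hF]
  simp [mul_comm]

lemma isFiniteMeasure_densityMeasure (hU : MeasurableSet U) (hUfin : volume U ≠ ⊤) {C : ℝ}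
    (hC : ∀ y ∈ U, f y ≤ C) : IsFiniteMeasure (densityMeasure f U) := by
  refine ⟨?_⟩
  rw [densityMeasure, withDensity_apply _ MeasurableSet.univ, Measure.restrict_univ]
  calc ∫⁻ y in U, ENNReal.ofReal (f y) ≤ ∫⁻ _ in U, ENNReal.ofReal C :=
        setLIntegral_mono' hU fun y hy => ENNReal.ofReal_le_ofReal (hC y hy)
    _ < ⊤ := by
        rw [setLIntegral_const]
        exact ENNReal.mul_lt_top ENNReal.ofReal_lt_top hUfin.lt_top

/-- The volume of the Euclidean unit ball. -/
def unitBallVolume (d : ℕ) : ℝ := (volume (Metric.ball (0 : EuclideanSpace ℝ (Fin d)) 1)).toReal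

lemma unitBallVolume_pos : 0 < unitBallVolume d :=
  ENNReal.toReal_pos (Metric.measure_ball_pos _ _ one_pos).ne' measure_ball_lt_top.ne

lemma volume_ball_eq_ofReal (z : EuclideanSpace ℝ (Fin d)) {ρ : ℝ} (hρ : 0 < ρ) :
    volume (Metric.ball z ρ) = ENNReal.ofReal (unitBallVolume d * ρ ^ (d : ℝ)) := by
  rw [Measure.addHaar_ball_of_pos _ _ hρ, finrank_euclideanSpace_fin, mul_comm,
    ENNReal.ofReal_mul unitBallVolume_pos.le, unitBallVolume,
    ENNReal.ofReal_toReal measure_ball_lt_top.ne, Real.rpow_natCast]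

lemma isBallRegular_densityMeasure (hU : MeasurableSet U) {C : ℝ} (hC0 : 0 ≤ C)
    (hC : ∀ y ∈ U, f y ≤ C) {ε : ℝ} (hε : 0 < ε) :
    IsBallRegular (densityMeasure f U) d (C * unitBallVolume d) ε := by
  intro z ρ hρ
  have hρ0 := hε.trans_le hρ
  refine (densityMeasure_apply_le hU hC measurableSet_closedBall).trans (le_of_eq ?_)
  rw [Measure.addHaar_closedBall _ z hρ0.le, ← Measure.addHaar_ball_of_pos _ z hρ0,
    volume_ball_eq_ofReal z hρ0, mul_assoc,
    ENNReal.ofReal_mul hC0]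

end ReferenceMeasure

section GMC

variable {Ω : Type*} [MeasurableSpace Ω] {P : Measure Ω}
  {X : ℝ → EuclideanSpace ℝ (Fin d) → Ω → ℝ}
  {Km : ℝ → ℝ → EuclideanSpace ℝ (Fin d) → EuclideanSpace ℝ (Fin d) → ℝ}
  {f : EuclideanSpace ℝ (Fin d) → ℝ} {D U A : Set (EuclideanSpace ℝ (Fin d))}
  {M : Ω → Measure (EuclideanSpace ℝ (Fin d))} {γ C₀ : ℝ}

/-- The Gaussian multiplicative chaos measure of a set is a limit of chaos masses. -/
lemma IsGMCMeasure.isChaosLimit [SFinite P] (hM : IsGMCMeasure P γ X Km f D M)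
    (hX : IsGaussianFamily P X Km)
    (hY : ∀ ε, 0 < ε → ε ≤ 1 → IsLogField P (fieldSpan X) γ C₀ ε fun y => γ • X ε y)
    (hf : Measurable f) (hf0 : ∀ y ∈ U, 0 ≤ f y) [IsFiniteMeasure (densityMeasure f U)]
    (hA : MeasurableSet A) (hAU : A ⊆ U) (hAc : IsCompact (closure A)) (hAD : closure A ⊆ D) :
    IsChaosLimit P (densityMeasure f U) (fun ε y => γ • X ε y) A fun ω => M ω A := by
  intro ρ hρ
  have hne : (𝓝[Set.Ioc (0 : ℝ) 1] 0).NeBot := by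
    rw [← mem_closure_iff_nhdsWithin_neBot, closure_Ioc (by norm_num)]
    exact ⟨le_rfl, zero_le_one⟩
  obtain ⟨ε, hε, hlim⟩ := (hM.2.2 A hA hAc hAD).exists_seq_tendsto_ae'
  have h1 : ∀ᶠ n in atTop, ε n ∈ Set.Ioc (0 : ℝ) 1 := hε self_mem_nhdsWithin
  have h2 : ∀ᶠ n in atTop, ε n < ρ := hε (mem_nhdsWithin_of_mem_nhds (Iio_mem_nhds hρ))
  obtain ⟨N, hN⟩ := eventually_atTop.1 (h1.and h2)
  have hεN : ∀ n, 0 < ε (n + N) ∧ ε (n + N) ≤ 1 ∧ ε (n + N) ≤ ρ := fun n => by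
    obtain ⟨h3, h4⟩ := hN (n + N) (by omega)
    exact ⟨h3.1, h3.2, h4.le⟩
  refine ⟨fun n => ε (n + N), hεN, ?_⟩
  have hYn := fun n => hY (ε (n + N)) (hεN n).1 (hεN n).2.1
  have hfin : ∀ n, ∀ᵐ ω ∂P,
      chaosMass P (densityMeasure f U) (fun y => γ • X (ε (n + N)) y) A ω < ⊤ := fun n => by
    refine ae_lt_top ((hYn n).measurable_chaosMass A) ?_
    have h3 := (hYn n).lintegral_wickExp_mul_chaosMass (σ := densityMeasure f U)
      hX.isGaussianSpace A (L := 0) (fieldSpan X).zero_mem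
    simp only [wickExp_zero, one_mul] at h3
    rw [h3]
    simp [mixedMoment]
  filter_upwards [hlim, ae_all_iff.2 hfin] with ω hω hω'
  have hMfin : M ω A ≠ ⊤ := hM.2.1 ω A hAc hAD
  rw [← ENNReal.ofReal_toReal hMfin]
  refine (ENNReal.tendsto_ofReal (hω.comp (tendsto_add_atTop_nat N))).congr fun n => ?_
  have hn := hYn n
  have hwick : Measurable fun y => wickExp P (γ • X (ε (n + N)) y) ω :=
    hn.measurable_uncurry_wickExp.comp measurable_prodMk_right
  have hdens : ∀ y, wickExp P (γ • X (ε (n + N)) y) ω =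
      ENNReal.ofReal (Real.exp (γ * X (ε (n + N)) y ω -
        γ ^ 2 / 2 * Km (ε (n + N)) (ε (n + N)) y y)) := fun y => by
    rw [wickExp, mixedMoment_smul_left, mixedMoment_smul_right,
      hX.mixedMoment_self (hεN n).1 (hεN n).2.1]
    congr 3
    ring
  have hmeas : Measurable fun y => Real.exp (γ * X (ε (n + N)) y ω -
      γ ^ 2 / 2 * Km (ε (n + N)) (ε (n + N)) y y) * f y := by
    refine Measurable.mul ?_ hf
    convert hwick.ennreal_toReal using 2 with y
    rw [hdens, ENNReal.toReal_ofReal (Real.exp_pos _).le]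
  have h4 : chaosMass P (densityMeasure f U) (fun y => γ • X (ε (n + N)) y) A ω =
      ∫⁻ y in A, ENNReal.ofReal (Real.exp (γ * X (ε (n + N)) y ω -
        γ ^ 2 / 2 * Km (ε (n + N)) (ε (n + N)) y y) * f y) := by
    rw [chaosMass, setLIntegral_densityMeasure hf hA hAU hwick]
    exact lintegral_congr fun y => by rw [hdens, ← ENNReal.ofReal_mul (Real.exp_pos _).le]
  show ENNReal.ofReal (approxGMC γ X Km f (ε (n + N)) ω A) = _
  rw [approxGMC, integral_eq_lintegral_of_nonneg_ae, ← h4, ENNReal.ofReal_toReal (hω' n).ne]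
  · exact (ae_restrict_mem hA).mono fun y hy => mul_nonneg (Real.exp_pos _).le (hf0 y (hAU hy))
  · exact hmeas.aestronglyMeasurable

end GMC

/-- **Existence of moments.** Let `γ ∈ (0, √(2d))`, `f` measurable with `0 < c ≤ f ≤ C` on `D`,
and `M` the Gaussian multiplicative chaos measure on `D`. For every open Euclidean ball `O`
with compact closure contained in `D` and every `q ∈ ℝ`, `E[M(O)^q] < ∞` iff `q < 2d/γ²`
(for `q < 0` this in particular asserts `M(O) > 0` a.s., via the `ℝ≥0∞` convention
`0 ^ q = ∞` for `q < 0`). -/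
theorem gmc_moments (hd : 1 ≤ d)
    (g : EuclideanSpace ℝ (Fin d) → EuclideanSpace ℝ (Fin d) → ℝ) (hg : IsBoundedMeasurable g)
    (θ : EuclideanSpace ℝ (Fin d) → ℝ) (hθ : IsMollifier θ)
    {Ω : Type*} [MeasurableSpace Ω] (P : Measure Ω) [IsProbabilityMeasure P]
    (X : ℝ → EuclideanSpace ℝ (Fin d) → Ω → ℝ)
    (hX : IsGaussianFamily P X (mollifiedCov (logKernel g) θ θ))
    (γ : ℝ) (hγ0 : 0 < γ) (hγ2 : γ < Real.sqrt (2 * d))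
    (D : Set (EuclideanSpace ℝ (Fin d))) (hD : IsOpen D) (hDne : D.Nonempty)
    (f : EuclideanSpace ℝ (Fin d) → ℝ) (hfmeas : Measurable f)
    (hfbd : ∃ c C : ℝ, 0 < c ∧ ∀ x ∈ D, c ≤ f x ∧ f x ≤ C)
    (M : Ω → Measure (EuclideanSpace ℝ (Fin d)))
    (hM : IsGMCMeasure P γ X (mollifiedCov (logKernel g) θ θ) f D M)
    (x : EuclideanSpace ℝ (Fin d)) (r : ℝ) (hr : 0 < r)
    (hball : closure (Metric.ball x r) ⊆ D) (q : ℝ) :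
    (∫⁻ ω, (M ω (Metric.ball x r)) ^ q ∂P) < ⊤ ↔ q < 2 * d / γ ^ 2 := by
  obtain ⟨c, C, hc, hfC⟩ := hfbd
  set U := Metric.ball x r with hU
  have hUm : MeasurableSet U := measurableSet_ball
  have hUD : U ⊆ D := subset_closure.trans hball
  have hUc : IsCompact (closure U) :=
    (isCompact_closedBall x r).of_isClosed_subset isClosed_closure
      Metric.closure_ball_subset_closedBall
  have hfc : ∀ y ∈ U, c ≤ f y := fun y hy => (hfC y (hUD hy)).1
  have hfC' : ∀ y ∈ U, f y ≤ C := fun y hy => (hfC y (hUD hy)).2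
  have hxU : x ∈ U := Metric.mem_ball_self hr
  have hC : 0 ≤ C := hc.le.trans ((hfc x hxU).trans (hfC' x hxU))
  have hγd : γ ^ 2 < 2 * d := (Real.lt_sqrt hγ0.le).1 hγ2
  have hγsq : 0 < γ ^ 2 := by positivity
  obtain ⟨C₀, -, hY⟩ := exists_isLogField hd hg hθ hX hγ0.le
  have hP := hX.isGaussianSpace
  have hσfin := isFiniteMeasure_densityMeasure hUm measure_ball_lt_top.ne hfC'
  have hCσ : 0 ≤ C * unitBallVolume d := mul_nonneg hC unitBallVolume_pos.le
  have hσ : ∀ ε, 0 < ε → IsBallRegular (densityMeasure f U) d (C * unitBallVolume d) ε :=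
    fun ε hε => isBallRegular_densityMeasure hUm hC hfC' hε
  have hlim : ∀ A, MeasurableSet A → A ⊆ U →
      IsChaosLimit P (densityMeasure f U) (fun ε y => γ • X ε y) A fun ω => M ω A :=
    fun A hA hAU => hM.isChaosLimit hX hY hfmeas (fun y hy => hc.le.trans (hfc y hy)) hA hAU
      (hUc.of_isClosed_subset isClosed_closure (closure_mono hAU)) ((closure_mono hAU).trans hball)
  have hσb : ∀ z ρ, 0 < ρ → Metric.ball z ρ ⊆ U →
      ENNReal.ofReal (c * unitBallVolume d * ρ ^ (d : ℝ)) ≤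
        densityMeasure f U (Metric.ball z ρ) := fun z ρ hρ hz => by
    refine le_trans (le_of_eq ?_) (le_densityMeasure_apply hfc measurableSet_ball hz)
    rw [volume_ball_eq_ofReal z hρ, ← ENNReal.ofReal_mul hc.le, mul_assoc]
  have hb : 0 < c * unitBallVolume d := mul_pos hc unitBallVolume_pos
  have hMm : Measurable fun ω => M ω U := hM.1 U hUm
  constructor
  · intro hfin
    by_contra! hq
    have htop := lintegral_rpow_critical_eq_top hd hr hP hY hγ0 hγd hCσ hσ hb hσb hM.1
      fun z ρ hz => hlim _ measurableSet_ball hz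
    refine hfin.ne (top_unique ?_)
    have h1 : ∀ ω, M ω U ^ (2 * d / γ ^ 2) ≤ 1 + M ω U ^ q := fun ω => by
      rcases le_total (M ω U) 1 with h | h
      · exact (ENNReal.rpow_le_one h (by positivity)).trans le_self_add
      · exact (ENNReal.rpow_le_rpow_of_exponent_le h hq).trans le_add_self
    have h2 := htop ▸ lintegral_mono (μ := P) h1
    rw [lintegral_add_left measurable_const, lintegral_one, measure_univ, top_le_iff,
      ENNReal.add_eq_top] at h2
    exact (h2.resolve_left ENNReal.one_ne_top).ge
  · intro hq
    rw [lt_div_iff₀ hγsq, mul_comm] at hq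
    rcases lt_trichotomy q 0 with hq0 | rfl | hq0
    · have hσU : densityMeasure f U U ≠ 0 :=
        (lt_of_lt_of_le (ENNReal.ofReal_pos.2 (by positivity)) (hσb x r hr le_rfl)).ne'
      have := (hlim U hUm le_rfl).lintegral_rpow_neg_lt_top hP hY hγ0.le hγd hCσ hσ hr hUm
        Metric.ball_subset_closedBall hσU (neg_pos.2 hq0)
      simpa using this
    · simp
    · exact (hlim U hUm le_rfl).lintegral_rpow_lt_top hP hY hγ0.le hCσ hσ hr hUm
        Metric.ball_subset_closedBall hq0 hq

end
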